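/- Let G be a finite Frobenius group with Frobenius kernel K and Frobenius complement H, and suppose G is not soluble. Then G has perfect order classes if, and only if, K is isomorphic to the direct product of two copies of a cyclic group of order 11^k for some positive integer k, and H is isomorphic to SL(2,5). -/

import Mathlib

/-- The number of elements of order `n` in the group `G`. -/
noncomputable def orderCount (G : Type*) [Group G] (n : ℕ) : ℕ :=
  Nat.card {g : G // orderOf g = n}

/-- A group has *perfect order classes* if, for every positive integer `n`, the number of
elements of order `n` is either zero or a divisor of the order of the group. -/
def PerfectOrderClasses (G : Type*) [Group G] : Prop :=
  ∀ n : ℕ, 0 < n → orderCount G n = 0 ∨ orderCount G n ∣ Nat.card G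

/-- `G` is a Frobenius group with Frobenius kernel `K` and Frobenius complement `H`:
`K` is a nontrivial proper normal subgroup, `H` a subgroup with `K ⊓ H = ⊥` and `KH = G`,
and the conjugation action of `H` on `K` is fixed-point-free. -/
def IsFrobeniusWith {G : Type*} [Group G] (K H : Subgroup G) : Prop :=
  K ≠ ⊥ ∧ K ≠ ⊤ ∧ K.Normal ∧ K ⊓ H = ⊥ ∧
    (∀ g : G, ∃ k ∈ K, ∃ h ∈ H, g = k * h) ∧
    ∀ h ∈ H, h ≠ 1 → ∀ k ∈ K, k ≠ 1 → h * k * h⁻¹ ≠ k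

set_option linter.unusedSectionVars false
set_option linter.unusedSimpArgs false

/-- The order of a group acting freely on a finite set divides the size of the set. -/
theorem card_dvd_card_of_free {A X : Type*} [Group A] [Finite A] [Finite X] [MulAction A X]
    (hfree : ∀ a : A, ∀ x : X, a • x = x → a = 1) : Nat.card A ∣ Nat.card X := by
  classical
  have := Fintype.ofFinite A
  have := Fintype.ofFinite X
  have := Fintype.ofFinite (MulAction.orbitRel.Quotient A X)
  have hB := MulAction.sum_card_fixedBy_eq_card_orbits_mul_card_group A X
  rw [Finset.sum_eq_single (1 : A)] at hB
  · have h1 : MulAction.fixedBy X (1 : A) = Set.univ := by ext; simp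
    rw [Nat.card_eq_fintype_card, Nat.card_eq_fintype_card]
    refine Dvd.intro_left _ (hB.symm.trans ?_)
    rw [← Nat.card_eq_fintype_card, h1, Nat.card_univ, Nat.card_eq_fintype_card]
  · intro a _ ha
    rw [Fintype.card_eq_zero_iff]
    exact ⟨fun x => ha (hfree a x.1 x.2)⟩
  · simp

/-- The number of elements of order `n` is divisible by `φ(n)`. -/
theorem totient_dvd_orderCount (G : Type*) [Group G] [Finite G] (n : ℕ) (hn : 0 < n) :
    n.totient ∣ orderCount G n := by
  have : NeZero n := ⟨hn.ne'⟩
  let act : MulAction (ZMod n)ˣ {g : G // orderOf g = n} :=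
    { smul := fun u g => ⟨g.1 ^ (u : ZMod n).val, by
        rw [orderOf_pow, g.2, Nat.Coprime.gcd_eq_one (ZMod.val_coe_unit_coprime u).symm,
          Nat.div_one]⟩
      one_smul := fun g => by
        apply Subtype.ext
        change g.1 ^ ((1 : (ZMod n)ˣ) : ZMod n).val = g.1
        have h1 : g.1 ^ ((1 : (ZMod n)ˣ) : ZMod n).val = g.1 ^ 1 := by
          rw [pow_inj_mod, g.2, Units.val_one, ← Nat.cast_one, ZMod.val_natCast]
          simp
        rw [h1, pow_one]
      mul_smul := fun u v g => by
        apply Subtype.ext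
        change g.1 ^ ((u * v : (ZMod n)ˣ) : ZMod n).val =
          (g.1 ^ (v : ZMod n).val) ^ (u : ZMod n).val
        rw [← pow_mul, pow_inj_mod, g.2, Units.val_mul, ZMod.val_mul, Nat.mod_mod, mul_comm] }
  have h := card_dvd_card_of_free (A := (ZMod n)ˣ) (X := {g : G // orderOf g = n}) ?_
  · rwa [Nat.card_eq_fintype_card, ZMod.card_units_eq_totient] at h
  · intro u g hg
    have h1 : g.1 ^ (u : ZMod n).val = g.1 := congrArg Subtype.val hg
    have h2 : g.1 ^ (u : ZMod n).val = g.1 ^ 1 := by rw [h1, pow_one]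
    rw [pow_inj_mod, g.2] at h2
    apply Units.ext
    have h3 := (ZMod.natCast_eq_natCast_iff' _ _ n).2 h2
    simpa using h3

theorem orderCount_congr {G G' : Type*} [Group G] [Group G'] (e : G ≃* G') (n : ℕ) :
    orderCount G n = orderCount G' n :=
  Nat.card_congr (e.toEquiv.subtypeEquiv fun g => by simp)

theorem orderCount_ne_zero {G : Type*} [Group G] [Finite G] (g : G) :
    orderCount G (orderOf g) ≠ 0 := by
  have : Nonempty {x : G // orderOf x = orderOf g} := ⟨⟨g, rfl⟩⟩
  exact Nat.card_pos.ne'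

theorem orderCount_pos {G : Type*} [Group G] [Finite G] {n : ℕ} (g : G) (hg : orderOf g = n) :
    0 < orderCount G n := hg ▸ Nat.pos_of_ne_zero (orderCount_ne_zero g)

theorem exists_of_orderCount_ne_zero {G : Type*} [Group G] {n : ℕ}
    (h : orderCount G n ≠ 0) : ∃ g : G, orderOf g = n := by
  by_contra! hcon
  exact h (Nat.card_eq_zero.2 (Or.inl ⟨fun g => hcon g.1 g.2⟩))

theorem PerfectOrderClasses.dvd {G : Type*} [Group G] [Finite G] (h : PerfectOrderClasses G)
    (g : G) : orderCount G (orderOf g) ∣ Nat.card G :=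
  (h _ (orderOf_pos g)).resolve_left (orderCount_ne_zero g)

/-- A nontrivial group with perfect order classes has even order. -/
theorem PerfectOrderClasses.even_card {G : Type*} [Group G] [Finite G] [Nontrivial G]
    (h : PerfectOrderClasses G) : 2 ∣ Nat.card G := by
  obtain ⟨p, hp, hpG⟩ := Nat.exists_prime_and_dvd (Finite.one_lt_card (α := G)).ne'
  have := Fact.mk hp
  obtain ⟨g, hg⟩ := exists_prime_orderOf_dvd_card' p hpG
  rcases hp.eq_two_or_odd' with rfl | hodd
  · exact hpG
  have h1 := h.dvd g
  rw [hg] at h1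
  refine dvd_trans ?_ ((totient_dvd_orderCount G p hp.pos).trans h1)
  rw [Nat.totient_prime hp]
  obtain ⟨m, rfl⟩ := hodd
  simp

namespace IsFrobeniusWith

variable {G : Type*} [Group G] {K H : Subgroup G}

theorem ne_bot (hF : IsFrobeniusWith K H) : K ≠ ⊥ := hF.1

theorem ne_top (hF : IsFrobeniusWith K H) : K ≠ ⊤ := hF.2.1

theorem normal (hF : IsFrobeniusWith K H) : K.Normal := hF.2.2.1

theorem eq_one_of_mem (hF : IsFrobeniusWith K H) {g : G} (hK : g ∈ K) (hH : g ∈ H) : g = 1 := by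
  have : g ∈ K ⊓ H := ⟨hK, hH⟩
  rwa [hF.2.2.2.1, Subgroup.mem_bot] at this

theorem exists_mul (hF : IsFrobeniusWith K H) (g : G) : ∃ k ∈ K, ∃ h ∈ H, g = k * h :=
  hF.2.2.2.2.1 g

theorem eq_one_of_conj_eq (hF : IsFrobeniusWith K H) {h k : G} (hh : h ∈ H) (hk : k ∈ K)
    (h1 : h ≠ 1) (hc : h * k * h⁻¹ = k) : k = 1 := by
  by_contra hk1
  exact hF.2.2.2.2.2 h hh h1 k hk hk1 hc

theorem nontrivial_compl (hF : IsFrobeniusWith K H) : Nontrivial H := by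
  rw [Subgroup.nontrivial_iff_ne_bot]
  rintro rfl
  apply hF.ne_top
  rw [Subgroup.eq_top_iff']
  intro g
  obtain ⟨k, hk, h, hh, rfl⟩ := hF.exists_mul g
  rw [Subgroup.mem_bot] at hh
  simpa [hh] using hk

theorem nontrivial_kernel (hF : IsFrobeniusWith K H) : Nontrivial K :=
  (Subgroup.nontrivial_iff_ne_bot K).2 hF.ne_bot

theorem mul_injective (hF : IsFrobeniusWith K H) {k k' h h' : G} (hk : k ∈ K) (hk' : k' ∈ K)
    (hh : h ∈ H) (hh' : h' ∈ H) (he : k * h = k' * h') : k = k' ∧ h = h' := by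
  have h1 : k'⁻¹ * k = h' * h⁻¹ := by
    rw [inv_mul_eq_iff_eq_mul, ← mul_assoc, eq_mul_inv_iff_mul_eq]; exact he
  have h2 : k'⁻¹ * k = 1 :=
    hF.eq_one_of_mem (K.mul_mem (K.inv_mem hk') hk) (h1 ▸ H.mul_mem hh' (H.inv_mem hh))
  rw [h2] at h1
  exact ⟨(inv_mul_eq_one.1 h2).symm, (mul_inv_eq_one.1 h1.symm).symm⟩

theorem isComplement' (hF : IsFrobeniusWith K H) : K.IsComplement' H := by
  rw [Subgroup.isComplement'_def, Subgroup.IsComplement]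
  constructor
  · rintro ⟨k, h⟩ ⟨k', h'⟩ he
    have h1 := hF.mul_injective k.2 k'.2 h.2 h'.2 he
    exact Prod.ext (Subtype.ext h1.1) (Subtype.ext h1.2)
  · intro g
    obtain ⟨k, hk, h, hh, rfl⟩ := hF.exists_mul g
    exact ⟨(⟨k, hk⟩, ⟨h, hh⟩), rfl⟩

theorem card_mul (hF : IsFrobeniusWith K H) : Nat.card K * Nat.card H = Nat.card G :=
  hF.isComplement'.card_mul_card

/-- Every element of a coset `K h`, `h ∈ H \ {1}`, is conjugate to `h`. -/
theorem exists_conj_eq [Finite G] (hF : IsFrobeniusWith K H) {h k : G} (hh : h ∈ H) (hk : k ∈ K)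
    (h1 : h ≠ 1) : ∃ c : G, k * h = c * h * c⁻¹ := by
  have hn := hF.normal
  let f : K → K := fun c => ⟨c * (h * (c : G)⁻¹ * h⁻¹),
    K.mul_mem c.2 (hn.conj_mem _ (K.inv_mem c.2) h)⟩
  have hinj : Function.Injective f := by
    intro c d hcd
    have h2 : (c : G) * (h * (c : G)⁻¹ * h⁻¹) = d * (h * (d : G)⁻¹ * h⁻¹) :=
      congrArg Subtype.val hcd
    have h3 : h * ((c : G)⁻¹ * d) * h⁻¹ = (c : G)⁻¹ * d := by
      have : (d : G)⁻¹ * (c * (h * (c : G)⁻¹ * h⁻¹)) = h * (d : G)⁻¹ * h⁻¹ := by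
        rw [h2]; group
      calc h * ((c : G)⁻¹ * d) * h⁻¹ = h * (c : G)⁻¹ * h⁻¹ * (h * (d : G)⁻¹ * h⁻¹)⁻¹ := by group
        _ = _ := by rw [← this]; group
    have h4 := hF.eq_one_of_conj_eq hh (K.mul_mem (K.inv_mem c.2) d.2) h1 h3
    exact Subtype.ext (inv_mul_eq_one.1 h4)
  obtain ⟨c, hc⟩ := (Finite.injective_iff_surjective.1 hinj) ⟨k, hk⟩
  refine ⟨c, ?_⟩
  have h2 : (c : G) * (h * (c : G)⁻¹ * h⁻¹) = k := congrArg Subtype.val hc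
  rw [← h2]; group

theorem orderOf_mul [Finite G] (hF : IsFrobeniusWith K H) {h k : G} (hh : h ∈ H) (hk : k ∈ K)
    (h1 : h ≠ 1) : orderOf (k * h) = orderOf h := by
  obtain ⟨c, hc⟩ := hF.exists_conj_eq hh hk h1
  rw [hc, show c * h * c⁻¹ = MulAut.conj c h from rfl]
  exact orderOf_injective (MulAut.conj c).toMonoidHom (MulAut.conj c).injective h

/-- Elements of order `n` in a Frobenius group, counted by kernel and complement. -/
theorem orderCount_eq [Finite G] (hF : IsFrobeniusWith K H) {n : ℕ} (hn : n ≠ 1) :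
    orderCount G n = orderCount K n + Nat.card K * orderCount H n := by
  classical
  have e : {g : G // orderOf g = n} ≃
      {k : K // orderOf k = n} ⊕ (K × {h : H // orderOf h = n}) := by
    symm
    refine Equiv.ofBijective (Sum.elim (fun k => ⟨k.1.1, by rw [Subgroup.orderOf_coe, k.2]⟩)
      fun p => ⟨p.1.1 * p.2.1.1, ?_⟩) ⟨?_, ?_⟩
    · have : (p.2.1.1 : G) ≠ 1 := by
        intro h
        apply hn
        rw [← p.2.2, ← Subgroup.orderOf_coe, h, orderOf_one]
      rw [hF.orderOf_mul p.2.1.2 p.1.2 this, Subgroup.orderOf_coe, p.2.2]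
    · have hne : ∀ h : {h : H // orderOf h = n}, h.1.1 ≠ 1 := by
        intro h h1
        exact hn (by rw [← h.2, ← Subgroup.orderOf_coe, h1, orderOf_one])
      rintro (a | ⟨a, b⟩) (c | ⟨c, d⟩) hac
      · have h1 : a.1.1 = c.1.1 := congrArg (fun x : {g : G // orderOf g = n} => x.1) hac
        exact congrArg Sum.inl (Subtype.ext (Subtype.ext h1))
      · have h1 : a.1.1 = c.1 * d.1.1 := congrArg Subtype.val hac
        rw [← mul_one a.1.1] at h1
        exact absurd (hF.mul_injective a.1.2 c.2 H.one_mem d.1.2 h1).2.symm (hne d)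
      · have h1 : a.1 * b.1.1 = c.1.1 := congrArg Subtype.val hac
        rw [← mul_one c.1.1] at h1
        exact absurd (hF.mul_injective a.2 c.1.2 b.1.2 H.one_mem h1).2 (hne b)
      · have h1 : a.1 * b.1.1 = c.1 * d.1.1 := congrArg Subtype.val hac
        have h2 := hF.mul_injective a.2 c.2 b.1.2 d.1.2 h1
        exact congrArg Sum.inr
          (Prod.ext (Subtype.ext h2.1) (Subtype.ext (Subtype.ext h2.2)))
    · rintro ⟨g, hg⟩
      obtain ⟨k, hk, h, hh, rfl⟩ := hF.exists_mul g
      by_cases h1 : h = 1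
      · subst h1
        refine ⟨Sum.inl ⟨⟨k, hk⟩, ?_⟩, ?_⟩
        · rw [← Subgroup.orderOf_coe]; simpa using hg
        · simp
      · refine ⟨Sum.inr (⟨k, hk⟩, ⟨⟨h, hh⟩, ?_⟩), rfl⟩
        rw [← Subgroup.orderOf_coe, ← hg, hF.orderOf_mul hh hk h1]
  unfold orderCount
  rw [Nat.card_congr e, Nat.card_sum, Nat.card_prod]

/-- The complement acts freely on the elements of order `n ≠ 1` of the kernel. -/
theorem card_dvd_orderCount [Finite G] (hF : IsFrobeniusWith K H) {n : ℕ} (hn : n ≠ 1) :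
    Nat.card H ∣ orderCount K n := by
  have hnorm := hF.normal
  let act : MulAction H {k : K // orderOf k = n} :=
    { smul := fun h k => ⟨⟨h * k.1.1 * (h : G)⁻¹, hnorm.conj_mem _ k.1.2 _⟩, by
        rw [← Subgroup.orderOf_coe]
        exact (orderOf_injective (MulAut.conj (h : G)).toMonoidHom
          (MulAut.conj (h : G)).injective k.1.1).trans ((Subgroup.orderOf_coe k.1).trans k.2)⟩
      one_smul := fun k => by
        apply Subtype.ext; apply Subtype.ext
        change ((1 : H) : G) * k.1.1 * ((1 : H) : G)⁻¹ = k.1.1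
        simp
      mul_smul := fun a b k => by
        apply Subtype.ext; apply Subtype.ext
        change ((a * b : H) : G) * k.1.1 * ((a * b : H) : G)⁻¹ =
          a * (b * k.1.1 * (b : G)⁻¹) * (a : G)⁻¹
        push_cast; group }
  refine card_dvd_card_of_free (A := H) (X := {k : K // orderOf k = n}) ?_
  intro h k hk
  by_contra h1
  have h2 : (h : G) * k.1.1 * (h : G)⁻¹ = k.1.1 := congrArg (fun x => x.1.1) hk
  have h3 := hF.eq_one_of_conj_eq h.2 k.1.2 (fun h => h1 (Subtype.ext h)) h2
  apply hn
  rw [← k.2, ← Subgroup.orderOf_coe, h3, orderOf_one]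

end IsFrobeniusWith

/-- The group `SL(2,5)`. -/
abbrev SL25 : Type := Matrix.SpecialLinearGroup (Fin 2) (ZMod 5)

/-- The order of a matrix in `SL(2,5)` in terms of its entries. -/
def quadOrder (q : ZMod 5 × ZMod 5 × ZMod 5 × ZMod 5) : ℕ :=
  if q.1 + q.2.2.2 = 0 then 4 else if q.1 + q.2.2.2 = 4 then 3
  else if q.1 + q.2.2.2 = 1 then 6
  else if q.1 + q.2.2.2 = 2 then (if q = (1, 0, 0, 1) then 1 else 5)
  else (if q = (4, 0, 0, 4) then 2 else 10)

/-- Quadruples of entries of matrices of determinant one. -/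
abbrev DetOneQuad : Type :=
  {q : ZMod 5 × ZMod 5 × ZMod 5 × ZMod 5 // q.1 * q.2.2.2 - q.2.1 * q.2.2.1 = 1}

/-- `SL(2,5)` as a set of quadruples. -/
def slQuadEquiv : SL25 ≃ DetOneQuad where
  toFun g := ⟨(g.1 0 0, g.1 0 1, g.1 1 0, g.1 1 1), by
    have := g.2; rw [Matrix.det_fin_two] at this; exact this⟩
  invFun q := ⟨!![q.1.1, q.1.2.1; q.1.2.2.1, q.1.2.2.2], by
    rw [Matrix.det_fin_two_of]; exact q.2⟩
  left_inv g := by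
    apply Subtype.ext
    exact (Matrix.eta_fin_two g.1).symm
  right_inv q := by
    apply Subtype.ext
    simp

theorem sl25_sq (g : SL25) :
    (g : Matrix (Fin 2) (Fin 2) (ZMod 5)) ^ 2 =
      (g.1 0 0 + g.1 1 1) • (g : Matrix (Fin 2) (Fin 2) (ZMod 5)) - 1 := by
  have h := g.2
  rw [Matrix.det_fin_two] at h
  have h' := h
  rw [sub_eq_iff_eq_add] at h'
  rw [sq, ← sub_eq_zero]
  ext i j
  fin_cases i <;> fin_cases j <;>
    simp [Matrix.mul_apply, Fin.sum_univ_two, Matrix.sub_apply] <;> grind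

theorem sl25_orderOf (g : SL25) : orderOf g = quadOrder (slQuadEquiv g).1 := by
  have hsq := sl25_sq g
  obtain ⟨t, ht⟩ : ∃ t, t = g.1 0 0 + g.1 1 1 := ⟨_, rfl⟩
  have hone : g = 1 ↔ (slQuadEquiv g).1 = (1, 0, 0, 1) := by
    rw [← slQuadEquiv.apply_eq_iff_eq, Subtype.ext_iff]; rfl
  have hneg : g = -1 ↔ (slQuadEquiv g).1 = (4, 0, 0, 4) := by
    rw [← slQuadEquiv.apply_eq_iff_eq, Subtype.ext_iff]; rfl
  have hcoe : ∀ n : ℕ, g ^ n = 1 ↔ (g : Matrix (Fin 2) (Fin 2) (ZMod 5)) ^ n = 1 := by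
    intro n
    rw [Matrix.SpecialLinearGroup.ext_iff, ← Matrix.ext_iff]; simp
  have h11 : (-1 : SL25) ≠ 1 := by
    intro h
    have := congrArg (fun m : SL25 => m.1 0 0) h
    revert this
    decide
  have hcoen : ∀ n : ℕ, g ^ n = -1 ↔ (g : Matrix (Fin 2) (Fin 2) (ZMod 5)) ^ n = -1 := by
    intro n
    rw [Matrix.SpecialLinearGroup.ext_iff, ← Matrix.ext_iff]; simp
  have h5 : (5 : Matrix (Fin 2) (Fin 2) (ZMod 5)) = 0 := by decide
  obtain ⟨m, hm⟩ : ∃ m : Matrix (Fin 2) (Fin 2) (ZMod 5), m = g := ⟨_, rfl⟩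
  rw [← ht, ← hm] at hsq
  simp only [← hm] at hcoe hcoen
  have hq : quadOrder (slQuadEquiv g).1 = if t = 0 then 4 else if t = 4 then 3
      else if t = 1 then 6 else if t = 2 then (if g = 1 then 1 else 5)
      else (if g = -1 then 2 else 10) := by
    simp only [hone, hneg, ht]
    rfl
  rw [hq]
  have hp2 : Fact (Nat.Prime 2) := ⟨Nat.prime_two⟩
  have hp3 : Fact (Nat.Prime 3) := ⟨Nat.prime_three⟩
  have hcases : ∀ t : ZMod 5, t = 0 ∨ t = 4 ∨ t = 1 ∨ t = 2 ∨ t = 3 := by decide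
  have h_six : ∀ n : ℕ, Nat.Prime n → n ≠ 2 → g ≠ -1 → g ^ n = -1 → orderOf g = 2 * n := by
    intro n hn hn2 hg1 h
    refine orderOf_eq_of_pow_and_pow_div_prime (by have := hn.pos; omega) ?_ ?_
    · rw [mul_comm, pow_mul, h]; simp
    · intro p hp hpd
      rcases (Nat.Prime.dvd_mul hp).1 hpd with hd | hd
      · rw [(Nat.prime_dvd_prime_iff_eq hp Nat.prime_two).1 hd, Nat.mul_div_cancel_left _ two_pos, h]
        exact h11
      · rw [(Nat.prime_dvd_prime_iff_eq hp hn).1 hd, Nat.mul_div_cancel _ hn.pos]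
        intro h2
        obtain ⟨r, hr⟩ := hn.odd_of_ne_two hn2
        rw [hr, pow_add, pow_mul, h2, one_pow, one_mul, pow_one] at h
        exact hg1 h
  rcases hcases t with h | h | h | h | h <;> subst h
  · rw [if_pos rfl]
    have h2 : g ^ 2 = -1 := by rw [hcoen, hsq]; simp
    refine orderOf_eq_prime_pow (p := 2) (n := 1) ?_ ?_
    · rw [pow_one, h2]; exact h11
    · rw [pow_succ, pow_mul, pow_one, h2]; simp
  · rw [if_neg (by decide), if_pos rfl]
    have h4 : (4 : ZMod 5) = -1 := by decide
    rw [h4, neg_one_smul] at hsq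
    refine orderOf_eq_prime ?_ ?_
    · rw [hcoe, pow_succ, hsq, sub_mul, neg_mul, ← sq, hsq]; simp
    · rintro rfl
      revert ht; decide
  · rw [if_neg (by decide), if_neg (by decide), if_pos rfl]
    rw [one_smul] at hsq
    refine h_six 3 Nat.prime_three (by norm_num) ?_ ?_
    · rintro rfl; revert ht; decide
    · rw [hcoen, pow_succ, hsq, sub_mul, ← sq, hsq]; simp
  · rw [if_neg (by decide), if_neg (by decide), if_neg (by decide), if_pos rfl]
    split_ifs with hg
    · rw [hg, orderOf_one]
    · have hp5 : Fact (Nat.Prime 5) := ⟨Nat.prime_five⟩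
      refine orderOf_eq_prime ?_ hg
      rw [hcoe]
      have h2 : m ^ 2 = 2 * m - 1 := by rw [hsq, two_smul, two_mul]
      have h3 : m ^ 5 = 5 * m - 4 := by
        have h4 : m ^ 4 = 4 * m - 3 := by
          rw [show m ^ 4 = (m ^ 2) ^ 2 by rw [← pow_mul], h2]
          have : (2 * m - 1) ^ 2 = 4 * m ^ 2 - 4 * m + 1 := by noncomm_ring
          rw [this, h2]; noncomm_ring; norm_num
        rw [pow_succ, h4, sub_mul, mul_assoc, ← sq, h2]; noncomm_ring; norm_num
      rw [h3, h5, zero_mul, zero_sub, neg_eq_iff_add_eq_zero]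
      rw [← h5]; norm_num
  · rw [if_neg (by decide), if_neg (by decide), if_neg (by decide), if_neg (by decide)]
    split_ifs with hg
    · rw [hg]
      exact orderOf_eq_prime (by simp) h11
    · refine h_six 5 Nat.prime_five (by norm_num) hg ?_
      rw [hcoen]
      have h2 : m ^ 2 = -2 * m - 1 := by
        rw [hsq, show (3 : ZMod 5) = -2 by decide, neg_smul, two_smul]; noncomm_ring
      have h3 : m ^ 5 = 5 * m + 4 := by
        have h4 : m ^ 4 = -4 * m - 3 := by
          rw [show m ^ 4 = (m ^ 2) ^ 2 by rw [← pow_mul], h2]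
          have : (-2 * m - 1) ^ 2 = 4 * m ^ 2 + 4 * m + 1 := by noncomm_ring
          rw [this, h2]; noncomm_ring; norm_num
        rw [pow_succ, h4, sub_mul, mul_assoc, ← sq, h2]; noncomm_ring
      rw [h3, h5, zero_mul, zero_add, ← add_eq_zero_iff_eq_neg]
      rw [← h5]; norm_num

theorem sl25_card : Nat.card SL25 = 120 := by
  rw [Nat.card_congr slQuadEquiv, Nat.card_eq_fintype_card]
  decide +kernel

theorem sl25_orderCount (n : ℕ) :
    orderCount SL25 n = Fintype.card {q : DetOneQuad // quadOrder q.1 = n} := by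
  unfold orderCount
  rw [Nat.card_congr (slQuadEquiv.subtypeEquiv (p := fun g => orderOf g = n)
    (q := fun q => quadOrder q.1 = n) fun g => by rw [sl25_orderOf]), Nat.card_eq_fintype_card]

theorem sl25_orderCount_values :
    orderCount SL25 1 = 1 ∧ orderCount SL25 2 = 1 ∧ orderCount SL25 3 = 20 ∧
    orderCount SL25 4 = 30 ∧ orderCount SL25 5 = 24 ∧ orderCount SL25 6 = 20 ∧
    orderCount SL25 10 = 24 := by
  simp only [sl25_orderCount]
  decide +kernel

theorem sl25_orderOf_mem (g : SL25) : orderOf g ∈ ({1, 2, 3, 4, 5, 6, 10} : Finset ℕ) := by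
  rw [sl25_orderOf, quadOrder]
  split_ifs <;> simp

theorem sl25_orderCount_dvd (n : ℕ) : orderCount SL25 n = 0 ∨ orderCount SL25 n ∣ 120 := by
  by_cases h : orderCount SL25 n = 0
  · exact Or.inl h
  right
  obtain ⟨g, rfl⟩ := exists_of_orderCount_ne_zero h
  obtain ⟨h1, h2, h3, h4, h5, h6, h10⟩ := sl25_orderCount_values
  have := sl25_orderOf_mem g
  simp only [Finset.mem_insert, Finset.mem_singleton] at this
  rcases this with h | h | h | h | h | h | h <;> rw [h] <;> simp only [*] <;> decide

theorem card_pow_eq_one_eq_sum (G : Type*) [Group G] [Finite G] {d : ℕ} (hd : d ≠ 0) :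
    Nat.card {g : G // g ^ d = 1} = ∑ m ∈ d.divisors, orderCount G m := by
  classical
  have := Fintype.ofFinite G
  rw [Nat.card_eq_fintype_card, Fintype.card_subtype]
  refine Eq.trans (by congr) ((sum_card_orderOf_eq_card_pow_eq_one hd).symm.trans ?_)
  refine Finset.sum_congr rfl fun m _ => ?_
  rw [orderCount, Nat.card_eq_fintype_card, Fintype.card_subtype]

theorem card_pow_eq_one_congr {G G' : Type*} [Group G] [Group G'] (e : G ≃* G') (d : ℕ) :
    Nat.card {g : G // g ^ d = 1} = Nat.card {g : G' // g ^ d = 1} :=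
  Nat.card_congr (e.toEquiv.subtypeEquiv fun g => by simp [← map_pow])

theorem card_pow_eq_one_pi {ι : Type*} [Fintype ι] (n : ι → ℕ) (hn : ∀ i, 0 < n i) (d : ℕ) :
    Nat.card {g : (∀ i, Multiplicative (ZMod (n i))) // g ^ d = 1} = ∏ i, (n i).gcd d := by
  have e : {g : (∀ i, Multiplicative (ZMod (n i))) // g ^ d = 1} ≃
      ∀ i, (powMonoidHom d : Multiplicative (ZMod (n i)) →* _).ker :=
    { toFun := fun g i => ⟨g.1 i, congrFun g.2 i⟩
      invFun := fun g => ⟨fun i => (g i).1, funext fun i => (g i).2⟩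
      left_inv := fun g => rfl
      right_inv := fun g => rfl }
  rw [Nat.card_congr e, Nat.card_pi]
  refine Finset.prod_congr rfl fun i _ => ?_
  have := NeZero.of_pos (hn i)
  rw [IsCyclic.card_powMonoidHom_ker]
  simp

theorem orderCount_one (G : Type*) [Group G] : orderCount G 1 = 1 := by
  have : Unique {g : G // orderOf g = 1} :=
    ⟨⟨⟨1, orderOf_one⟩⟩, fun g => Subtype.ext (orderOf_eq_one_iff.1 g.2)⟩
  exact Nat.card_unique

theorem orderCount_prime_pow (G : Type*) [Group G] [Finite G] {p : ℕ} (hp : p.Prime) (j : ℕ) :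
    orderCount G (p ^ (j + 1)) + Nat.card {g : G // g ^ p ^ j = 1} =
      Nat.card {g : G // g ^ p ^ (j + 1) = 1} := by
  rw [card_pow_eq_one_eq_sum _ (pow_ne_zero _ hp.ne_zero),
    card_pow_eq_one_eq_sum _ (pow_ne_zero _ hp.ne_zero), Nat.divisors_prime_pow hp,
    Nat.divisors_prime_pow hp, Finset.sum_map, Finset.sum_map, Finset.sum_range_succ _ (j + 1),
    add_comm]
  rfl

theorem card_pow_prime_eq_one (G : Type*) [Group G] [Finite G] {p : ℕ} (hp : p.Prime) :
    Nat.card {g : G // g ^ p = 1} = 1 + orderCount G p := by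
  rw [card_pow_eq_one_eq_sum _ hp.ne_zero, hp.sum_divisors, orderCount_one, add_comm]

/-- Sizes of the order classes of `C × C` with `C` cyclic of order `11 ^ k`. -/
theorem orderCount_homocyclic (k j : ℕ) (hj : j < k) :
    orderCount (Fin 2 → Multiplicative (ZMod (11 ^ k))) (11 ^ (j + 1)) = 120 * 11 ^ (2 * j) := by
  have : NeZero (11 ^ k) := ⟨by positivity⟩
  have h := orderCount_prime_pow (Fin 2 → Multiplicative (ZMod (11 ^ k)))
    (p := 11) (by norm_num) j
  have hg : ∀ i ≤ k, (11 ^ k).gcd (11 ^ i) = 11 ^ i := fun i hi =>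
    Nat.gcd_eq_right (pow_dvd_pow 11 hi)
  rw [card_pow_eq_one_pi (fun _ : Fin 2 => 11 ^ k) (fun _ => by positivity),
    card_pow_eq_one_pi (fun _ : Fin 2 => 11 ^ k) (fun _ => by positivity)] at h
  simp only [hg j hj.le, hg (j + 1) hj, Finset.prod_const, Finset.card_univ, Fintype.card_fin] at h
  rw [← pow_mul, ← pow_mul, show (j + 1) * 2 = 2 * j + 2 by ring, mul_comm j 2, pow_add 11 (2 * j)]
    at h
  omega

/-- A Frobenius group with kernel homocyclic of rank two and exponent `11 ^ k` and complement
`SL(2,5)` has perfect order classes. -/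
theorem perfectOrderClasses_of_homocyclic {G : Type*} [Group G] [Finite G] {K H : Subgroup G}
    (hF : IsFrobeniusWith K H) {k : ℕ}
    (eK : K ≃* (Fin 2 → Multiplicative (ZMod (11 ^ k)))) (eH : H ≃* SL25) :
    PerfectOrderClasses G := by
  intro n _
  have : NeZero (11 ^ k) := ⟨by positivity⟩
  have hK : Nat.card K = 11 ^ (2 * k) := by
    rw [Nat.card_congr eK.toEquiv]
    simp [← pow_mul, mul_comm]
  have hH : Nat.card H = 120 := by rw [Nat.card_congr eH.toEquiv, sl25_card]
  by_cases hn1 : n = 1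
  · subst hn1
    rw [orderCount_one]; exact Or.inr (one_dvd _)
  rw [hF.orderCount_eq hn1, ← hF.card_mul, hK, hH, orderCount_congr eH]
  by_cases h0 : orderCount K n = 0
  · rw [h0, zero_add]
    rcases sl25_orderCount_dvd n with h | h
    · left; rw [h, mul_zero]
    · right; exact Nat.mul_dvd_mul_left _ h
  · right
    obtain ⟨g, hg⟩ := exists_of_orderCount_ne_zero h0
    have hgp : g ^ 11 ^ k = 1 := by
      apply eK.injective
      rw [map_pow, map_one]
      funext i
      have := pow_card_eq_one' (x := eK g i)
      simpa using this
    have hd : n ∣ 11 ^ k := hg ▸ orderOf_dvd_of_pow_eq_one hgp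
    obtain ⟨j, hj, rfl⟩ := (Nat.dvd_prime_pow (by norm_num)).1 hd
    obtain ⟨j, rfl⟩ : ∃ i, j = i + 1 := Nat.exists_eq_succ_of_ne_zero (by rintro rfl; simp at hn1)
    have h1 : orderCount SL25 (11 ^ (j + 1)) = 0 := by
      by_contra hne
      obtain ⟨x, hx⟩ := exists_of_orderCount_ne_zero hne
      have h2 : 11 ∣ 120 := by
        rw [← sl25_card]
        exact ((dvd_pow_self 11 (Nat.succ_ne_zero j)).trans hx.symm.dvd).trans (orderOf_dvd_natCard x)
      norm_num at h2
    rw [h1, mul_zero, add_zero, orderCount_congr eK, orderCount_homocyclic k j hj, mul_comm]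
    exact Nat.mul_dvd_mul_right (pow_dvd_pow _ (by omega)) _

/-- An abelian group of order prime to `120` all of whose nontrivial order classes have size
divisible by `120` and dividing `120 * |K|` is homocyclic of rank two for the prime `11`. -/
theorem exists_equiv_homocyclic (K : Type*) [CommGroup K] [Finite K] [Nontrivial K]
    (hco : (Nat.card K).Coprime 120) (hdvd : ∀ n, n ≠ 1 → 120 ∣ orderCount K n)
    (hpoc : ∀ n, n ≠ 1 → orderCount K n = 0 ∨ orderCount K n ∣ Nat.card K * 120) :
    ∃ k : ℕ, 0 < k ∧ Nonempty (K ≃* (Fin 2 → Multiplicative (ZMod (11 ^ k)))) := by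
  classical
  obtain ⟨ι, _, n, hn, ⟨e⟩⟩ := CommGroup.equiv_prod_multiplicative_zmod_of_finite K
  have hT : ∀ d, Nat.card {g : K // g ^ d = 1} = ∏ i, (n i).gcd d := fun d => by
    rw [card_pow_eq_one_congr e, card_pow_eq_one_pi n (fun i => by have := hn i; omega)]
  have hcard : Nat.card K = ∏ i, n i := by
    have : ∀ i, NeZero (n i) := fun i => ⟨by have := hn i; omega⟩
    rw [Nat.card_congr e.toEquiv, Nat.card_pi]
    simp
  obtain ⟨p, hp, hpK⟩ := Nat.exists_prime_and_dvd (Finite.one_lt_card (α := K)).ne'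
  have hpf := Fact.mk hp
  have hpos : ∀ q, q.Prime → q ∣ Nat.card K → 0 < orderCount K q := by
    intro q hq hqK
    have := Fact.mk hq
    obtain ⟨g, hg⟩ := exists_prime_orderOf_dvd_card' q hqK
    exact orderCount_pos g hg
  have huniq : ∀ q, q.Prime → q ∣ Nat.card K → q = p := by
    intro q hq hqK
    by_contra hqp
    have hcop : p.Coprime q := (Nat.coprime_primes hp hq).2 (Ne.symm hqp)
    have h1 : Nat.card {g : K // g ^ (p * q) = 1} =
        Nat.card {g : K // g ^ p = 1} * Nat.card {g : K // g ^ q = 1} := by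
      rw [hT, hT, hT, ← Finset.prod_mul_distrib]
      exact Finset.prod_congr rfl fun i _ => Nat.Coprime.gcd_mul _ hcop
    have hne1 : p * q ≠ 1 := fun h => hp.one_lt.ne' (Nat.eq_one_of_mul_eq_one_right h)
    have hdiv : (p * q).divisors = {1, p, q, p * q} := by
      ext d
      simp only [Nat.mem_divisors, Finset.mem_insert, Finset.mem_singleton]
      constructor
      · rintro ⟨hd, -⟩
        obtain ⟨b, c, hb, hc, rfl⟩ := Nat.dvd_mul.1 hd
        rcases (Nat.dvd_prime hp).1 hb with rfl | rfl <;>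
          rcases (Nat.dvd_prime hq).1 hc with rfl | rfl <;> simp
      · rintro (rfl | rfl | rfl | rfl) <;> simp [hp.ne_zero, hq.ne_zero]
    have h2 : Nat.card {g : K // g ^ (p * q) = 1} =
        1 + orderCount K p + orderCount K q + orderCount K (p * q) := by
      rw [card_pow_eq_one_eq_sum _ (mul_ne_zero hp.ne_zero hq.ne_zero),
        hdiv, Finset.sum_insert, Finset.sum_insert, Finset.sum_pair, orderCount_one]
      · ring
      · exact fun h => hp.one_lt.ne' (Nat.eq_of_mul_eq_mul_right hq.pos (by rw [← h, one_mul]))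
      · simp only [Finset.mem_insert, Finset.mem_singleton, not_or]
        exact ⟨Ne.symm hqp, fun h => hq.one_lt.ne' (Nat.eq_of_mul_eq_mul_left hp.pos
          (by rw [← h, mul_one]))⟩
      · simp only [Finset.mem_insert, Finset.mem_singleton, not_or]
        exact ⟨hp.one_lt.ne, hq.one_lt.ne, hne1.symm⟩
    rw [h2, card_pow_prime_eq_one K hp, card_pow_prime_eq_one K hq] at h1
    have h3 : orderCount K (p * q) = orderCount K p * orderCount K q := by linarith
    have h4 := (hpoc (p * q) hne1).resolve_left (by
      rw [h3]; exact (Nat.mul_pos (hpos p hp hpK) (hpos q hq hqK)).ne')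
    rw [h3] at h4
    have h5 := (Nat.mul_dvd_mul (hdvd p hp.ne_one) (hdvd q hq.ne_one)).trans h4
    have h6 : 120 ∣ Nat.card K := Nat.dvd_of_mul_dvd_mul_right (by norm_num) h5
    have := Nat.Coprime.eq_one_of_dvd hco.symm h6
    norm_num at this
  have hni : ∀ i, ∃ a, 0 < a ∧ n i = p ^ a := by
    intro i
    have hdv : n i ∣ Nat.card K := hcard ▸ Finset.dvd_prod_of_mem n (Finset.mem_univ i)
    have h1 := Nat.eq_prime_pow_of_unique_prime_dvd (n := n i) (p := p)
      (by have := hn i; omega) (fun {d} hd hdn => huniq d hd (hdn.trans hdv))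
    refine ⟨_, Nat.pos_of_ne_zero fun h => ?_, h1⟩
    rw [h, pow_zero] at h1
    have := hn i; omega
  choose a ha0 ha using hni
  have hfp : Nat.card {g : K // g ^ p = 1} = p ^ Fintype.card ι := by
    rw [hT, ← Finset.card_univ, ← Finset.prod_const]
    refine Finset.prod_congr rfl fun i _ => ?_
    rw [ha i, Nat.gcd_comm]
    exact Nat.gcd_eq_left (dvd_pow_self p (ha0 i).ne')
  rw [card_pow_prime_eq_one K hp] at hfp
  have h120 : orderCount K p = 120 := by
    refine Nat.dvd_antisymm ?_ (hdvd p hp.ne_one)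
    have h1 := (hpoc p hp.ne_one).resolve_left (hpos p hp hpK).ne'
    refine Nat.Coprime.dvd_of_dvd_mul_left ?_ h1
    rw [Nat.coprime_comm]
    rw [Nat.eq_prime_pow_of_unique_prime_dvd (n := Nat.card K) (p := p) Nat.card_pos.ne'
      (fun {d} hd hdn => huniq d hd hdn)]
    refine Nat.Coprime.pow_left _ ((Nat.Prime.coprime_iff_not_dvd hp).2 fun hd => ?_)
    have h2 : p ∣ 1 + orderCount K p := by
      rw [hfp]
      refine dvd_pow_self p ?_
      rintro h0
      rw [h0, pow_zero] at hfp
      have := hpos p hp hpK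
      omega
    exact hp.one_lt.ne' (Nat.dvd_one.1 ((Nat.dvd_add_left hd).1 h2))
  rw [h120] at hfp
  have hp11 : p = 11 := by
    have h1 : p ∣ 11 ^ 2 := by
      rw [show 11 ^ 2 = 1 + 120 by norm_num, hfp]
      refine dvd_pow_self p ?_
      rintro h0
      rw [h0, pow_zero] at hfp
      omega
    exact (Nat.prime_dvd_prime_iff_eq hp (by norm_num)).1 (hp.dvd_of_dvd_pow h1)
  subst hp11
  have hι : Fintype.card ι = 2 := by
    have : 11 ^ 2 = 11 ^ Fintype.card ι := by rw [← hfp]; norm_num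
    exact (Nat.pow_right_injective (le_refl _ |>.trans (by norm_num : 2 ≤ 11)) this).symm
  let f : Fin 2 ≃ ι := (Fintype.equivFinOfCardEq hι).symm
  have hlt : ∀ b c : ι, (∀ i, i = b ∨ i = c) → b ≠ c → ¬ a b < a c := by
    intro b c hbc hne hlt
    have huniv : (Finset.univ : Finset ι) = {b, c} := by
      ext i; simpa using hbc i
    obtain ⟨d, hd⟩ : ∃ d, a c = d + 1 := Nat.exists_eq_succ_of_ne_zero (ha0 c).ne'
    have h1 := orderCount_prime_pow K (p := 11) (by norm_num) d
    rw [hT, hT, huniv, Finset.prod_pair hne, Finset.prod_pair hne, ha b, ha c, hd,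
      Nat.gcd_eq_left (pow_dvd_pow 11 (by omega : a b ≤ d)),
      Nat.gcd_eq_right (pow_dvd_pow 11 (by omega : d ≤ d + 1)),
      Nat.gcd_eq_left (pow_dvd_pow 11 (by omega : a b ≤ d + 1)), Nat.gcd_self] at h1
    have h2 : orderCount K (11 ^ (d + 1)) = 11 ^ (a b + d) * 10 := by
      rw [pow_succ 11 d] at h1 ⊢
      rw [pow_add]
      linarith
    have h3 := hdvd (11 ^ (d + 1)) (by simp)
    rw [h2, show 120 = 12 * 10 by norm_num] at h3
    have h4 : 12 ∣ 11 ^ (a b + d) := Nat.dvd_of_mul_dvd_mul_right (by norm_num) h3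
    have h5 : Nat.Coprime 12 (11 ^ (a b + d)) := Nat.Coprime.pow_right _ (by norm_num)
    have := Nat.Coprime.eq_one_of_dvd h5 h4
    norm_num at this
  have hf01 : f 0 ≠ f 1 := fun h => by simpa using f.injective h
  have hcov : ∀ i, i = f 0 ∨ i = f 1 := by
    intro i
    obtain ⟨j, rfl⟩ := f.surjective i
    fin_cases j <;> simp
  have haeq : a (f 0) = a (f 1) :=
    le_antisymm (not_lt.1 (hlt _ _ (fun i => (hcov i).symm) hf01.symm)) (not_lt.1 (hlt _ _ hcov hf01))
  refine ⟨a (f 0), ha0 _, ⟨e.trans ?_⟩⟩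
  have hall : ∀ i, n i = 11 ^ a (f 0) := by
    intro i
    rcases hcov i with h | h
    · rw [h, ha]
    · rw [h, ha, ← haeq]
  have hn' : n = fun _ => 11 ^ a (f 0) := funext hall
  clear_value f
  rw [hn']
  exact { Equiv.arrowCongr f.symm (Equiv.refl _) with map_mul' := fun _ _ => rfl }

section

open MonoidAlgebra

/-- The sum of the powers of `g` in the group algebra. -/
noncomputable def normElement (R : Type*) {H : Type*} [CommRing R] [Group H] (g : H) :
    MonoidAlgebra R H :=
  ∑ i ∈ Finset.range (orderOf g), MonoidAlgebra.of R H (g ^ i)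

/-- The left ideal generated by the norm elements of the subgroups of prime order. -/
noncomputable def normIdeal (R H : Type*) [CommRing R] [Group H] : Ideal (MonoidAlgebra R H) :=
  Ideal.span {x | ∃ g : H, (orderOf g).Prime ∧ x = normElement R g}

section NormIdeal

variable {R H : Type*} [CommRing R] [Group H]

theorem normElement_mul_of (g h : H) :
    normElement R g * MonoidAlgebra.of R H h =
      MonoidAlgebra.of R H h * normElement R (h⁻¹ * g * h) := by
  have h1 : orderOf (h⁻¹ * g * h) = orderOf g := by
    have := orderOf_injective (MulAut.conj h⁻¹).toMonoidHom (MulAut.conj h⁻¹).injective g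
    simpa using this
  have h2 : ∀ i : ℕ, (h⁻¹ * g * h) ^ i = h⁻¹ * g ^ i * h := fun i => by
    have := conj_pow (i := i) (a := h⁻¹) (b := g)
    simpa using this
  rw [normElement, normElement, h1, Finset.sum_mul, Finset.mul_sum]
  refine Finset.sum_congr rfl fun i _ => ?_
  rw [← map_mul, ← map_mul, h2]
  congr 1
  group

theorem normElement_mul_mem {g : H} (hg : (orderOf g).Prime) (a : MonoidAlgebra R H) :
    normElement R g * a ∈ normIdeal R H := by
  induction a using MonoidAlgebra.induction_on with
  | of h =>
    rw [normElement_mul_of]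
    refine Ideal.mul_mem_left _ _ (Ideal.subset_span ⟨_, ?_, rfl⟩)
    have := orderOf_injective (MulAut.conj h⁻¹).toMonoidHom (MulAut.conj h⁻¹).injective g
    have h1 : orderOf (h⁻¹ * g * h) = orderOf g := by simpa using this
    rwa [h1]
  | add x y hx hy => rw [mul_add]; exact add_mem hx hy
  | smul r x hx =>
    rw [mul_smul_comm]
    exact Submodule.smul_of_tower_mem _ r hx

theorem of_mul_normElement [Finite H] (g : H) :
    MonoidAlgebra.of R H g * normElement R g = normElement R g := by
  obtain ⟨n, hn⟩ : ∃ n, orderOf g = n + 1 :=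
    Nat.exists_eq_succ_of_ne_zero (orderOf_pos g).ne'
  rw [normElement, Finset.mul_sum, hn, Finset.sum_range_succ, Finset.sum_range_succ']
  congr 1
  · exact Finset.sum_congr rfl fun i _ => by rw [← map_mul, ← pow_succ']
  · rw [← map_mul, ← pow_succ', ← hn, pow_orderOf_eq_one, pow_zero]

theorem of_pow_mul_normElement [Finite H] (g : H) (i : ℕ) :
    MonoidAlgebra.of R H (g ^ i) * normElement R g = normElement R g := by
  induction i with
  | zero => rw [pow_zero, map_one, one_mul]
  | succ i ih => rw [pow_succ, map_mul, mul_assoc, of_mul_normElement, ih]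

theorem normElement_sq [Finite H] (g : H) :
    normElement R g * normElement R g = (orderOf g : R) • normElement R g := by
  conv_lhs => lhs; rw [normElement]
  rw [Finset.sum_mul, Finset.sum_congr rfl fun i _ => of_pow_mul_normElement g i]
  rw [Finset.sum_const, Finset.card_range, Nat.cast_smul_eq_nsmul]

theorem mapRingHom_normElement {S : Type*} [CommRing S] (f : R →+* S) (g : H) :
    MonoidAlgebra.mapRingHom H f (normElement R g) = normElement S g := by
  rw [normElement, normElement, map_sum]
  exact Finset.sum_congr rfl fun i _ => by simp

end NormIdeal

section Reduction

variable {H : Type*} [Group H] [Finite H] {p : ℕ} [Fact p.Prime]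

theorem exists_eq_smul_of_castHom_eq_zero (k : ℕ) (hk : k ≠ 0) (x : ZMod (p ^ k))
    (hx : ZMod.castHom (dvd_pow_self p hk) (ZMod p) x = 0) : ∃ y, x = (p : ZMod (p ^ k)) * y := by
  have : NeZero (p ^ k) := ⟨pow_ne_zero _ (Fact.out : p.Prime).ne_zero⟩
  obtain ⟨n, rfl⟩ := ZMod.natCast_zmod_surjective x
  rw [map_natCast, ZMod.natCast_eq_zero_iff] at hx
  obtain ⟨m, rfl⟩ := hx
  exact ⟨m, by push_cast; rfl⟩

theorem exists_eq_smul_of_mapRingHom_eq_zero (k : ℕ) (hk : k ≠ 0)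
    (x : MonoidAlgebra (ZMod (p ^ k)) H)
    (hx : MonoidAlgebra.mapRingHom H (ZMod.castHom (dvd_pow_self p hk) (ZMod p)) x = 0) :
    ∃ y, x = (p : ZMod (p ^ k)) • y := by
  have h1 : ∀ h, ∃ y, x.coeff h = (p : ZMod (p ^ k)) * y := fun h => by
    apply exists_eq_smul_of_castHom_eq_zero k hk
    have := congrArg (fun z => z.coeff h) hx
    simpa using this
  choose f hf using h1
  refine ⟨.ofCoeff (Finsupp.equivFunOnFinite.symm f), ?_⟩
  ext h
  simpa using hf h

/-- A left ideal spanned by norm elements that is proper modulo `p` is proper over `ℚ`. -/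
theorem one_notMem_normIdeal_rat (hp : ¬ p ∣ Nat.card H)
    (htop : normIdeal (ZMod p) H ≠ ⊤) : (1 : MonoidAlgebra ℚ H) ∉ normIdeal ℚ H := by
  intro hone
  have hpp : p.Prime := Fact.out
  -- clear denominators
  have hden : ∀ a : MonoidAlgebra ℚ H, ∃ n : ℕ, 0 < n ∧ ∃ b : MonoidAlgebra ℤ H,
      MonoidAlgebra.mapRingHom H (Int.castRingHom ℚ) b = (n : ℚ) • a := by
    intro a
    induction a using MonoidAlgebra.induction_on with
    | of h => exact ⟨1, one_pos, MonoidAlgebra.of ℤ H h, by simp⟩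
    | add x y hx hy =>
      obtain ⟨n, hn, b, hb⟩ := hx
      obtain ⟨m, hm, c, hc⟩ := hy
      refine ⟨n * m, Nat.mul_pos hn hm, m • b + n • c, ?_⟩
      rw [map_add, map_nsmul, map_nsmul, hb, hc, smul_add, ← Nat.cast_smul_eq_nsmul ℚ,
        ← Nat.cast_smul_eq_nsmul ℚ, smul_smul, smul_smul]
      push_cast
      rw [mul_comm (m : ℚ)]
    | smul r x hx =>
      obtain ⟨n, hn, b, hb⟩ := hx
      refine ⟨r.den * n, Nat.mul_pos r.den_pos hn, r.num • b, ?_⟩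
      rw [map_zsmul, hb, ← Int.cast_smul_eq_zsmul ℚ, smul_smul, smul_smul]
      congr 1
      push_cast
      have := Rat.mul_den_eq_num r
      rw [← this]; ring
  have h_int : ∀ x ∈ normIdeal ℚ H, ∃ n : ℕ, 0 < n ∧ ∃ y ∈ normIdeal ℤ H,
      MonoidAlgebra.mapRingHom H (Int.castRingHom ℚ) y = (n : ℚ) • x := by
    intro x hx
    induction hx using Submodule.span_induction with
    | mem x hx =>
      obtain ⟨g, hg, rfl⟩ := hx
      exact ⟨1, one_pos, normElement ℤ g, Ideal.subset_span ⟨g, hg, rfl⟩, by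
        rw [mapRingHom_normElement]; simp⟩
    | zero => exact ⟨1, one_pos, 0, zero_mem _, by simp⟩
    | add x y _ _ hx hy =>
      obtain ⟨n, hn, b, hb, hb'⟩ := hx
      obtain ⟨m, hm, c, hc, hc'⟩ := hy
      refine ⟨n * m, Nat.mul_pos hn hm, m • b + n • c,
        add_mem (nsmul_mem hb _) (nsmul_mem hc _), ?_⟩
      rw [map_add, map_nsmul, map_nsmul, hb', hc', smul_add, ← Nat.cast_smul_eq_nsmul ℚ,
        ← Nat.cast_smul_eq_nsmul ℚ, smul_smul, smul_smul]
      push_cast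
      rw [mul_comm (m : ℚ)]
    | smul a x _ hx =>
      obtain ⟨n, hn, b, hb, hb'⟩ := hx
      obtain ⟨m, hm, c, hc⟩ := hden a
      refine ⟨m * n, Nat.mul_pos hm hn, c * b, Ideal.mul_mem_left _ _ hb, ?_⟩
      rw [map_mul, hc, hb', smul_mul_smul_comm, smul_eq_mul]
      push_cast; rfl
  obtain ⟨m, hm, y, hy, hym⟩ := h_int 1 hone
  have hy1 : y = (m : MonoidAlgebra ℤ H) := by
    apply MonoidAlgebra.map_injective (Int.castRingHom ℚ : ℤ →+ ℚ) Int.cast_injective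
    change MonoidAlgebra.mapRingHom H (Int.castRingHom ℚ) y =
      MonoidAlgebra.mapRingHom H (Int.castRingHom ℚ) m
    rw [hym, map_natCast, Nat.cast_smul_eq_nsmul, nsmul_one]
  subst hy1
  -- idempotents modulo `p` and modulo `p ^ m`
  have hne : NeZero (Nat.card H : ZMod p) := ⟨by rwa [Ne, ZMod.natCast_eq_zero_iff]⟩
  obtain ⟨f, hf, hI⟩ := IsSemisimpleRing.ideal_eq_span_idempotent (normIdeal (ZMod p) H)
  have hmul : ∀ x ∈ normIdeal (ZMod p) H, x * (1 - f) = 0 := by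
    intro x hx
    rw [hI, Ideal.mem_span_singleton'] at hx
    obtain ⟨a, rfl⟩ := hx
    rw [mul_sub, mul_one, mul_assoc, hf.eq, sub_self]
  have hf1 : (1 : MonoidAlgebra (ZMod p) H) - f ≠ 0 := by
    intro h
    apply htop
    rw [hI, ← sub_eq_zero.1 h, Ideal.span_singleton_one]
  have hk : m ≠ 0 := hm.ne'
  let π := MonoidAlgebra.mapRingHom H (ZMod.castHom (dvd_pow_self p hk) (ZMod p))
  have hsurj : Function.Surjective π :=
    MonoidAlgebra.map_surjective _ (ZMod.castHom_surjective (dvd_pow_self p hk))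
  have hpm : ((p : ZMod (p ^ m)) ^ m) = 0 := by
    rw [← Nat.cast_pow, ZMod.natCast_self]
  obtain ⟨e, he, hπe⟩ := exists_isIdempotentElem_eq_of_ker_isNilpotent π (by
    intro x hx
    obtain ⟨y, rfl⟩ := exists_eq_smul_of_mapRingHom_eq_zero m hk x hx
    exact ⟨m, by rw [smul_pow, hpm, zero_smul]⟩) (1 - f) (hsurj _) hf.one_sub
  have hkill : ∀ g : H, (orderOf g).Prime → normElement (ZMod (p ^ m)) g * e = 0 := by
    intro g hg
    have hq : IsUnit ((orderOf g : ℕ) : ZMod (p ^ m)) := by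
      rw [ZMod.isUnit_iff_coprime]
      refine Nat.Coprime.pow_right _ (Nat.coprime_comm.1 ((Nat.Prime.coprime_iff_not_dvd hpp).2 ?_))
      exact fun h => hp (h.trans (orderOf_dvd_natCard g))
    obtain ⟨c, hc⟩ := hq.exists_left_inv
    have hbase : ∀ a, ∃ b, normElement (ZMod (p ^ m)) g * a * e = (p : ZMod (p ^ m)) • b := by
      intro a
      apply exists_eq_smul_of_mapRingHom_eq_zero m hk
      change π _ = 0
      rw [map_mul, map_mul, hπe, mapRingHom_normElement]
      exact hmul _ (normElement_mul_mem hg _)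
    have hstep : ∀ j : ℕ, ∃ b, normElement (ZMod (p ^ m)) g * e = ((p : ZMod (p ^ m)) ^ j) • b := by
      intro j
      induction j with
      | zero => exact ⟨_, by rw [pow_zero, one_smul]⟩
      | succ j ih =>
        obtain ⟨b, hb⟩ := ih
        obtain ⟨d, hd⟩ := hbase b
        refine ⟨c • d, ?_⟩
        calc normElement (ZMod (p ^ m)) g * e
            = c • (normElement (ZMod (p ^ m)) g * (normElement (ZMod (p ^ m)) g * e) * e) := by
              rw [← mul_assoc, normElement_sq, mul_assoc, he.eq, smul_mul_assoc, smul_smul, hc,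
                one_smul]
          _ = _ := by
              rw [hb, mul_smul_comm, smul_mul_assoc, hd, smul_smul, smul_smul, smul_smul]
              congr 1; ring
    obtain ⟨b, hb⟩ := hstep m
    rw [hb, hpm, zero_smul]
  have hall : ∀ x ∈ normIdeal ℤ H,
      MonoidAlgebra.mapRingHom H (Int.castRingHom (ZMod (p ^ m))) x * e = 0 := by
    intro x hx
    induction hx using Submodule.span_induction with
    | mem x hx =>
      obtain ⟨g, hg, rfl⟩ := hx
      rw [mapRingHom_normElement, hkill g hg]
    | zero => simp
    | add x y _ _ hx hy => rw [map_add, add_mul, hx, hy, add_zero]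
    | smul a x _ hx => rw [smul_eq_mul, map_mul, mul_assoc, hx, mul_zero]
  have hme := hall _ hy
  rw [map_natCast] at hme
  obtain ⟨h, hh⟩ : ∃ h, (1 - f).coeff h ≠ 0 := by
    by_contra! hcon
    exact hf1 (by ext h; simpa using hcon h)
  rw [← hπe] at hh
  have hh' : ZMod.castHom (dvd_pow_self p hk) (ZMod p) (e.coeff h) ≠ 0 := by
    simpa [π] using hh
  have hmc : (m : ZMod (p ^ m)) * e.coeff h = 0 := by
    have := congrArg (fun z => z.coeff h) hme
    simpa [← nsmul_eq_mul] using this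
  have : NeZero (p ^ m) := ⟨pow_ne_zero _ hpp.ne_zero⟩
  obtain ⟨n, hn⟩ := ZMod.natCast_zmod_surjective (e.coeff h)
  rw [← hn, map_natCast, Ne, ZMod.natCast_eq_zero_iff] at hh'
  rw [← hn, ← Nat.cast_mul, ZMod.natCast_eq_zero_iff] at hmc
  have h1 : p ^ m ∣ m := by
    refine Nat.Coprime.dvd_of_dvd_mul_right ?_ hmc
    exact Nat.Coprime.pow_left _ ((Nat.Prime.coprime_iff_not_dvd hpp).2 hh')
  exact absurd (Nat.le_of_dvd hm h1) (not_le.2 (Nat.lt_pow_self hpp.one_lt))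

end Reduction

end

/-- Every nontrivial element acts without nonzero fixed vectors. -/
def FixedPointFreeRep {k H W : Type*} [Field k] [Group H] [AddCommGroup W] [Module k W]
    (ρ : H →* Module.End k W) : Prop :=
  ∀ g : H, g ≠ 1 → ∀ v : W, ρ g v = v → v = 0

theorem exists_pow_orderOf_prime {H : Type*} [Group H] [Finite H] {g : H} (hg : g ≠ 1) :
    ∃ n : ℕ, (orderOf (g ^ n)).Prime := by
  obtain ⟨q, hq, hqd⟩ := Nat.exists_prime_and_dvd (fun h => hg (orderOf_eq_one_iff.1 h))
  obtain ⟨m, hm⟩ := hqd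
  have hm0 : m ≠ 0 := by
    rintro rfl
    rw [mul_zero] at hm
    exact (orderOf_pos g).ne' hm
  refine ⟨m, ?_⟩
  rw [orderOf_pow_of_dvd hm0 (Dvd.intro_left _ hm.symm), hm, Nat.mul_div_cancel _
    (Nat.pos_of_ne_zero hm0)]
  exact hq

theorem normIdeal_ne_top {H : Type*} [Group H] [Finite H] {k V : Type*} [Field k] [AddCommGroup V]
    [Module k V] [Nontrivial V] (τ : H →* Module.End k V) (hτ : FixedPointFreeRep τ) :
    normIdeal k H ≠ ⊤ := by
  let φ := MonoidAlgebra.lift k (Module.End k V) H τ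
  have hle : normIdeal k H ≤ RingHom.ker φ.toRingHom := by
    rw [normIdeal, Ideal.span_le]
    rintro x ⟨g, hg, rfl⟩
    change φ (normElement k g) = 0
    have hφ : ∀ h, φ (MonoidAlgebra.of k H h) = τ h := fun h => by simp [φ]
    ext v
    refine hτ g ?_ _ ?_
    · rintro rfl
      rw [orderOf_one] at hg
      exact Nat.not_prime_one hg
    · rw [← hφ, ← Module.End.mul_apply, ← map_mul, of_mul_normElement]
  intro htop
  rw [htop] at hle
  have h1 : φ 1 = 0 := hle (Submodule.mem_top : (1 : MonoidAlgebra k H) ∈ ⊤)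
  rw [map_one] at h1
  exact one_ne_zero h1

theorem FixedPointFreeRep.exists_fin {H W : Type*} [Group H] [AddCommGroup W] [Module ℚ W]
    [Module.Finite ℚ W] [Nontrivial W] {ρ : H →* Module.End ℚ W} (hρ : FixedPointFreeRep ρ) :
    ∃ (n : ℕ) (σ : H →* Module.End ℚ (Fin (n + 1) → ℚ)), FixedPointFreeRep σ := by
  obtain ⟨n, hn⟩ : ∃ n, Module.finrank ℚ W = n + 1 :=
    Nat.exists_eq_succ_of_ne_zero Module.finrank_pos.ne'
  let e : W ≃ₗ[ℚ] (Fin (n + 1) → ℚ) := (Module.finBasisOfFinrankEq ℚ W hn).equivFun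
  refine ⟨n, (e.conjRingEquiv.toMonoidHom).comp ρ, ?_⟩
  intro g hg v hv
  have h1 : ρ g (e.symm v) = e.symm v := by
    apply e.injective
    rw [e.apply_symm_apply]
    exact hv
  have h2 := hρ g hg _ h1
  simpa using h2

/-- The representation by left multiplication on the quotient by the norm ideal. -/
noncomputable def normQuotientRep (H : Type*) [Group H] :
    H →* Module.End ℚ (MonoidAlgebra ℚ H ⧸ normIdeal ℚ H) :=
  ((Algebra.lsmul ℚ ℚ (MonoidAlgebra ℚ H ⧸ normIdeal ℚ H)).toMonoidHom).comp
    (MonoidAlgebra.of ℚ H)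

theorem normQuotientRep_apply {H : Type*} [Group H] (g : H)
    (w : MonoidAlgebra ℚ H ⧸ normIdeal ℚ H) :
    normQuotientRep H g w = MonoidAlgebra.of ℚ H g • w := rfl

theorem normQuotientRep_fixedPointFree (H : Type*) [Group H] [Finite H] :
    FixedPointFreeRep (normQuotientRep H) := by
  intro g hg v hv
  obtain ⟨n, hn⟩ := exists_pow_orderOf_prime hg
  rw [normQuotientRep_apply] at hv
  have h1 : ∀ i : ℕ, MonoidAlgebra.of ℚ H (g ^ i) • v = v := by
    intro i
    induction i with
    | zero => rw [pow_zero, map_one, one_smul]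
    | succ i ih => rw [pow_succ, map_mul, mul_smul, hv, ih]
  have h2 : normElement ℚ (g ^ n) • v = (orderOf (g ^ n) : ℚ) • v := by
    rw [normElement, Finset.sum_smul, Finset.sum_congr rfl fun i _ => by
      rw [← pow_mul, h1 (n * i)], Finset.sum_const, Finset.card_range, Nat.cast_smul_eq_nsmul]
  have h3 : normElement ℚ (g ^ n) • v = 0 := by
    obtain ⟨a, rfl⟩ := Submodule.mkQ_surjective _ v
    rw [← map_smul, Submodule.mkQ_apply, Submodule.Quotient.mk_eq_zero]
    exact normElement_mul_mem hn a
  rw [h3] at h2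
  exact (smul_eq_zero.1 h2.symm).resolve_left (Nat.cast_ne_zero.2 hn.ne_zero)

instance finite_normQuotient (H : Type*) [Group H] [Finite H] :
    Module.Finite ℚ (MonoidAlgebra ℚ H ⧸ normIdeal ℚ H) := by
  have hfinA : Module.Finite ℚ (MonoidAlgebra ℚ H) :=
    Module.Finite.equiv (MonoidAlgebra.coeffLinearEquiv ℚ : _ ≃ₗ[ℚ] (H →₀ ℚ)).symm
  exact Module.Finite.trans (MonoidAlgebra ℚ H) _

/-- A fixed-point-free representation in characteristic prime to the order of the group gives
one over the rationals. -/
theorem exists_rat_fixedPointFreeRep {H : Type*} [Group H] [Finite H] {p : ℕ} [Fact p.Prime]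
    (hp : ¬ p ∣ Nat.card H) {V : Type*} [AddCommGroup V] [Module (ZMod p) V] [Nontrivial V]
    (τ : H →* Module.End (ZMod p) V) (hτ : FixedPointFreeRep τ) :
    ∃ (n : ℕ) (ρ : H →* Module.End ℚ (Fin (n + 1) → ℚ)), FixedPointFreeRep ρ := by
  have hone := one_notMem_normIdeal_rat hp (normIdeal_ne_top τ hτ)
  have hW : Nontrivial (MonoidAlgebra ℚ H ⧸ normIdeal ℚ H) :=
    Submodule.Quotient.nontrivial_iff.2 ((Ideal.ne_top_iff_one _).2 hone)
  exact (normQuotientRep_fixedPointFree H).exists_fin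

/-- An action by additive endomorphisms as a representation over `ZMod p`. -/
def zmodRep {H V : Type*} (p : ℕ) [Group H] [AddCommGroup V] [Module (ZMod p) V]
    (f : H →* AddMonoid.End V) : H →* Module.End (ZMod p) V where
  toFun h := AddMonoidHom.toZModLinearMap p (f h)
  map_one' := by rw [map_one]; rfl
  map_mul' a b := by rw [map_mul]; rfl

/-- The action on an invariant subgroup, written additively. -/
def restrictAction {K H : Type*} [CommGroup K] [Group H] (f : H →* MulAut K) (T : Subgroup K)
    (hT : ∀ h, ∀ k ∈ T, f h k ∈ T) : H →* AddMonoid.End (Additive T) where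
  toFun h :=
    { toFun := fun x => Additive.ofMul ⟨f h (Additive.toMul x).1, hT h _ (Additive.toMul x).2⟩
      map_zero' := Additive.toMul.injective (Subtype.ext (map_one (f h)))
      map_add' := fun x y => Additive.toMul.injective (Subtype.ext (map_mul (f h) _ _)) }
  map_one' := AddMonoidHom.ext fun x => Additive.toMul.injective (Subtype.ext (by
    change f 1 (Additive.toMul x).1 = (Additive.toMul x).1
    rw [map_one, MulAut.one_apply]))
  map_mul' a b := AddMonoidHom.ext fun x => Additive.toMul.injective (Subtype.ext (by
    change f (a * b) (Additive.toMul x).1 = f a (f b (Additive.toMul x).1)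
    rw [map_mul, MulAut.mul_apply]))

/-- A fixed-point-free action by automorphisms on an abelian group of coprime order gives a
fixed-point-free rational representation. -/
theorem exists_fixedPointFreeRep_of_mulAut {K H : Type*} [CommGroup K] [Finite K] [Nontrivial K]
    [Group H] [Finite H] (hco : (Nat.card K).Coprime (Nat.card H)) (f : H →* MulAut K)
    (hf : ∀ h, h ≠ 1 → ∀ k, f h k = k → k = 1) :
    ∃ (n : ℕ) (ρ : H →* Module.End ℚ (Fin (n + 1) → ℚ)), FixedPointFreeRep ρ := by
  obtain ⟨p, hp, hpK⟩ := Nat.exists_prime_and_dvd (Finite.one_lt_card (α := K)).ne'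
  have := Fact.mk hp
  obtain ⟨T, hT⟩ : ∃ T : Subgroup K, ∀ k : K, k ∈ T ↔ k ^ p = 1 :=
    ⟨(powMonoidHom p : K →* K).ker, fun k => by simp [MonoidHom.mem_ker]⟩
  have hmap : ∀ h, ∀ k ∈ T, (f h) k ∈ T := fun h k hk => by
    rw [hT] at hk ⊢
    rw [← map_pow, hk, map_one]
  let : Module (ZMod p) (Additive T) := AddCommGroup.zmodModule fun x => by
    apply Additive.toMul.injective
    apply Subtype.ext
    exact (hT _).1 (Additive.toMul x).2
  have hnt : Nontrivial (Additive T) := by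
    obtain ⟨g, hg⟩ := exists_prime_orderOf_dvd_card' p hpK
    refine ⟨Additive.ofMul ⟨g, (hT g).2 (hg ▸ pow_orderOf_eq_one g)⟩, 0, fun h => ?_⟩
    have h1 : g = 1 := congrArg Subtype.val (congrArg Additive.toMul h)
    rw [h1, orderOf_one] at hg
    exact hp.one_lt.ne hg
  refine exists_rat_fixedPointFreeRep (p := p) (fun h => ?_)
    (zmodRep p (restrictAction f T hmap)) ?_
  · exact hp.one_lt.ne' (Nat.eq_one_of_dvd_coprimes hco hpK h)
  · intro g hg v hv
    have h1 : f g (Additive.toMul v).1 = (Additive.toMul v).1 :=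
      congrArg Subtype.val (congrArg Additive.toMul hv)
    apply Additive.toMul.injective
    exact Subtype.ext (hf g hg _ h1)

namespace IsFrobeniusWith

variable {G : Type*} [Group G] {K H : Subgroup G}

theorem coprime [Finite G] (hF : IsFrobeniusWith K H) : (Nat.card K).Coprime (Nat.card H) := by
  have h1 : Nat.card K = ∑ m ∈ (Nat.card K).divisors, orderCount K m := by
    rw [← card_pow_eq_one_eq_sum K Nat.card_pos.ne']
    exact (Nat.card_congr (Equiv.subtypeUnivEquiv fun g => pow_card_eq_one')).symm
  rw [← Finset.add_sum_erase _ _ (Nat.one_mem_divisors.2 Nat.card_pos.ne'), orderCount_one] at h1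
  obtain ⟨c, hc⟩ : Nat.card H ∣ ∑ m ∈ (Nat.card K).divisors.erase 1, orderCount K m :=
    Finset.dvd_sum fun m hm => hF.card_dvd_orderCount (Finset.ne_of_mem_erase hm)
  rw [h1, hc, Nat.coprime_add_mul_left_left]
  exact Nat.coprime_one_left _

theorem orderCount_compl [Finite G] (hF : IsFrobeniusWith K H) {n : ℕ} (hn : n ≠ 1)
    (h0 : orderCount H n ≠ 0) : orderCount K n = 0 := by
  by_contra h1
  obtain ⟨h, rfl⟩ := exists_of_orderCount_ne_zero h0
  obtain ⟨k, hk⟩ := exists_of_orderCount_ne_zero h1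
  exact hn (Nat.eq_one_of_dvd_coprimes hF.coprime (hk ▸ orderOf_dvd_natCard k)
    (orderOf_dvd_natCard h))

theorem perfectOrderClasses_compl [Finite G] (hF : IsFrobeniusWith K H)
    (hP : PerfectOrderClasses G) : PerfectOrderClasses H := by
  intro n hn
  by_cases h0 : orderCount H n = 0
  · exact Or.inl h0
  right
  by_cases h1 : n = 1
  · rw [h1, orderCount_one]; exact one_dvd _
  have h2 := hF.orderCount_eq h1
  rw [hF.orderCount_compl h1 h0, zero_add] at h2
  have h3 := hP n hn
  rw [h2, ← hF.card_mul] at h3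
  have hK : 0 < Nat.card K := Nat.card_pos
  rcases h3 with h3 | h3
  · exact absurd h3 (Nat.mul_ne_zero hK.ne' h0)
  · exact Nat.dvd_of_mul_dvd_mul_left hK h3

theorem commute_kernel [Finite G] (hF : IsFrobeniusWith K H) (h2 : 2 ∣ Nat.card H) (a b : K) :
    a * b = b * a := by
  have hn := hF.normal
  have := Fact.mk Nat.prime_two
  obtain ⟨z, hz⟩ := exists_prime_orderOf_dvd_card' 2 h2
  have hz1 : (z : G) ≠ 1 := fun h => by
    rw [← Subgroup.orderOf_coe, h, orderOf_one] at hz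
    exact absurd hz (by norm_num)
  have hzz : z ^ 2 = 1 := hz ▸ pow_orderOf_eq_one z
  let φ : K →* K := (MulAut.conjNormal (z : G)).toMonoidHom
  have hφ : MonoidHom.FixedPointFree φ := fun k hk =>
    Subtype.ext (hF.eq_one_of_conj_eq z.2 k.2 hz1 (congrArg Subtype.val hk))
  refine hφ.commute_all_of_involutive (fun k => ?_) a b
  change (MulAut.conjNormal (z : G)) ((MulAut.conjNormal (z : G)) k) = k
  rw [← MulAut.mul_apply, ← map_mul, ← sq, ← Subgroup.coe_pow, hzz]
  simp

theorem not_isSolvable_compl (hF : IsFrobeniusWith K H)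
    (hc : ∀ a b : K, a * b = b * a) (hG : ¬ Group.IsSolvable G) : ¬ Group.IsSolvable H := by
  intro hH
  have hn := hF.normal
  have hK : Group.IsSolvable K := Group.isSolvable_of_comm hc
  apply hG
  have hq : Group.IsSolvable (G ⧸ K) := by
    refine Group.isSolvable_of_surjective (f := (QuotientGroup.mk' K).comp H.subtype) ?_
    intro q
    obtain ⟨g, rfl⟩ := QuotientGroup.mk'_surjective K q
    obtain ⟨k, hk, h, hh, rfl⟩ := hF.exists_mul g
    refine ⟨⟨h, hh⟩, ?_⟩
    have : QuotientGroup.mk' K k = 1 := (QuotientGroup.eq_one_iff k).2 hk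
    simp [map_mul, this]
  exact Group.isSolvable_of_ker_le_range K.subtype (QuotientGroup.mk' K) (by simp)

theorem exists_fixedPointFreeRep [Finite G] (hF : IsFrobeniusWith K H)
    (hc : ∀ a b : K, a * b = b * a) :
    ∃ (n : ℕ) (ρ : H →* Module.End ℚ (Fin (n + 1) → ℚ)), FixedPointFreeRep ρ := by
  have hn := hF.normal
  have hnt := hF.nontrivial_kernel
  let : CommGroup K := { (inferInstance : Group K) with mul_comm := hc }
  refine exists_fixedPointFreeRep_of_mulAut hF.coprime (MulAut.conjNormal.comp H.subtype) ?_
  intro h h1 k hk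
  exact Subtype.ext (hF.eq_one_of_conj_eq h.2 k.2 (fun h' => h1 (Subtype.ext h'))
    (congrArg Subtype.val hk))

end IsFrobeniusWith

open Polynomial in
/-- The second coefficient of a cyclotomic polynomial. -/
theorem nextCoeff_cyclotomic {n : ℕ} (hn : 0 < n) :
    (cyclotomic n ℚ).nextCoeff = -(ArithmeticFunction.moebius n : ℚ) := by
  induction n using Nat.strong_induction_on with
  | _ n ih =>
  have h1 := congrArg nextCoeff (prod_cyclotomic_eq_X_pow_sub_one hn ℚ)
  rw [Monic.nextCoeff_prod _ _ fun d _ => cyclotomic.monic d ℚ] at h1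
  have h2 : (X ^ n - 1 : ℚ[X]).nextCoeff = if n = 1 then -1 else 0 := by
    have hd : (X ^ n - 1 : ℚ[X]).natDegree = n := by
      simpa using natDegree_X_pow_sub_C (n := n) (r := (1 : ℚ))
    rw [nextCoeff_of_natDegree_pos (by rw [hd]; exact hn), hd, coeff_sub, coeff_X_pow, coeff_one]
    by_cases h : n = 1
    · simp [h]
    · rw [if_neg (by omega), if_neg (by omega), if_neg h]; simp
  have h3 : ∑ d ∈ n.divisors, (ArithmeticFunction.moebius d : ℚ) = if n = 1 then 1 else 0 := by
    have h := congrArg (fun F : ArithmeticFunction ℚ => F n)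
      (ArithmeticFunction.coe_moebius_mul_coe_zeta (R := ℚ))
    rw [ArithmeticFunction.coe_mul_zeta_apply, ArithmeticFunction.one_apply] at h
    exact h
  rw [h2, ← Nat.cons_self_properDivisors hn.ne', Finset.sum_cons] at h1
  rw [← Nat.cons_self_properDivisors hn.ne', Finset.sum_cons] at h3
  rw [Finset.sum_congr rfl fun d hd => ih d (Nat.mem_properDivisors.1 hd).2
    (Nat.pos_of_mem_properDivisors hd), Finset.sum_neg_distrib] at h1
  split_ifs at h1 h3 <;> linarith

theorem trace_lsmul_tower {F K W : Type*} [Field F] [Field K] [Algebra F K]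
    [FiniteDimensional F K] [AddCommGroup W] [Module F W] [Module K W] [IsScalarTower F K W]
    [FiniteDimensional K W] (a : K) :
    LinearMap.trace F W (Algebra.lsmul F F W a) = Module.finrank K W • Algebra.trace F K a := by
  classical
  let b := Module.finBasis F K
  let c := Module.finBasis K W
  rw [LinearMap.trace_eq_matrix_trace F (b.smulTower c), Algebra.trace_apply,
    LinearMap.trace_eq_matrix_trace F b, Matrix.trace, Matrix.trace, Fintype.sum_prod_type,
    Finset.sum_comm]
  have h : ∀ (j : Fin (Module.finrank K W)) (i : Fin (Module.finrank F K)),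
      (LinearMap.toMatrix (b.smulTower c) (b.smulTower c) (Algebra.lsmul F F W a)).diag (i, j) =
      (LinearMap.toMatrix b b (LinearMap.mul F K a)).diag i := by
    intro j i
    rw [Matrix.diag_apply, Matrix.diag_apply, LinearMap.toMatrix_apply, LinearMap.toMatrix_apply,
      Module.Basis.smulTower_repr, Module.Basis.smulTower_apply]
    simp [smul_smul]
  simp_rw [h, Finset.sum_const, Finset.card_univ, Fintype.card_fin]
  rfl

open Polynomial in
theorem trace_of_aeval_eq_zero {F W : Type*} [Field F] [AddCommGroup W] [Module F W]
    [FiniteDimensional F W] (f : Module.End F W) {P : F[X]} (hP : Irreducible P) (hm : P.Monic)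
    (h : aeval f P = 0) :
    (P.natDegree : F) * LinearMap.trace F W f = -(Module.finrank F W * P.nextCoeff) := by
  have : Fact (Irreducible P) := ⟨hP⟩
  have hker : ∀ a ∈ Ideal.span {P}, (aeval f : F[X] →ₐ[F] Module.End F W).toRingHom a = 0 := by
    intro a ha
    obtain ⟨c, rfl⟩ := Ideal.mem_span_singleton'.1 ha
    change aeval f (c * P) = 0
    rw [map_mul, h, mul_zero]
  let L : AdjoinRoot P →+* Module.End F W := Ideal.Quotient.lift _ _ hker
  have hL : ∀ q, L (AdjoinRoot.mk P q) = aeval f q := fun q => Ideal.Quotient.lift_mk _ _ _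
  let : Module (AdjoinRoot P) W := Module.compHom W L
  have hsm : ∀ (a : AdjoinRoot P) (w : W), a • w = L a w := fun _ _ => rfl
  have htower : IsScalarTower F (AdjoinRoot P) W := ⟨fun r a w => by
    obtain ⟨q, rfl⟩ := AdjoinRoot.mk_surjective a
    rw [hsm, hsm, AdjoinRoot.smul_mk, hL, hL, map_smul]
    rfl⟩
  have hfin : FiniteDimensional F (AdjoinRoot P) := hm.finite_adjoinRoot
  have hfin' : FiniteDimensional (AdjoinRoot P) W := Module.Finite.of_restrictScalars_finite F _ _
  have h1 := trace_lsmul_tower (F := F) (W := W) (AdjoinRoot.root P)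
  have h2 : Algebra.lsmul F F W (AdjoinRoot.root P) = f := by
    ext w
    change AdjoinRoot.root P • w = f w
    rw [hsm, ← AdjoinRoot.mk_X, hL, aeval_X]
  have h3 := (AdjoinRoot.powerBasis hP.ne_zero).trace_gen_eq_nextCoeff_minpoly
  rw [AdjoinRoot.powerBasis_gen, AdjoinRoot.minpoly_root hP.ne_zero, hm.leadingCoeff, inv_one,
    C_1, mul_one] at h3
  have h4 := Module.finrank_mul_finrank F (AdjoinRoot P) W
  rw [(AdjoinRoot.powerBasis hP.ne_zero).finrank, AdjoinRoot.powerBasis_dim] at h4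
  rw [h2, h3] at h1
  rw [h1, ← h4]
  push_cast
  rw [nsmul_eq_mul]
  ring

namespace FixedPointFreeRep

section Field

variable {k H W : Type*} [Field k] [Group H] [AddCommGroup W] [Module k W]
  {ρ : H →* Module.End k W}

theorem injective [Nontrivial W] (hρ : FixedPointFreeRep ρ) : Function.Injective ρ := by
  rw [injective_iff_map_eq_one]
  intro g hg
  by_contra h1
  obtain ⟨v, hv⟩ := exists_ne (0 : W)
  exact hv (hρ g h1 v (by rw [hg]; rfl))

theorem isUnit_sub_one [FiniteDimensional k W] (hρ : FixedPointFreeRep ρ) {g : H} (hg : g ≠ 1) :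
    IsUnit (ρ g - 1) := by
  rw [LinearMap.isUnit_iff_ker_eq_bot, LinearMap.ker_eq_bot']
  intro v hv
  exact hρ g hg v (sub_eq_zero.1 hv)

open Polynomial in
theorem aeval_cyclotomic [FiniteDimensional k W] (hρ : FixedPointFreeRep ρ) {g : H} {n : ℕ}
    (hn : 0 < n) (hg : orderOf g = n) : aeval (ρ g) (cyclotomic n k) = 0 := by
  have h1 : aeval (ρ g) (X ^ n - 1 : k[X]) = 0 := by
    rw [map_sub, map_pow, aeval_X, map_one, ← map_pow, ← hg, pow_orderOf_eq_one, map_one, sub_self]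
  rw [← prod_cyclotomic_eq_X_pow_sub_one hn, ← Nat.cons_self_properDivisors hn.ne',
    Finset.prod_cons, mul_comm, map_mul] at h1
  refine (IsUnit.mul_right_eq_zero ?_).1 h1
  refine Finset.prod_induction _ (fun q => IsUnit (aeval (ρ g) q))
    (fun a b ha hb => by rw [map_mul]; exact ha.mul hb) (by rw [map_one]; exact isUnit_one) ?_
  intro d hd
  obtain ⟨hdn, hdlt⟩ := Nat.mem_properDivisors.1 hd
  have hd0 : 0 < d := Nat.pos_of_mem_properDivisors hd
  obtain ⟨q, hq⟩ := cyclotomic.dvd_X_pow_sub_one d k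
  have h2 : IsUnit (ρ (g ^ d) - 1) := hρ.isUnit_sub_one fun h =>
    hdlt.not_ge (hg ▸ orderOf_le_of_pow_eq_one hd0 h)
  have h3 : ρ (g ^ d) - 1 = aeval (ρ g) (cyclotomic d k) * aeval (ρ g) q := by
    rw [← map_mul, ← hq, map_sub, map_pow, map_pow, aeval_X, map_one]
  rw [h3, Commute.isUnit_mul_iff] at h2
  · exact h2.1
  · rw [commute_iff_eq, ← map_mul, ← map_mul, mul_comm]

end Field

variable {H W : Type*} [Group H] [AddCommGroup W] [Module ℚ W] [FiniteDimensional ℚ W]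
  {ρ : H →* Module.End ℚ W}

theorem trace_eq (hρ : FixedPointFreeRep ρ) {g : H} {n : ℕ} (hn : 0 < n) (hg : orderOf g = n) :
    (n.totient : ℚ) * LinearMap.trace ℚ W (ρ g) =
      ArithmeticFunction.moebius n * Module.finrank ℚ W := by
  have h := trace_of_aeval_eq_zero (ρ g) (Polynomial.cyclotomic.irreducible_rat hn)
    (Polynomial.cyclotomic.monic n ℚ) (hρ.aeval_cyclotomic hn hg)
  rw [Polynomial.natDegree_cyclotomic, nextCoeff_cyclotomic hn] at h
  rw [h]; ring

theorem eq_neg_one_of_orderOf (hρ : FixedPointFreeRep ρ) {g : H} (hg : orderOf g = 2) :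
    ρ g = -1 := by
  have h := hρ.aeval_cyclotomic two_pos hg
  rw [Polynomial.cyclotomic_two, map_add, Polynomial.aeval_X, map_one] at h
  exact eq_neg_of_add_eq_zero_left h

theorem eq_of_orderOf_two [Nontrivial W] (hρ : FixedPointFreeRep ρ) {g h : H} (hg : orderOf g = 2)
    (hh : orderOf h = 2) : g = h :=
  hρ.injective ((hρ.eq_neg_one_of_orderOf hg).trans (hρ.eq_neg_one_of_orderOf hh).symm)

theorem mul_self_of_orderOf_three (hρ : FixedPointFreeRep ρ) {g : H} (hg : orderOf g = 3) :
    ρ g * ρ g = -1 - ρ g := by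
  have h := hρ.aeval_cyclotomic three_pos hg
  rw [Polynomial.cyclotomic_three] at h
  simp only [map_add, map_pow, Polynomial.aeval_X, map_one] at h
  rw [← sub_eq_zero, ← h]
  noncomm_ring

theorem mul_self_of_orderOf_six (hρ : FixedPointFreeRep ρ) {g : H} (hg : orderOf g = 6) :
    ρ g * ρ g = ρ g - 1 := by
  have h3 : ρ (g ^ 3) = -1 := hρ.eq_neg_one_of_orderOf (by rw [orderOf_pow' _ (by norm_num), hg]; rfl)
  have h2 := hρ.mul_self_of_orderOf_three (g := g ^ 2) (by rw [orderOf_pow' _ (by norm_num), hg]; rfl)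
  rw [map_pow] at h2 h3
  have h4 : ρ g ^ 2 * ρ g ^ 2 = ρ g ^ 3 * ρ g := by noncomm_ring
  rw [h4, h3] at h2
  rw [← sq]
  linear_combination (norm := noncomm_ring) h2

theorem pow_four_of_orderOf_ten (hρ : FixedPointFreeRep ρ) {g : H} (hg : orderOf g = 10) :
    ρ g ^ 4 = ρ g ^ 3 - ρ g ^ 2 + ρ g - 1 := by
  have h5 : ρ (g ^ 5) = -1 := hρ.eq_neg_one_of_orderOf (by rw [orderOf_pow' _ (by norm_num), hg]; rfl)
  have := Fact.mk Nat.prime_five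
  have h := hρ.aeval_cyclotomic (g := g ^ 2) (by norm_num : 0 < 5) (by rw [orderOf_pow' _ (by norm_num), hg]; rfl)
  rw [Polynomial.cyclotomic_prime] at h
  simp only [Finset.sum_range_succ, Finset.sum_range_zero, map_add, map_zero, map_pow,
    Polynomial.aeval_X] at h
  rw [map_pow] at h5
  have h6 : (ρ g ^ 2) ^ 3 = ρ g ^ 5 * ρ g := by noncomm_ring
  have h8 : (ρ g ^ 2) ^ 4 = ρ g ^ 5 * ρ g ^ 3 := by noncomm_ring
  rw [h6, h8, h5] at h
  linear_combination (norm := noncomm_ring) h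

end FixedPointFreeRep

theorem eq_six_or_ten_of_totient_le {n : ℕ} (hn : 1 < n)
    (h : (n.totient : ℤ) ≤ 4 * ArithmeticFunction.moebius n) :
    n = 6 ∨ n = 10 := by
  have hpos : 0 < n.totient := Nat.totient_pos.2 (by omega)
  have hmu : ArithmeticFunction.moebius n ≠ 0 := by
    intro h0
    rw [h0] at h
    omega
  have hsq : Squarefree n := ArithmeticFunction.moebius_ne_zero_iff_squarefree.1 hmu
  have h1 : ArithmeticFunction.moebius n = 1 := by
    rcases ArithmeticFunction.moebius_ne_zero_iff_eq_or.1 hmu with h1 | h1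
    · exact h1
    · rw [h1] at h; omega
  have h4 : n.totient ≤ 4 := by rw [h1] at h; omega
  have h30 : n ∣ 30 := by
    rw [← Nat.prod_primeFactors_of_squarefree hsq]
    have hsub : n.primeFactors ⊆ {2, 3, 5} := by
      intro p hp
      have hpp := Nat.prime_of_mem_primeFactors hp
      have h5 := Nat.le_of_dvd hpos (Nat.totient_dvd_of_dvd (Nat.dvd_of_mem_primeFactors hp))
      rw [Nat.totient_prime hpp] at h5
      have h6 : p ≤ 5 := by omega
      have := hpp.two_le
      interval_cases p <;> simp_all
      exact absurd hpp (by norm_num)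
    exact (Finset.prod_dvd_prod_of_subset _ _ _ hsub).trans (by simp)
  have hle : n ≤ 30 := Nat.le_of_dvd (by norm_num) h30
  have hmem : n ∈ Nat.divisors 30 := Nat.mem_divisors.2 ⟨h30, by norm_num⟩
  have hd : Nat.divisors 30 = {1, 2, 3, 5, 6, 10, 15, 30} := by decide +kernel
  rw [hd] at hmem
  have hc : ∀ p : ℕ, p.Prime → ArithmeticFunction.moebius p = -1 :=
    fun p hp => ArithmeticFunction.moebius_apply_prime hp
  have h2 := hc 2 (by norm_num)
  have h3 := hc 3 (by norm_num)
  have h5 := hc 5 (by norm_num)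
  have t15 : Nat.totient 15 = 8 := by decide +kernel
  have t30 : Nat.totient 30 = 8 := by decide +kernel
  simp only [Finset.mem_insert, Finset.mem_singleton] at hmem
  rcases hmem with rfl | rfl | rfl | rfl | rfl | rfl | rfl | rfl <;> omega

theorem moebius_totient_pair {n m : ℕ} (hn : 1 < n) (hm : 1 < m)
    (h : (ArithmeticFunction.moebius n : ℚ) / n.totient + ArithmeticFunction.moebius m / m.totient
      = 1 / 2) : n = 6 ∨ m = 6 ∨ (n = 10 ∧ m = 10) := by
  have hcase : ∀ a : ℕ, 1 < a → (1 : ℚ) / 4 ≤ ArithmeticFunction.moebius a / a.totient →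
      a = 6 ∨ a = 10 := by
    intro a ha hle
    have hpos : (0 : ℚ) < a.totient := by exact_mod_cast Nat.totient_pos.2 (by omega)
    rw [le_div_iff₀ hpos] at hle
    refine eq_six_or_ten_of_totient_le ha ?_
    have : (a.totient : ℚ) ≤ 4 * ArithmeticFunction.moebius a := by linarith
    exact_mod_cast this
  have h10 : (ArithmeticFunction.moebius 10 : ℚ) / (Nat.totient 10 : ℚ) = 1 / 4 := by
    have hm10 : ArithmeticFunction.moebius 10 = 1 := by
      rw [show 10 = 2 * 5 from rfl,
        ArithmeticFunction.isMultiplicative_moebius.map_mul_of_coprime (by norm_num),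
        ArithmeticFunction.moebius_apply_prime (by norm_num),
        ArithmeticFunction.moebius_apply_prime (by norm_num)]
      norm_num
    rw [hm10, show Nat.totient 10 = 4 by decide +kernel]
    norm_num
  rcases le_or_gt (1 / 4 : ℚ) (ArithmeticFunction.moebius n / n.totient) with h1 | h1
  · rcases hcase n hn h1 with rfl | rfl
    · exact Or.inl rfl
    · rw [h10] at h
      rcases hcase m hm (by linarith) with rfl | rfl
      · exact Or.inr (Or.inl rfl)
      · exact Or.inr (Or.inr ⟨rfl, rfl⟩)
  · rcases hcase m hm (by linarith) with rfl | rfl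
    · exact Or.inr (Or.inl rfl)
    · rw [h10] at h
      exfalso
      linarith

namespace FixedPointFreeRep

variable {H W : Type*} [Group H] [AddCommGroup W] [Module ℚ W] [FiniteDimensional ℚ W]
  {ρ : H →* Module.End ℚ W}

theorem inv_of_orderOf_three (hρ : FixedPointFreeRep ρ) {g : H} (hg : orderOf g = 3) :
    ρ g⁻¹ = -1 - ρ g := by
  rw [← hρ.mul_self_of_orderOf_three hg, ← map_mul, ← sq]
  congr 1
  rw [inv_eq_iff_mul_eq_one, ← pow_succ']
  have h := pow_orderOf_eq_one g
  rw [hg] at h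
  exact h

theorem trace_div (hρ : FixedPointFreeRep ρ) [Finite H] (g : H) :
    LinearMap.trace ℚ W (ρ g) =
      ArithmeticFunction.moebius (orderOf g) / (orderOf g).totient * Module.finrank ℚ W := by
  have h := hρ.trace_eq (orderOf_pos g) rfl
  have hpos : (0 : ℚ) < (orderOf g).totient := by
    exact_mod_cast Nat.totient_pos.2 (orderOf_pos g)
  field_simp
  linarith

/-- Two elements of order three generate a group in which the anticommutator of their imaginary
parts is very restricted. -/
theorem orderOf_three_pair (hρ : FixedPointFreeRep ρ) [Finite H] [Nontrivial W] {x y : H}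
    (hx : orderOf x = 3) (hy : orderOf y = 3) {X Y : Module.End ℚ W}
    (hX : X = ρ x + ρ x + 1) (hY : Y = ρ y + ρ y + 1) :
    y = x ∨ y = x⁻¹ ∨ (X * Y + Y * X = 1 + 1) ∨ (X * Y + Y * X = -(1 + 1)) ∨
      (X * Y + Y * X) * (X * Y + Y * X) = (20 : ℤ) • 1 := by
  have hx2 := hρ.mul_self_of_orderOf_three hx
  have hy2 := hρ.mul_self_of_orderOf_three hy
  have hxi := hρ.inv_of_orderOf_three hx
  have hyi := hρ.inv_of_orderOf_three hy
  have hu : ρ (x * y) + ρ (x * y)⁻¹ = ρ x * ρ y + ρ y * ρ x + ρ x + ρ y + 1 := by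
    rw [mul_inv_rev, map_mul, map_mul, hxi, hyi]; noncomm_ring
  have hv : ρ (x * y⁻¹) + ρ (x * y⁻¹)⁻¹ = 1 - (ρ (x * y) + ρ (x * y)⁻¹) := by
    rw [hu, mul_inv_rev, inv_inv, map_mul, map_mul, hxi, hyi]; noncomm_ring
  have hS : X * Y + Y * X = (4 : ℤ) • (ρ (x * y) + ρ (x * y)⁻¹) - (1 + 1) := by
    rw [hu, hX, hY]; noncomm_ring
  by_cases hu1 : x * y = 1
  · exact Or.inr (Or.inl (eq_inv_of_mul_eq_one_right hu1))
  by_cases hv1 : x * y⁻¹ = 1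
  · exact Or.inl (mul_inv_eq_one.1 hv1).symm
  right; right
  have hinv : ∀ g : H, ρ g * ρ g⁻¹ = 1 := fun g => by rw [← map_mul, mul_inv_cancel, map_one]
  have hinv' : ∀ g : H, ρ g⁻¹ * ρ g = 1 := fun g => by rw [← map_mul, inv_mul_cancel, map_one]
  have hsix : ∀ g : H, orderOf g = 6 → ρ g + ρ g⁻¹ = 1 := by
    intro g hg
    have h6 := hρ.mul_self_of_orderOf_six hg
    have h7 := hinv g
    have h8 : ρ g * (ρ g + ρ g⁻¹) = ρ g * 1 := by rw [mul_add, h6, h7]; noncomm_ring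
    have h9 := congrArg (ρ g⁻¹ * ·) h8
    simpa only [← mul_assoc, hinv', one_mul] using h9
  have htr : (ArithmeticFunction.moebius (orderOf (x * y)) : ℚ) / (orderOf (x * y)).totient +
      ArithmeticFunction.moebius (orderOf (x * y⁻¹)) / (orderOf (x * y⁻¹)).totient = 1 / 2 := by
    have h1 := congrArg (LinearMap.trace ℚ W) hv
    rw [map_sub, map_add, map_add, hρ.trace_div, hρ.trace_div, hρ.trace_div, hρ.trace_div,
      orderOf_inv, orderOf_inv, LinearMap.trace_one] at h1
    have hd : (Module.finrank ℚ W : ℚ) ≠ 0 := by exact_mod_cast Module.finrank_pos.ne'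
    apply mul_right_cancel₀ hd
    linarith
  have hlt : ∀ g : H, g ≠ 1 → 1 < orderOf g := fun g hg => by
    have := orderOf_pos g
    have : orderOf g ≠ 1 := fun h => hg (orderOf_eq_one_iff.1 h)
    omega
  rcases moebius_totient_pair (hlt _ hu1) (hlt _ hv1) htr with h6 | h6 | ⟨h10, -⟩
  · left
    rw [hS, hsix _ h6]; noncomm_ring
  · right; left
    rw [hsix _ h6] at hv
    have h0 : ρ (x * y) + ρ (x * y)⁻¹ = 0 := by linear_combination (norm := noncomm_ring) hv
    rw [hS, h0]; noncomm_ring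
  · right; right
    have h4 := hρ.pow_four_of_orderOf_ten h10
    rw [hS]
    generalize x * y = u at h4
    have h5 := hinv u
    have h6 := hinv' u
    generalize ρ u = a at *
    generalize ρ u⁻¹ = b at *
    have e4 : a ^ 4 = a * a * a * a := by noncomm_ring
    have e3 : a ^ 3 = a * a * a := by noncomm_ring
    have e2 : a ^ 2 = a * a := by noncomm_ring
    rw [e4, e3, e2] at h4
    have h7 : (a + b) * (a + b) = (a + b) + 1 := by
      have h8 : b * b * (a * a * a * a) = a * a := by
        calc b * b * (a * a * a * a) = b * (b * a) * a * a * a := by noncomm_ring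
          _ = a * a := by rw [h6, mul_one, h6, one_mul]
      have h9 : b * b * (a * a * a) = a := by
        calc b * b * (a * a * a) = b * (b * a) * a * a := by noncomm_ring
          _ = a := by rw [h6, mul_one, h6, one_mul]
      have h10 : b * b * (a * a) = 1 := by
        calc b * b * (a * a) = b * (b * a) * a := by noncomm_ring
          _ = 1 := by rw [h6, mul_one, h6]
      have h11 : b * b * a = b := by rw [mul_assoc, h6, mul_one]
      have h12 := congrArg (b * b * ·) h4
      simp only [mul_sub, mul_add, h8, h9, h10, h11, mul_one] at h12
      linear_combination (norm := noncomm_ring) h12 + h5 + h6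
    linear_combination (norm := noncomm_ring) (16 : ℤ) • h7

end FixedPointFreeRep

/-- Quaternions with coefficients in a ring that need not be commutative. -/
@[ext]
structure NQuat (C : Type*) where
  re : C
  i : C
  j : C
  k : C

namespace NQuat

variable {C : Type*} [Ring C]

instance : One (NQuat C) := ⟨⟨1, 0, 0, 0⟩⟩
instance : Neg (NQuat C) := ⟨fun a => ⟨-a.re, -a.i, -a.j, -a.k⟩⟩
instance : Add (NQuat C) := ⟨fun a b => ⟨a.re + b.re, a.i + b.i, a.j + b.j, a.k + b.k⟩⟩
instance : Mul (NQuat C) := ⟨fun a b =>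
  ⟨a.re * b.re - a.i * b.i - a.j * b.j - a.k * b.k,
   a.re * b.i + a.i * b.re + a.j * b.k - a.k * b.j,
   a.re * b.j + a.j * b.re + a.k * b.i - a.i * b.k,
   a.re * b.k + a.k * b.re + a.i * b.j - a.j * b.i⟩⟩

theorem one_def : (1 : NQuat C) = ⟨1, 0, 0, 0⟩ := rfl

theorem neg_mk (a b c d : C) : -(⟨a, b, c, d⟩ : NQuat C) = ⟨-a, -b, -c, -d⟩ := rfl

theorem add_mk (a b c d a' b' c' d' : C) :
    (⟨a, b, c, d⟩ : NQuat C) + ⟨a', b', c', d'⟩ = ⟨a + a', b + b', c + c', d + d'⟩ := rfl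

theorem mul_mk (a b c d a' b' c' d' : C) :
    (⟨a, b, c, d⟩ : NQuat C) * ⟨a', b', c', d'⟩ =
      ⟨a * a' - b * b' - c * c' - d * d', a * b' + b * a' + c * d' - d * c',
       a * c' + c * a' + d * b' - b * d', a * d' + d * a' + b * c' - c * b'⟩ := rfl

/-- The imaginary parts (scaled by two) of the elements of order three in a group of quaternions
containing the binary tetrahedral group. -/
structure TetraSystem (P : Set (NQuat C)) : Prop where
  base : (⟨0, 1, 1, 1⟩ : NQuat C) ∈ P
  neg : ∀ {a b c d : C}, (⟨a, b, c, d⟩ : NQuat C) ∈ P → (⟨-a, -b, -c, -d⟩ : NQuat C) ∈ P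
  flip : ∀ {a b c d : C}, (⟨a, b, c, d⟩ : NQuat C) ∈ P → (⟨a, b, -c, -d⟩ : NQuat C) ∈ P
  rot : ∀ {a b c d : C}, (⟨a, b, c, d⟩ : NQuat C) ∈ P → (⟨a, c, d, b⟩ : NQuat C) ∈ P
  sq : ∀ X ∈ P, X * X = -(1 + 1 + 1)
  pair : ∀ X ∈ P, ∀ Y ∈ P, Y = X ∨ Y = -X ∨ X * Y + Y * X = 1 + 1 ∨ X * Y + Y * X = -(1 + 1) ∨
    (X * Y + Y * X) * (X * Y + Y * X) = ⟨(20 : ℤ) • 1, 0, 0, 0⟩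
  invol : ∀ X ∈ P, ∀ Y ∈ P, ∀ Z, Z = (-1 + X) * (-1 + -Y) * ⟨0, 1, 0, 0⟩ →
    Z * Z = ⟨(16 : ℤ) • 1, 0, 0, 0⟩ → Z = ⟨(4 : ℤ) • 1, 0, 0, 0⟩ ∨ Z = ⟨(-4 : ℤ) • 1, 0, 0, 0⟩

namespace TetraSystem

variable [Algebra ℚ C] {P : Set (NQuat C)}

theorem zsmul_cancel {m : ℤ} (hm : m ≠ 0) {a b : C} (h : m • a = m • b) : a = b := by
  have h2 : (m : ℚ) • (a - b) = 0 := by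
    rw [smul_sub, Int.cast_smul_eq_zsmul, Int.cast_smul_eq_zsmul, h, sub_self]
  have h3 := congrArg ((m : ℚ)⁻¹ • ·) h2
  simp only [smul_smul, smul_zero] at h3
  rw [inv_mul_cancel₀ (by exact_mod_cast hm), one_smul] at h3
  exact sub_eq_zero.1 h3

variable [Nontrivial C]

theorem zsmul_one_ne {m : ℤ} (hm : m ≠ 0) : m • (1 : C) ≠ 0 := fun h =>
  one_ne_zero (zsmul_cancel hm (h.trans (smul_zero m).symm))

theorem comps (hP : TetraSystem P) {a b c d : C} (h : (⟨a, b, c, d⟩ : NQuat C) ∈ P) :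
    a * a - b * b - c * c - d * d = -(1 + 1 + 1) ∧ a * b + b * a + c * d - d * c = 0 ∧
    a * c + c * a + d * b - b * d = 0 ∧ a * d + d * a + b * c - c * b = 0 := by
  have := hP.sq _ h
  simpa only [mul_mk, one_def, add_mk, neg_mk, NQuat.mk.injEq, add_zero, neg_zero] using this

theorem base_pair (hP : TetraSystem P) {a b c d : C} (h : (⟨a, b, c, d⟩ : NQuat C) ∈ P) :
    (⟨a, b, c, d⟩ : NQuat C) = ⟨0, 1, 1, 1⟩ ∨ (⟨a, b, c, d⟩ : NQuat C) = ⟨0, -1, -1, -1⟩ ∨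
    (a = 0 ∧ b + c + d = -1) ∨ (a = 0 ∧ b + c + d = 1) ∨
    ((b + c + d) * (b + c + d) = (5 : ℤ) • 1 + (3 : ℤ) • (a * a) ∧
      a * (b + c + d) + (b + c + d) * a = 0) := by
  rcases hP.pair _ hP.base _ h with h1 | h1 | h1 | h1 | h1
  · exact Or.inl h1
  · right; left; rw [h1, neg_mk, neg_zero]
  · right; right; left
    simp only [mul_mk, one_def, add_mk, NQuat.mk.injEq, add_zero] at h1
    obtain ⟨h1, h2, -, -⟩ := h1
    constructor
    · apply zsmul_cancel (two_ne_zero (α := ℤ))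
      linear_combination (norm := noncomm_ring) h2
    · apply zsmul_cancel (two_ne_zero (α := ℤ))
      linear_combination (norm := noncomm_ring) -h1
  · right; right; right; left
    simp only [mul_mk, one_def, add_mk, neg_mk, NQuat.mk.injEq, add_zero, neg_zero] at h1
    obtain ⟨h1, h2, -, -⟩ := h1
    constructor
    · apply zsmul_cancel (two_ne_zero (α := ℤ))
      linear_combination (norm := noncomm_ring) h2
    · apply zsmul_cancel (two_ne_zero (α := ℤ))
      linear_combination (norm := noncomm_ring) -h1
  · right; right; right; right
    simp only [mul_mk, add_mk, NQuat.mk.injEq] at h1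
    obtain ⟨h1, h2, -, -⟩ := h1
    constructor
    · apply zsmul_cancel (four_ne_zero (α := ℤ))
      linear_combination (norm := noncomm_ring) h1
    · apply zsmul_cancel (four_ne_zero (α := ℤ))
      linear_combination (norm := noncomm_ring) -h2

theorem re_or (hP : TetraSystem P) {a b c d : C} (h : (⟨a, b, c, d⟩ : NQuat C) ∈ P) :
    a = 0 ∨ ((b + c + d) * (b + c + d) = (5 : ℤ) • 1 + (3 : ℤ) • (a * a) ∧
      a * (b + c + d) + (b + c + d) * a = 0) := by
  rcases hP.base_pair h with h1 | h1 | h1 | h1 | h1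
  · rw [NQuat.mk.injEq] at h1; exact Or.inl h1.1
  · rw [NQuat.mk.injEq] at h1; exact Or.inl h1.1
  · exact Or.inl h1.1
  · exact Or.inl h1.1
  · exact Or.inr h1

theorem flip_j (hP : TetraSystem P) {a b c d : C} (h : (⟨a, b, c, d⟩ : NQuat C) ∈ P) :
    (⟨a, -b, c, -d⟩ : NQuat C) ∈ P := hP.rot (hP.rot (hP.flip (hP.rot h)))

theorem flip_k (hP : TetraSystem P) {a b c d : C} (h : (⟨a, b, c, d⟩ : NQuat C) ∈ P) :
    (⟨a, -b, -c, d⟩ : NQuat C) ∈ P := hP.rot (hP.flip (hP.rot (hP.rot h)))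

/-- The relations among the coordinates in the exceptional case of a nonzero real part. -/
theorem exceptional (hP : TetraSystem P) {a b c d : C} (h : (⟨a, b, c, d⟩ : NQuat C) ∈ P)
    (ha : a ≠ 0) :
    a * a = -1 ∧ b * b + c * c + d * d = 1 + 1 ∧ a * b = -(b * a) ∧ a * c = -(c * a) ∧
    a * d = -(d * a) ∧ b * c = 0 ∧ c * b = 0 ∧ b * d = 0 ∧ d * b = 0 ∧ c * d = 0 ∧ d * c = 0 := by
  obtain ⟨q0, q1, q2, q3⟩ := hP.comps h
  obtain ⟨s0, t0⟩ := (hP.re_or h).resolve_left ha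
  obtain ⟨s1, t1⟩ := (hP.re_or (hP.flip h)).resolve_left ha
  obtain ⟨s2, t2⟩ := (hP.re_or (hP.flip_j h)).resolve_left ha
  obtain ⟨s3, t3⟩ := (hP.re_or (hP.flip_k h)).resolve_left ha
  have hb : a * b + b * a = 0 := by
    apply zsmul_cancel (two_ne_zero (α := ℤ))
    linear_combination (norm := noncomm_ring) t0 + t1
  have hc : a * c + c * a = 0 := by
    apply zsmul_cancel (two_ne_zero (α := ℤ))
    linear_combination (norm := noncomm_ring) t0 + t2
  have hd : a * d + d * a = 0 := by
    apply zsmul_cancel (two_ne_zero (α := ℤ))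
    linear_combination (norm := noncomm_ring) t0 + t3
  have hS : b * b + c * c + d * d = (5 : ℤ) • 1 + (3 : ℤ) • (a * a) := by
    apply zsmul_cancel (four_ne_zero (α := ℤ))
    linear_combination (norm := noncomm_ring) s0 + s1 + s2 + s3
  have haa : a * a = -1 := by
    apply zsmul_cancel (two_ne_zero (α := ℤ))
    linear_combination (norm := noncomm_ring) -q0 - hS
  have k1 : c * d = d * c := by linear_combination (norm := noncomm_ring) q1 - hb
  have k2 : d * b = b * d := by linear_combination (norm := noncomm_ring) q2 - hc
  have k3 : b * c = c * b := by linear_combination (norm := noncomm_ring) q3 - hd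
  have m1 : c * d = 0 := by
    apply zsmul_cancel (show (8 : ℤ) ≠ 0 by norm_num)
    linear_combination (norm := noncomm_ring) s0 + s1 - s2 - s3 + (4 : ℤ) • k1
  have m2 : d * b = 0 := by
    apply zsmul_cancel (show (8 : ℤ) ≠ 0 by norm_num)
    linear_combination (norm := noncomm_ring) s0 - s1 + s2 - s3 + (4 : ℤ) • k2
  have m3 : b * c = 0 := by
    apply zsmul_cancel (show (8 : ℤ) ≠ 0 by norm_num)
    linear_combination (norm := noncomm_ring) s0 - s1 - s2 + s3 + (4 : ℤ) • k3
  refine ⟨haa, ?_, eq_neg_of_add_eq_zero_left hb, eq_neg_of_add_eq_zero_left hc,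
    eq_neg_of_add_eq_zero_left hd, m3, k3 ▸ m3, k2 ▸ m2, m2, m1, k1 ▸ m1⟩
  linear_combination (norm := noncomm_ring) hS + (3 : ℤ) • haa

theorem exceptional_axis (hP : TetraSystem P) {a b : C} (h : (⟨a, b, 0, 0⟩ : NQuat C) ∈ P)
    (ha : a ≠ 0) : False := by
  obtain ⟨haa, hbb, hab, -⟩ := hP.exceptional h ha
  have hbb : b * b = 1 + 1 := by simpa using hbb
  have h3 : (⟨a, -b, 0, 0⟩ : NQuat C) ∈ P := by simpa using hP.flip_j h
  have hba : b * a = -(a * b) := by rw [hab, neg_neg]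
  have hZ : ((-1 + ⟨a, b, 0, 0⟩) * (-1 + -⟨a, -b, 0, 0⟩) * ⟨0, 1, 0, 0⟩ : NQuat C) =
      ⟨(2 : ℤ) • (b - a * b), 0, 0, 0⟩ := by
    simp only [mul_mk, one_def, add_mk, neg_mk, NQuat.mk.injEq]
    refine ⟨?_, ?_, ?_, ?_⟩
    · linear_combination (norm := noncomm_ring) hba
    · linear_combination (norm := noncomm_ring) -haa - hbb
    · noncomm_ring
    · noncomm_ring
  have hsq : (b - a * b) * (b - a * b) = (4 : ℤ) • 1 := by
    linear_combination (norm := noncomm_ring)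
      -hba * b + a * hba * b - haa * (b * b) + (2 : ℤ) • hbb
  have key : ∀ m : ℤ, m ≠ 0 → (2 : ℤ) • (b - a * b) = m • 1 → False := by
    intro m hm h0
    have h1 : a * ((2 : ℤ) • (b - a * b)) + ((2 : ℤ) • (b - a * b)) * a = 0 := by
      linear_combination (norm := noncomm_ring) (2 : ℤ) • hba - (2 : ℤ) • (a * hba)
    rw [h0] at h1
    have h2 : a = 0 := by
      apply zsmul_cancel (mul_ne_zero hm (two_ne_zero (α := ℤ)))
      rw [smul_zero, ← h1, mul_smul_comm, smul_mul_assoc, mul_one, one_mul, ← add_smul, mul_two]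
    exact ha h2
  rcases hP.invol _ h _ h3 _ hZ.symm (by
    simp only [mul_mk, NQuat.mk.injEq, mul_zero, zero_mul, sub_zero, add_zero, and_true]
    linear_combination (norm := noncomm_ring) (4 : ℤ) • hsq) with h4 | h4
  · exact key 4 (by norm_num) (by simpa only [NQuat.mk.injEq, and_true] using h4)
  · exact key (-4) (by norm_num) (by simpa only [NQuat.mk.injEq, and_true] using h4)

theorem exceptional_dichotomy (hP : TetraSystem P) {a b c d : C}
    (h : (⟨a, b, c, d⟩ : NQuat C) ∈ P) (ha : a ≠ 0) : b * b = 0 ∨ (c = 0 ∧ d = 0) := by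
  obtain ⟨haa, hS, hab, hac, had, hbc, hcb, hbd, hdb, hcd, hdc⟩ := hP.exceptional h ha
  have hb4 : (b * b) * (b * b) = (2 : ℤ) • (b * b) := by
    linear_combination (norm := noncomm_ring) b * b * hS - b * hbc * c - b * hbd * d
  have hone : b * b ≠ 1 := by
    intro h1
    rw [h1] at hb4
    exact zsmul_one_ne (C := C) (m := 1) one_ne_zero
      (by linear_combination (norm := noncomm_ring) -hb4)
  have hS2 : (⟨a, b, c, d⟩ * ⟨a, b, -c, -d⟩ + ⟨a, b, -c, -d⟩ * ⟨a, b, c, d⟩ : NQuat C) =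
      ⟨(2 : ℤ) • 1 - (4 : ℤ) • (b * b), 0, 0, 0⟩ := by
    simp only [mul_mk, add_mk, NQuat.mk.injEq]
    refine ⟨?_, ?_, ?_, ?_⟩
    · linear_combination (norm := noncomm_ring) (2 : ℤ) • haa + (2 : ℤ) • hS
    · linear_combination (norm := noncomm_ring) (2 : ℤ) • hab - (2 : ℤ) • hcd + (2 : ℤ) • hdc
    · noncomm_ring
    · noncomm_ring
  rcases hP.pair _ h _ (hP.flip h) with h1 | h1 | h1 | h1 | h1
  · right
    simp only [NQuat.mk.injEq] at h1
    constructor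
    · apply zsmul_cancel (two_ne_zero (α := ℤ))
      linear_combination (norm := noncomm_ring) -h1.2.2.1
    · apply zsmul_cancel (two_ne_zero (α := ℤ))
      linear_combination (norm := noncomm_ring) -h1.2.2.2
  · exfalso
    simp only [neg_mk, NQuat.mk.injEq] at h1
    apply ha
    apply zsmul_cancel (two_ne_zero (α := ℤ))
    linear_combination (norm := noncomm_ring) h1.1
  · left
    rw [hS2] at h1
    simp only [one_def, add_mk, NQuat.mk.injEq] at h1
    apply zsmul_cancel (four_ne_zero (α := ℤ))
    linear_combination (norm := noncomm_ring) -h1.1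
  · exfalso
    rw [hS2] at h1
    simp only [one_def, add_mk, neg_mk, NQuat.mk.injEq] at h1
    apply hone
    apply zsmul_cancel (four_ne_zero (α := ℤ))
    linear_combination (norm := noncomm_ring) -h1.1
  · exfalso
    rw [hS2] at h1
    simp only [mul_mk, NQuat.mk.injEq] at h1
    apply hone
    apply zsmul_cancel (show (16 : ℤ) ≠ 0 by norm_num)
    linear_combination (norm := noncomm_ring) h1.1 - (16 : ℤ) • hb4

theorem re_eq_zero (hP : TetraSystem P) {a b c d : C} (h : (⟨a, b, c, d⟩ : NQuat C) ∈ P) :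
    a = 0 := by
  by_contra ha
  have hr := hP.rot h
  have hrr := hP.rot hr
  obtain ⟨-, hS, -⟩ := hP.exceptional h ha
  rcases hP.exceptional_dichotomy h ha with h1 | ⟨rfl, rfl⟩
  swap; · exact hP.exceptional_axis h ha
  rcases hP.exceptional_dichotomy hr ha with h2 | ⟨rfl, rfl⟩
  swap; · exact hP.exceptional_axis hr ha
  rcases hP.exceptional_dichotomy hrr ha with h3 | ⟨rfl, rfl⟩
  swap; · exact hP.exceptional_axis hrr ha
  exact zsmul_one_ne (C := C) (m := 2) two_ne_zero
    (by linear_combination (norm := noncomm_ring) h1 + h2 + h3 - hS)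

end TetraSystem
end NQuat

namespace NQuat.TetraSystem

variable {C : Type*} [Ring C] [Algebra ℚ C] [Nontrivial C] {P : Set (NQuat C)}

theorem eq_one_ne_golden {p : C} (hp : p * p = p + 1) : p ≠ 1 := by
  rintro rfl
  exact zsmul_one_ne (C := C) (m := 1) one_ne_zero (by linear_combination (norm := noncomm_ring) -hp)

theorem golden_add_ne {p q : C} (hp : p * p = p + 1) (hq : q * q = q + 1) : p + q ≠ 0 := by
  intro h
  have h2 : p = 0 := by
    apply zsmul_cancel (two_ne_zero (α := ℤ))
    linear_combination (norm := noncomm_ring) hq - hp + h + p * h - h * q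
  rw [h2] at hp
  exact zsmul_one_ne (C := C) (m := 1) one_ne_zero (by linear_combination (norm := noncomm_ring) -hp)

/-- At most one golden ratio occurs in the coordinates of a tetrahedral system. -/
theorem golden_unique (hP : TetraSystem P) {p q : C} (hp : p * p = p + 1) (hq : q * q = q + 1)
    (h1 : (⟨0, 0, p, 1 - p⟩ : NQuat C) ∈ P) (h2 : (⟨0, 0, q, 1 - q⟩ : NQuat C) ∈ P) : q = p := by
  obtain ⟨r, hr⟩ : ∃ r, r = (2 : ℤ) • p - 1 := ⟨_, rfl⟩
  obtain ⟨s, hs⟩ : ∃ s, s = (2 : ℤ) • q - 1 := ⟨_, rfl⟩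
  obtain ⟨D, hD⟩ : ∃ D, D = p * q - q * p := ⟨_, rfl⟩
  obtain ⟨c, hc⟩ : ∃ c, c = r * s + s * r := ⟨_, rfl⟩
  have hrr : r * r = (5 : ℤ) • 1 := by
    rw [hr]; linear_combination (norm := noncomm_ring) (4 : ℤ) • hp
  have hss : s * s = (5 : ℤ) • 1 := by
    rw [hs]; linear_combination (norm := noncomm_ring) (4 : ℤ) • hq
  have hDr : (4 : ℤ) • D = r * s - s * r := by rw [hD, hr, hs]; noncomm_ring
  have hDD : (16 : ℤ) • (D * D) = c * c - (100 : ℤ) • 1 := by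
    calc (16 : ℤ) • (D * D) = ((4 : ℤ) • D) * ((4 : ℤ) • D) := by noncomm_ring
      _ = c * c - (100 : ℤ) • 1 := by
        rw [hDr, hc]
        linear_combination (norm := noncomm_ring) -(2 : ℤ) • (r * hss * r) - (10 : ℤ) • hrr
          -(2 : ℤ) • (s * hrr * s) - (10 : ℤ) • hss
  have hne : p + q ≠ 0 := golden_add_ne hp hq
  have hp1 : p ≠ 1 := eq_one_ne_golden hp
  have hc2 : c * c = (4 : ℤ) • c + (60 : ℤ) • 1 := by
    have h3 : (⟨0, 0, q, -(1 - q)⟩ : NQuat C) ∈ P := by simpa using hP.flip_j h2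
    have hS : (⟨0, 0, p, 1 - p⟩ * ⟨0, 0, q, -(1 - q)⟩ + ⟨0, 0, q, -(1 - q)⟩ * ⟨0, 0, p, 1 - p⟩ :
        NQuat C) = ⟨(2 : ℤ) • 1 - (2 : ℤ) • (p + q), (2 : ℤ) • D, 0, 0⟩ := by
      simp only [mul_mk, add_mk, NQuat.mk.injEq, hD]
      refine ⟨?_, ?_, ?_, ?_⟩ <;> noncomm_ring
    rcases hP.pair _ h1 _ h3 with h | h | h | h | h
    · exfalso
      simp only [NQuat.mk.injEq] at h
      obtain ⟨-, -, h4, h5⟩ := h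
      apply hp1
      rw [h4] at h5
      apply zsmul_cancel (two_ne_zero (α := ℤ))
      linear_combination (norm := noncomm_ring) h5
    · exfalso
      simp only [neg_mk, NQuat.mk.injEq] at h
      obtain ⟨-, -, h4, h5⟩ := h
      exact hne (by rw [h4, add_neg_cancel])
    · exfalso
      rw [hS] at h
      simp only [one_def, add_mk, NQuat.mk.injEq] at h
      apply hne
      apply zsmul_cancel (two_ne_zero (α := ℤ))
      linear_combination (norm := noncomm_ring) -h.1
    · exfalso
      rw [hS] at h
      simp only [one_def, add_mk, neg_mk, NQuat.mk.injEq] at h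
      have h4 : q = (2 : ℤ) • 1 - p := by
        apply zsmul_cancel (two_ne_zero (α := ℤ))
        linear_combination (norm := noncomm_ring) -h.1
      rw [h4] at hq
      apply hp1
      apply zsmul_cancel (two_ne_zero (α := ℤ))
      linear_combination (norm := noncomm_ring) hp - hq
    · rw [hS] at h
      simp only [mul_mk, NQuat.mk.injEq] at h
      have hh := h.1
      have e1 : (2 : ℤ) • (1 : C) - (2 : ℤ) • (p + q) = -(r + s) := by rw [hr, hs]; noncomm_ring
      rw [e1] at hh
      linear_combination (norm := noncomm_ring) -(4 : ℤ) • hh + (4 : ℤ) • hrr + (4 : ℤ) • hss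
        - hDD - (4 : ℤ) • hc
  have hc6 : q = p ∨ c = (-6 : ℤ) • 1 := by
    have hS : (⟨0, 0, p, 1 - p⟩ * ⟨0, 0, q, 1 - q⟩ + ⟨0, 0, q, 1 - q⟩ * ⟨0, 0, p, 1 - p⟩ :
        NQuat C) = ⟨-((2 : ℤ) • (p * q + q * p) - (2 : ℤ) • (p + q) + (2 : ℤ) • 1), 0, 0, 0⟩ := by
      simp only [mul_mk, add_mk, NQuat.mk.injEq]
      refine ⟨?_, ?_, ?_, ?_⟩ <;> noncomm_ring
    have hcc : c = (4 : ℤ) • (p * q + q * p) - (4 : ℤ) • (p + q) + (2 : ℤ) • 1 := by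
      rw [hc, hr, hs]; noncomm_ring
    have hc2' : c ≠ (2 : ℤ) • 1 := by
      intro h
      rw [h] at hc2
      exact zsmul_one_ne (C := C) (m := 64) (by norm_num)
        (by linear_combination (norm := noncomm_ring) -hc2)
    rcases hP.pair _ h1 _ h2 with h | h | h | h | h
    · left
      simp only [NQuat.mk.injEq] at h
      exact h.2.2.1
    · exfalso
      simp only [neg_mk, NQuat.mk.injEq] at h
      exact hne (by rw [h.2.2.1, add_neg_cancel])
    · right
      rw [hS] at h
      simp only [one_def, add_mk, NQuat.mk.injEq] at h
      linear_combination (norm := noncomm_ring) hcc - (2 : ℤ) • h.1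
    · exfalso
      rw [hS] at h
      simp only [one_def, add_mk, neg_mk, NQuat.mk.injEq] at h
      apply hc2'
      linear_combination (norm := noncomm_ring) hcc - (2 : ℤ) • h.1
    · exfalso
      rw [hS] at h
      simp only [mul_mk, NQuat.mk.injEq] at h
      obtain ⟨h, -⟩ := h
      apply hc2'
      have e1 : (c + (2 : ℤ) • 1) * (c + (2 : ℤ) • 1) = (80 : ℤ) • 1 := by
        rw [hcc]
        linear_combination (norm := noncomm_ring) (4 : ℤ) • h
      apply zsmul_cancel (show (8 : ℤ) ≠ 0 by norm_num)
      linear_combination (norm := noncomm_ring) e1 - hc2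
  rcases hc6 with h | hc6
  · exact h
  have ht : p * q + q * p = p + q - (2 : ℤ) • 1 := by
    apply zsmul_cancel (four_ne_zero (α := ℤ))
    rw [hc, hr, hs] at hc6
    linear_combination (norm := noncomm_ring) hc6
  have hD0 : D ≠ 0 := by
    intro h
    rw [h, hc6] at hDD
    exact zsmul_one_ne (C := C) (m := 64) (by norm_num)
      (by linear_combination (norm := noncomm_ring) hDD)
  have h3 : (⟨0, 1 - q, 0, q⟩ : NQuat C) ∈ P := hP.rot (hP.rot (hP.rot (hP.rot (hP.rot h2))))
  have hS : (⟨0, 0, p, 1 - p⟩ * ⟨0, 1 - q, 0, q⟩ + ⟨0, 1 - q, 0, q⟩ * ⟨0, 0, p, 1 - p⟩ :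
        NQuat C) = ⟨p - q - (2 : ℤ) • 1, D, D, D⟩ := by
    simp only [mul_mk, add_mk, NQuat.mk.injEq, hD]
    refine ⟨?_, ?_, ?_, ?_⟩
    · linear_combination (norm := noncomm_ring) ht
    all_goals noncomm_ring
  rcases hP.pair _ h1 _ h3 with h | h | h | h | h
  · simp only [NQuat.mk.injEq] at h
    exact absurd (sub_eq_zero.1 h.2.1).symm (eq_one_ne_golden hq)
  · simp only [neg_mk, NQuat.mk.injEq, neg_zero] at h
    exact absurd (sub_eq_zero.1 h.2.1).symm (eq_one_ne_golden hq)
  · rw [hS] at h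
    simp only [one_def, add_mk, NQuat.mk.injEq, add_zero] at h
    exact absurd h.2.1 hD0
  · rw [hS] at h
    simp only [one_def, add_mk, neg_mk, NQuat.mk.injEq, add_zero, neg_zero] at h
    exact absurd h.2.1 hD0
  · exfalso
    rw [hS] at h
    simp only [mul_mk, NQuat.mk.injEq] at h
    obtain ⟨-, h, -⟩ := h
    apply hD0
    apply zsmul_cancel (four_ne_zero (α := ℤ))
    have e1 : (p - q) * D + D * (p - q) = 0 := by
      rw [hD]
      linear_combination (norm := noncomm_ring) hp * q - q * hp - p * hq + hq * p
    linear_combination (norm := noncomm_ring) e1 - h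

end NQuat.TetraSystem

namespace NQuat

variable {C : Type*} [Ring C]

/-- The vectors `(±1, ±1, ±1)`. -/
def IsTetra (w : NQuat C) : Prop :=
  w.re = 0 ∧ (w.i = 1 ∨ w.i = -1) ∧ (w.j = 1 ∨ w.j = -1) ∧ (w.k = 1 ∨ w.k = -1)

/-- The cyclic permutations of the vectors `(0, ±p, ±(1 - p))`. -/
def IsIcosa (p : C) (w : NQuat C) : Prop :=
  w.re = 0 ∧
    ((w.i = 0 ∧ (w.j = p ∨ w.j = -p) ∧ (w.k = 1 - p ∨ w.k = -(1 - p))) ∨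
     (w.j = 0 ∧ (w.k = p ∨ w.k = -p) ∧ (w.i = 1 - p ∨ w.i = -(1 - p))) ∨
     (w.k = 0 ∧ (w.i = p ∨ w.i = -p) ∧ (w.j = 1 - p ∨ w.j = -(1 - p))))

namespace TetraSystem

variable [Algebra ℚ C] [Nontrivial C] {P : Set (NQuat C)}

theorem add_eq_zero_of_sums {s t u v : C} (hsum : s + t + u + v = 0) (hs : s = 1 ∨ s = -1)
    (ht : t = 1 ∨ t = -1) (hu : u * u = (5 : ℤ) • 1) (hv : v * v = (5 : ℤ) • 1) : s + t = 0 := by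
  have key : ∀ ε : C, ε = 1 ∨ ε = -1 → ¬ (u + v = -(2 : ℤ) • ε) := by
    intro ε hε h
    have hε2 : ε * ε = 1 := by rcases hε with rfl | rfl <;> noncomm_ring
    have hc : ∀ a : C, a * ε = ε * a := by
      intro a; rcases hε with rfl | rfl <;> noncomm_ring
    have h1 : v = -ε := by
      have hu' : u = -v - (2 : ℤ) • ε := by linear_combination (norm := noncomm_ring) h
      rw [hu'] at hu
      have h2 : (4 : ℤ) • (ε * v) = -((4 : ℤ) • 1) := by
        linear_combination (norm := noncomm_ring) hu - hv - (2 : ℤ) • hc v - (4 : ℤ) • hε2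
      have h3 : ε * v = -1 := by
        apply zsmul_cancel (four_ne_zero (α := ℤ))
        linear_combination (norm := noncomm_ring) h2
      linear_combination (norm := noncomm_ring) ε * h3 - hε2 * v
    rw [h1] at hv
    exact zsmul_one_ne (C := C) (m := 4) (by norm_num)
      (by linear_combination (norm := noncomm_ring) hε2 - hv)
  rcases hs with rfl | rfl <;> rcases ht with rfl | rfl
  · exact absurd (by linear_combination (norm := noncomm_ring) hsum) (key 1 (Or.inl rfl))
  · exact add_neg_cancel _
  · exact neg_add_cancel _
  · exact absurd (by linear_combination (norm := noncomm_ring) hsum) (key (-1) (Or.inr rfl))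

theorem isTetra_or_sum (hP : TetraSystem P) {b c d : C} (h : (⟨0, b, c, d⟩ : NQuat C) ∈ P) :
    IsTetra (⟨0, b, c, d⟩ : NQuat C) ∨ (b + c + d = 1 ∨ b + c + d = -1) ∨
      (b + c + d) * (b + c + d) = (5 : ℤ) • 1 := by
  rcases hP.base_pair h with h1 | h1 | h1 | h1 | h1
  · left; rw [h1]; simp [IsTetra]
  · left; rw [h1]; simp [IsTetra]
  · exact Or.inr (Or.inl (Or.inr h1.2))
  · exact Or.inr (Or.inl (Or.inl h1.2))
  · right; right; rw [h1.1]; noncomm_ring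

theorem neg_or_neg {a : C} : (-a = 1 ∨ -a = -1) ↔ (a = 1 ∨ a = -1) := by
  rw [neg_eq_iff_eq_neg, neg_inj, or_comm]

/-- A vector with a vanishing coordinate comes from a golden ratio. -/
theorem exists_golden (hP : TetraSystem P) {c d : C} (h : (⟨0, 0, c, d⟩ : NQuat C) ∈ P)
    (hs : (c + d = 1 ∨ c + d = -1) ∨ (c - d = 1 ∨ c - d = -1)) :
    ∃ p : C, p * p = p + 1 ∧ (⟨0, 0, p, 1 - p⟩ : NQuat C) ∈ P ∧ (c = p ∨ c = -p) ∧
      (d = 1 - p ∨ d = -(1 - p)) := by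
  have key : ∀ c d : C, (⟨0, 0, c, d⟩ : NQuat C) ∈ P → c + d = 1 →
      c * c = c + 1 ∧ d = 1 - c := by
    intro c d h hs
    have hd : d = 1 - c := eq_sub_of_add_eq' hs
    refine ⟨?_, hd⟩
    have h0 := (hP.comps h).1
    rw [hd] at h0
    apply zsmul_cancel (two_ne_zero (α := ℤ))
    linear_combination (norm := noncomm_ring) -h0
  have hn : (⟨0, 0, -c, -d⟩ : NQuat C) ∈ P := by simpa using hP.neg h
  have hj : (⟨0, 0, c, -d⟩ : NQuat C) ∈ P := by simpa using hP.flip_j h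
  have hk : (⟨0, 0, -c, d⟩ : NQuat C) ∈ P := by simpa using hP.flip_k h
  rcases hs with (hs | hs) | (hs | hs)
  · obtain ⟨h1, h2⟩ := key _ _ h hs
    exact ⟨c, h1, h2 ▸ h, Or.inl rfl, Or.inl h2⟩
  · obtain ⟨h1, h2⟩ := key _ _ hn (by linear_combination (norm := abel) -hs)
    exact ⟨-c, h1, h2 ▸ hn, Or.inr (neg_neg _).symm, Or.inr (by rw [← h2, neg_neg])⟩
  · obtain ⟨h1, h2⟩ := key _ _ hj (by rw [← hs]; abel)
    exact ⟨c, h1, h2 ▸ hj, Or.inl rfl, Or.inr (by rw [← h2, neg_neg])⟩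
  · obtain ⟨h1, h2⟩ := key _ _ hk (by linear_combination (norm := abel) -hs)
    exact ⟨-c, h1, h2 ▸ hk, Or.inr (neg_neg _).symm, Or.inl h2⟩

theorem isTetra_or_axis (hP : TetraSystem P) {b c d : C} (h : (⟨0, b, c, d⟩ : NQuat C) ∈ P) :
    IsTetra (⟨0, b, c, d⟩ : NQuat C) ∨
    (b = 0 ∧ ((c + d = 1 ∨ c + d = -1) ∨ (c - d = 1 ∨ c - d = -1))) ∨
    (c = 0 ∧ ((d + b = 1 ∨ d + b = -1) ∨ (d - b = 1 ∨ d - b = -1))) ∨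
    (d = 0 ∧ ((b + c = 1 ∨ b + c = -1) ∨ (b - c = 1 ∨ b - c = -1))) := by
  by_cases hT : IsTetra (⟨0, b, c, d⟩ : NQuat C)
  · exact Or.inl hT
  right
  have e0 := (hP.isTetra_or_sum h).resolve_left hT
  have e1 := (hP.isTetra_or_sum (hP.flip h)).resolve_left (by
    simpa only [IsTetra, neg_or_neg] using hT)
  have e2 := (hP.isTetra_or_sum (hP.flip_j h)).resolve_left (by
    simpa only [IsTetra, neg_or_neg] using hT)
  have e3 := (hP.isTetra_or_sum (hP.flip_k h)).resolve_left (by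
    simpa only [IsTetra, neg_or_neg] using hT)
  have hq := (hP.comps h).1
  have hsum : (b + c + d) * (b + c + d) + (b + -c + -d) * (b + -c + -d) +
      (-b + c + -d) * (-b + c + -d) + (-b + -c + d) * (-b + -c + d) = (12 : ℤ) • 1 := by
    linear_combination (norm := noncomm_ring) -(4 : ℤ) • hq
  have sq : ∀ s : C, s = 1 ∨ s = -1 → s * s = 1 := by
    rintro s (rfl | rfl) <;> noncomm_ring
  have hne : ∀ m : ℤ, m ≠ 0 → m • (1 : C) ≠ 0 := fun m hm => zsmul_one_ne hm
  have half : ∀ a : C, (2 : ℤ) • a = 0 → a = 0 := fun a ha =>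
    zsmul_cancel two_ne_zero (ha.trans (smul_zero _).symm)
  rcases e0 with e0 | e0 <;> rcases e1 with e1 | e1 <;> rcases e2 with e2 | e2 <;>
    rcases e3 with e3 | e3
  · rw [sq _ e0, sq _ e1, sq _ e2, sq _ e3] at hsum
    exact absurd (by linear_combination (norm := noncomm_ring) -hsum) (hne 8 (by norm_num))
  · rw [sq _ e0, sq _ e1, sq _ e2, e3] at hsum
    exact absurd (by linear_combination (norm := noncomm_ring) -hsum) (hne 4 (by norm_num))
  · rw [sq _ e0, sq _ e1, e2, sq _ e3] at hsum
    exact absurd (by linear_combination (norm := noncomm_ring) -hsum) (hne 4 (by norm_num))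
  · left
    have hb : b = 0 := half _ (by
      rw [← add_eq_zero_of_sums (by abel) e0 e1 e2 e3]; abel)
    refine ⟨hb, Or.inl ?_⟩
    simpa [hb] using e0
  · rw [sq _ e0, e1, sq _ e2, sq _ e3] at hsum
    exact absurd (by linear_combination (norm := noncomm_ring) -hsum) (hne 4 (by norm_num))
  · right; left
    have hb : c = 0 := half _ (by
      rw [← add_eq_zero_of_sums (by abel) e0 e2 e1 e3]; abel)
    refine ⟨hb, Or.inl ?_⟩
    rw [add_comm d b]
    simpa [hb] using e0
  · right; right
    have hb : d = 0 := half _ (by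
      rw [← add_eq_zero_of_sums (by abel) e0 e3 e1 e2]; abel)
    refine ⟨hb, Or.inl ?_⟩
    simpa [hb] using e0
  · rw [sq _ e0, e1, e2, e3] at hsum
    exact absurd (by linear_combination (norm := noncomm_ring) hsum) (hne 4 (by norm_num))
  · rw [e0, sq _ e1, sq _ e2, sq _ e3] at hsum
    exact absurd (by linear_combination (norm := noncomm_ring) -hsum) (hne 4 (by norm_num))
  · right; right
    have hb : d = 0 := half _ (by
      rw [← neg_eq_zero.2 (add_eq_zero_of_sums (by abel) e1 e2 e0 e3)]; abel)
    refine ⟨hb, Or.inr ?_⟩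
    simpa [hb, sub_eq_add_neg] using e1
  · right; left
    have hb : c = 0 := half _ (by
      rw [← neg_eq_zero.2 (add_eq_zero_of_sums (by abel) e1 e3 e0 e2)]; abel)
    refine ⟨hb, Or.inr ?_⟩
    rw [← neg_or_neg, neg_sub, sub_eq_add_neg]
    simpa [hb] using e1
  · rw [e0, sq _ e1, e2, e3] at hsum
    exact absurd (by linear_combination (norm := noncomm_ring) hsum) (hne 4 (by norm_num))
  · left
    have hb : b = 0 := half _ (by
      rw [← neg_eq_zero.2 (add_eq_zero_of_sums (by abel) e2 e3 e0 e1)]; abel)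
    refine ⟨hb, Or.inr ?_⟩
    simpa [hb, sub_eq_add_neg] using e2
  · rw [e0, e1, sq _ e2, e3] at hsum
    exact absurd (by linear_combination (norm := noncomm_ring) hsum) (hne 4 (by norm_num))
  · rw [e0, e1, e2, sq _ e3] at hsum
    exact absurd (by linear_combination (norm := noncomm_ring) hsum) (hne 4 (by norm_num))
  · rw [e0, e1, e2, e3] at hsum
    exact absurd (by linear_combination (norm := noncomm_ring) hsum) (hne 8 (by norm_num))

/-- A tetrahedral system either consists of the eight obvious vectors, or all its other vectors
are obtained from a single golden ratio. -/
theorem classification (hP : TetraSystem P) :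
    (∀ w ∈ P, IsTetra w) ∨ ∃ p : C, p * p = p + 1 ∧ (⟨0, 0, p, 1 - p⟩ : NQuat C) ∈ P ∧
      ∀ w ∈ P, IsTetra w ∨ IsIcosa p w := by
  have key : ∀ w ∈ P, IsTetra w ∨ ∃ p : C, p * p = p + 1 ∧ (⟨0, 0, p, 1 - p⟩ : NQuat C) ∈ P ∧
      IsIcosa p w := by
    rintro ⟨a, b, c, d⟩ h
    obtain rfl := hP.re_eq_zero h
    rcases hP.isTetra_or_axis h with h1 | ⟨rfl, h1⟩ | ⟨rfl, h1⟩ | ⟨rfl, h1⟩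
    · exact Or.inl h1
    · obtain ⟨p, hp, hpP, h2, h3⟩ := hP.exists_golden h h1
      exact Or.inr ⟨p, hp, hpP, rfl, Or.inl ⟨rfl, h2, h3⟩⟩
    · obtain ⟨p, hp, hpP, h2, h3⟩ := hP.exists_golden (hP.rot h) h1
      exact Or.inr ⟨p, hp, hpP, rfl, Or.inr (Or.inl ⟨rfl, h2, h3⟩)⟩
    · obtain ⟨p, hp, hpP, h2, h3⟩ := hP.exists_golden (hP.rot (hP.rot h)) h1
      exact Or.inr ⟨p, hp, hpP, rfl, Or.inr (Or.inr ⟨rfl, h2, h3⟩)⟩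
  by_cases hall : ∀ w ∈ P, IsTetra w
  · exact Or.inl hall
  push Not at hall
  obtain ⟨w, hw, hnw⟩ := hall
  obtain ⟨p, hp, hpP, -⟩ := (key w hw).resolve_left hnw
  refine Or.inr ⟨p, hp, hpP, fun v hv => ?_⟩
  rcases key v hv with h1 | ⟨q, hq, hqP, h1⟩
  · exact Or.inl h1
  · rw [hP.golden_unique hp hq hpP hqP] at h1
    exact Or.inr h1

end TetraSystem
end NQuat

namespace NQuat

variable {R : Type*} [Ring R] [Algebra ℚ R] {i j : R}

/-- Evaluation of quaternions with coefficients commuting with the two units `i`, `j`. -/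
def toRing (i j : R) (w : NQuat (Subalgebra.centralizer ℚ {i, j})) : R :=
  w.re + w.i * i + w.j * j + w.k * (i * j)

theorem comm_i (n : Subalgebra.centralizer ℚ {i, j}) : i * (n : R) = n * i :=
  Subalgebra.mem_centralizer_iff ℚ |>.1 n.2 i (by simp)

theorem comm_j (n : Subalgebra.centralizer ℚ {i, j}) : j * (n : R) = n * j :=
  Subalgebra.mem_centralizer_iff ℚ |>.1 n.2 j (by simp)

theorem toRing_one : toRing i j 1 = 1 := by simp [toRing, one_def]

theorem toRing_add (v w : NQuat (Subalgebra.centralizer ℚ {i, j})) :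
    toRing i j (v + w) = toRing i j v + toRing i j w := by
  obtain ⟨a, b, c, d⟩ := v
  obtain ⟨a', b', c', d'⟩ := w
  simp only [toRing, add_mk, Subalgebra.coe_add]
  noncomm_ring

theorem toRing_neg (v : NQuat (Subalgebra.centralizer ℚ {i, j})) :
    toRing i j (-v) = -toRing i j v := by
  obtain ⟨a, b, c, d⟩ := v
  simp only [toRing, neg_mk, Subalgebra.coe_neg]
  noncomm_ring

theorem toRing_mul (hi : i * i = -1) (hj : j * j = -1) (hij : j * i = -(i * j))
    (v w : NQuat (Subalgebra.centralizer ℚ {i, j})) :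
    toRing i j (v * w) = toRing i j v * toRing i j w := by
  obtain ⟨a, b, c, d⟩ := v
  obtain ⟨a', b', c', d'⟩ := w
  have ci (n : Subalgebra.centralizer ℚ {i, j}) (x : R) : i * (n * x) = n * (i * x) := by
    rw [← mul_assoc, comm_i, mul_assoc]
  have cj (n : Subalgebra.centralizer ℚ {i, j}) (x : R) : j * (n * x) = n * (j * x) := by
    rw [← mul_assoc, comm_j, mul_assoc]
  have hi' (x : R) : i * (i * x) = -x := by rw [← mul_assoc, hi, neg_one_mul]
  have hj' (x : R) : j * (j * x) = -x := by rw [← mul_assoc, hj, neg_one_mul]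
  have hij' (x : R) : j * (i * x) = -(i * (j * x)) := by
    rw [← mul_assoc, hij, neg_mul, mul_assoc]
  simp only [toRing, mul_mk, Subalgebra.coe_add, Subalgebra.coe_sub, Subalgebra.coe_mul]
  simp only [mul_add, add_mul, sub_mul, mul_assoc, comm_i, comm_j, ci, cj, hi, hj, hij, hi', hj',
    hij', mul_neg, neg_neg, mul_one]
  abel

theorem toRing_surjective (hi : i * i = -1) (hj : j * j = -1) (hij : j * i = -(i * j)) :
    Function.Surjective (toRing i j) := by
  have hre : ∀ a : R, a - i * a * i - j * a * j - (i * j) * a * (i * j) ∈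
      Subalgebra.centralizer ℚ {i, j} := by
    intro a
    rw [Subalgebra.mem_centralizer_iff]
    have hi' (x : R) : i * (i * x) = -x := by rw [← mul_assoc, hi, neg_one_mul]
    have hj' (x : R) : j * (j * x) = -x := by rw [← mul_assoc, hj, neg_one_mul]
    have hij' (x : R) : j * (i * x) = -(i * (j * x)) := by
      rw [← mul_assoc, hij, neg_mul, mul_assoc]
    rintro x (rfl | rfl)
    · simp only [mul_sub, sub_mul, mul_assoc, hi, hi', hj, hij, hij', mul_neg, neg_neg, mul_one,
        neg_mul]
      abel
    · simp only [mul_sub, sub_mul, mul_assoc, hi, hi', hj, hj', hij, hij', mul_neg, neg_neg,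
        mul_one, neg_mul]
      abel
  intro a
  let re (a : R) : Subalgebra.centralizer ℚ {i, j} :=
    (4⁻¹ : ℚ) • ⟨a - i * a * i - j * a * j - (i * j) * a * (i * j), hre a⟩
  refine ⟨⟨re a, re (-(a * i)), re (-(a * j)), re (-(a * (i * j)))⟩, ?_⟩
  apply smul_right_injective R (show (4 : ℚ) ≠ 0 by norm_num)
  simp only [toRing, re, SetLike.val_smul, smul_add, smul_mul_assoc, smul_smul]
  norm_num
  have hi' (x : R) : i * (i * x) = -x := by rw [← mul_assoc, hi, neg_one_mul]
  have hj' (x : R) : j * (j * x) = -x := by rw [← mul_assoc, hj, neg_one_mul]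
  have hij' (x : R) : j * (i * x) = -(i * (j * x)) := by
    rw [← mul_assoc, hij, neg_mul, mul_assoc]
  have h4 : (4 : ℚ) • a = a + a + a + a := by
    rw [show (4 : ℚ) = 1 + 1 + 1 + 1 by norm_num]; simp only [add_smul, one_smul]
  rw [h4]
  simp only [mul_sub, sub_mul, add_mul, mul_assoc, hi, hi', hj, hj', hij, hij', mul_neg, neg_neg,
    mul_one, neg_mul]
  abel

theorem toRing_injective (hi : i * i = -1) (hj : j * j = -1) (hij : j * i = -(i * j)) :
    Function.Injective (toRing i j) := by
  have key : ∀ w : NQuat (Subalgebra.centralizer ℚ {i, j}), toRing i j w = 0 → (w.re : R) = 0 := by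
    rintro ⟨a, b, c, d⟩ h
    have ci (n : Subalgebra.centralizer ℚ {i, j}) (x : R) : i * (n * x) = n * (i * x) := by
      rw [← mul_assoc, comm_i, mul_assoc]
    have cj (n : Subalgebra.centralizer ℚ {i, j}) (x : R) : j * (n * x) = n * (j * x) := by
      rw [← mul_assoc, comm_j, mul_assoc]
    have hi' (x : R) : i * (i * x) = -x := by rw [← mul_assoc, hi, neg_one_mul]
    have hj' (x : R) : j * (j * x) = -x := by rw [← mul_assoc, hj, neg_one_mul]
    have hij' (x : R) : j * (i * x) = -(i * (j * x)) := by
      rw [← mul_assoc, hij, neg_mul, mul_assoc]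
    obtain ⟨x, hx⟩ : ∃ x, x = toRing i j ⟨a, b, c, d⟩ := ⟨_, rfl⟩
    have h1 : x - i * x * i - j * x * j - (i * j) * x * (i * j) = (4 : ℤ) • (a : R) := by
      rw [hx]
      simp only [toRing, mul_add, add_mul, mul_assoc, comm_i, comm_j, ci, cj, hi, hj, hij, hi',
        hj', hij', mul_neg, neg_neg, mul_one, neg_mul]
      abel
    rw [hx, h] at h1
    exact TetraSystem.zsmul_cancel four_ne_zero (by rw [← h1]; simp)
  intro v w h
  have h0 : toRing i j (v + -w) = 0 := by rw [toRing_add, toRing_neg, h, add_neg_cancel]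
  have kk : ∀ q : NQuat (Subalgebra.centralizer ℚ {i, j}), ((v + -w) * q).re = 0 := fun q =>
    Subtype.ext (key _ (by rw [toRing_mul hi hj hij, h0, zero_mul]))
  obtain ⟨a, b, c, d⟩ := v
  obtain ⟨a', b', c', d'⟩ := w
  have k0 := kk ⟨1, 0, 0, 0⟩
  have k1 := kk ⟨0, 1, 0, 0⟩
  have k2 := kk ⟨0, 0, 1, 0⟩
  have k3 := kk ⟨0, 0, 0, 1⟩
  simp only [add_mk, neg_mk, mul_mk, mul_one, mul_zero, sub_zero, zero_sub, neg_eq_zero]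
    at k0 k1 k2 k3
  rw [NQuat.mk.injEq]
  exact ⟨eq_of_sub_eq_zero (by rw [← k0, sub_eq_add_neg]),
    eq_of_sub_eq_zero (by rw [← k1, sub_eq_add_neg]),
    eq_of_sub_eq_zero (by rw [← k2, sub_eq_add_neg]),
    eq_of_sub_eq_zero (by rw [← k3, sub_eq_add_neg])⟩

end NQuat

theorem zsmul_one_mul {R : Type*} [Ring R] (m : ℤ) (a : R) : (m • (1 : R)) * a = m • a := by
  rw [smul_mul_assoc, one_mul]

namespace NQuat

variable {C : Type*} [Ring C]

theorem conj_i (a b c d : C) :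
    (⟨0, 1, 0, 0⟩ * ⟨a, b, c, d⟩ * -⟨0, 1, 0, 0⟩ : NQuat C) = ⟨a, b, -c, -d⟩ := by
  simp only [mul_mk, neg_mk, mk.injEq]
  refine ⟨?_, ?_, ?_, ?_⟩ <;> simp

theorem conj_ijk (a b c d : C) :
    ((-1 + ⟨0, 1, 1, 1⟩) * ⟨a, b, c, d⟩ * (-1 + -⟨0, 1, 1, 1⟩) : NQuat C) =
      ⟨(4 : ℤ) • 1, 0, 0, 0⟩ * ⟨a, c, d, b⟩ := by
  simp only [mul_mk, neg_mk, add_mk, one_def, mk.injEq, zsmul_one_mul, zero_mul, neg_zero,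
    zero_add, add_zero, neg_mul, one_mul, mul_neg, mul_one]
  refine ⟨?_, ?_, ?_, ?_⟩ <;> abel

end NQuat

namespace FixedPointFreeRep

variable {H W : Type*} [Group H] [AddCommGroup W] [Module ℚ W] [FiniteDimensional ℚ W]
  {ρ : H →* Module.End ℚ W}

theorem orderOf_conj {H : Type*} [Group H] (g x : H) : orderOf (g * x * g⁻¹) = orderOf x :=
  orderOf_injective (MulAut.conj g).toMonoidHom (MulAut.conj g).injective x

/-- Two noncommuting elements of order three may be replaced by a pair that generates a binary
tetrahedral group. -/
theorem exists_tetra_pair (hρ : FixedPointFreeRep ρ) [Finite H] [Nontrivial W] {x y : H}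
    (hx : orderOf x = 3) (hy : orderOf y = 3) (hxy : x * y ≠ y * x) :
    ∃ y' : H, orderOf y' = 3 ∧ ρ x * ρ y' + ρ y' * ρ x = -1 - ρ x - ρ y' := by
  have hyi := hρ.inv_of_orderOf_three hy
  have hx2 := hρ.mul_self_of_orderOf_three hx
  have hy2 := hρ.mul_self_of_orderOf_three hy
  have half : ∀ {a b : Module.End ℚ W}, (4 : ℤ) • a = (4 : ℤ) • b → a = b := fun h =>
    NQuat.TetraSystem.zsmul_cancel four_ne_zero h
  rcases hρ.orderOf_three_pair hx hy rfl rfl with h | h | h | h | h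
  · exact absurd (by rw [h]) hxy
  · exact absurd (by rw [h, mul_inv_cancel, inv_mul_cancel]) hxy
  · refine ⟨y⁻¹, by rw [orderOf_inv, hy], ?_⟩
    rw [hyi]
    apply half
    linear_combination (norm := noncomm_ring) -h
  · refine ⟨y, hy, ?_⟩
    apply half
    linear_combination (norm := noncomm_ring) h
  · refine ⟨y * x * y⁻¹, by rw [orderOf_conj, hx], ?_⟩
    rw [map_mul, map_mul, hyi]
    generalize ρ x = a at *
    generalize ρ y = b at *
    obtain ⟨X, hX⟩ : ∃ X, X = a + a + 1 := ⟨_, rfl⟩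
    obtain ⟨Y, hY⟩ : ∃ Y, Y = b + b + 1 := ⟨_, rfl⟩
    have hXX : X * X = -(1 + 1 + 1) := by
      rw [hX]; linear_combination (norm := noncomm_ring) (4 : ℤ) • hx2
    have hYY : Y * Y = -(1 + 1 + 1) := by
      rw [hY]; linear_combination (norm := noncomm_ring) (4 : ℤ) • hy2
    rw [← hX, ← hY] at h
    have key : X * ((Y - 1) * X * (-Y - 1)) + ((Y - 1) * X * (-Y - 1)) * X = -(8 : ℤ) • 1 := by
      linear_combination (norm := noncomm_ring) -h + X * hYY * X - Y * hXX * Y - hXX - hYY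
        + hXX * Y - Y * hXX + (2 : ℤ) • (Y * hXX * Y) - (2 : ℤ) • hYY
    apply NQuat.TetraSystem.zsmul_cancel (show (16 : ℤ) ≠ 0 by norm_num)
    rw [hX, hY] at key
    linear_combination (norm := noncomm_ring)
      key + (8 : ℤ) • (a * hy2) + (8 : ℤ) • hy2 + (8 : ℤ) • (hy2 * a)

/-- Noncommuting elements of order three produce a system of quaternion units. -/
theorem exists_frame (hρ : FixedPointFreeRep ρ) [Finite H] [Nontrivial W] {x y : H}
    (hx : orderOf x = 3) (hy : orderOf y = 3) (hxy : x * y ≠ y * x) :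
    ∃ s t : H, ρ s * ρ s = -1 ∧ ρ t * ρ t = -1 ∧ ρ t * ρ s = -(ρ s * ρ t) ∧
      ρ x + ρ x + 1 = ρ s + ρ t + ρ s * ρ t := by
  obtain ⟨z, hz, h⟩ := hρ.exists_tetra_pair hx hy hxy
  have hx2 := hρ.mul_self_of_orderOf_three hx
  have hz2 := hρ.mul_self_of_orderOf_three hz
  have hxi := hρ.inv_of_orderOf_three hx
  have hzi := hρ.inv_of_orderOf_three hz
  refine ⟨z⁻¹ * x⁻¹, x⁻¹ * z⁻¹, ?_⟩
  rw [map_mul, map_mul, hxi, hzi]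
  generalize ρ x = a at *
  generalize ρ z = b at *
  have e1 : (-1 - b) * (-1 - a) = -(a * b) := by linear_combination (norm := noncomm_ring) h
  have e2 : (-1 - a) * (-1 - b) = -(b * a) := by linear_combination (norm := noncomm_ring) h
  rw [e1, e2]
  have h1 : a * b * (a * b) = -1 := by
    linear_combination (norm := noncomm_ring) a * h * b - hx2 * b - a * hz2 - hx2 * b * b + hz2 + a * hz2
  have h2 : b * a * (b * a) = -1 := by
    linear_combination (norm := noncomm_ring) b * h * a - hz2 * a - b * hx2 - hz2 * a * a + hx2
      + b * hx2
  have h3 : b * a * b = 1 + a := by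
    linear_combination (norm := noncomm_ring) b * h - hz2 * a - hz2
  have h4 : a * b * a = 1 + b := by
    linear_combination (norm := noncomm_ring) a * h - hx2 * b - hx2
  refine ⟨by linear_combination (norm := noncomm_ring) h1,
    by linear_combination (norm := noncomm_ring) h2, ?_, ?_⟩
  · linear_combination (norm := noncomm_ring) b * hx2 * b + a * hz2 * a - hz2 - hx2 - h3 - h4
  · linear_combination (norm := noncomm_ring) h - a * hz2 * a + hx2 + h4

/-- The scaled imaginary parts of the elements of order three, in quaternion coordinates. -/
def threeSet (ρ : H →* Module.End ℚ W) (s t : H) :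
    Set (NQuat (Subalgebra.centralizer ℚ {ρ s, ρ t})) :=
  {w | ∃ g : H, orderOf g = 3 ∧ NQuat.toRing (ρ s) (ρ t) w = ρ g + ρ g + 1}

theorem eq_one_or_of_mul_self (hρ : FixedPointFreeRep ρ) [Nontrivial W] {g : H}
    (h : ρ g * ρ g = 1) : ρ g = 1 ∨ ρ g = -1 := by
  by_cases hg : g = 1
  · left; rw [hg, map_one]
  · right
    refine hρ.eq_neg_one_of_orderOf (orderOf_eq_prime ?_ hg)
    apply hρ.injective
    rw [sq, map_mul, h, map_one]

theorem threeSet_conj {s t : H}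
    {w w' : NQuat (Subalgebra.centralizer ℚ {ρ s, ρ t})} (hw : w ∈ threeSet ρ s t) (u : H)
    (h : NQuat.toRing (ρ s) (ρ t) w' = ρ u * NQuat.toRing (ρ s) (ρ t) w * ρ u⁻¹) :
    w' ∈ threeSet ρ s t := by
  obtain ⟨g, hg, hgw⟩ := hw
  refine ⟨u * g * u⁻¹, by rw [orderOf_conj, hg], ?_⟩
  have h1 : ρ u * ρ u⁻¹ = 1 := by rw [← map_mul, mul_inv_cancel, map_one]
  rw [h, hgw, map_mul, map_mul]
  linear_combination (norm := noncomm_ring) h1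

theorem tetraSystem (hρ : FixedPointFreeRep ρ) [Finite H] [Nontrivial W] {s t x : H}
    (hs : ρ s * ρ s = -1) (ht : ρ t * ρ t = -1) (hst : ρ t * ρ s = -(ρ s * ρ t))
    (hx : orderOf x = 3) (hxs : ρ x + ρ x + 1 = ρ s + ρ t + ρ s * ρ t) :
    NQuat.TetraSystem (threeSet ρ s t) := by
  have inj := NQuat.toRing_injective hs ht hst
  have mul := NQuat.toRing_mul hs ht hst
  have hxe : NQuat.toRing (ρ s) (ρ t) ⟨0, 1, 1, 1⟩ = ρ x + ρ x + 1 := by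
    rw [hxs]; simp [NQuat.toRing]
  have h_int : ∀ m : ℤ, NQuat.toRing (ρ s) (ρ t) ⟨m • 1, 0, 0, 0⟩ = m • 1 := by
    intro m; simp [NQuat.toRing]
  have hsi : ρ s⁻¹ = -ρ s := by
    have h1 : ρ s * ρ s⁻¹ = 1 := by rw [← map_mul, mul_inv_cancel, map_one]
    linear_combination (norm := noncomm_ring) hs * ρ s⁻¹ - ρ s * h1
  refine ⟨⟨x, hx, hxe⟩, ?_, ?_, ?_, ?_, ?_, ?_⟩
  · rintro a b c d ⟨g, hg, h⟩
    refine ⟨g⁻¹, by rw [orderOf_inv, hg], ?_⟩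
    rw [← NQuat.neg_mk, NQuat.toRing_neg, h, hρ.inv_of_orderOf_three hg]
    noncomm_ring
  · intro a b c d h
    refine threeSet_conj h s ?_
    have e1 : NQuat.toRing (ρ s) (ρ t) ⟨0, 1, 0, 0⟩ = ρ s := by simp [NQuat.toRing]
    have e2 : ρ s * NQuat.toRing (ρ s) (ρ t) ⟨a, b, c, d⟩ * -ρ s =
        NQuat.toRing (ρ s) (ρ t) (⟨0, 1, 0, 0⟩ * ⟨a, b, c, d⟩ * -⟨0, 1, 0, 0⟩) := by
      rw [mul, mul, NQuat.toRing_neg, e1]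
    rw [hsi, e2, NQuat.conj_i]
  · intro a b c d h
    refine threeSet_conj h x ?_
    rw [hρ.inv_of_orderOf_three hx]
    apply NQuat.TetraSystem.zsmul_cancel four_ne_zero
    have e2 : (4 : ℤ) • (ρ x * NQuat.toRing (ρ s) (ρ t) ⟨a, b, c, d⟩ * (-1 - ρ x)) =
        NQuat.toRing (ρ s) (ρ t) ((-1 + ⟨0, 1, 1, 1⟩) * ⟨a, b, c, d⟩ * (-1 + -⟨0, 1, 1, 1⟩)) := by
      rw [mul, mul, NQuat.toRing_add, NQuat.toRing_add, NQuat.toRing_neg, NQuat.toRing_neg,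
        NQuat.toRing_one, hxe]
      noncomm_ring
    have e3 : (4 : ℤ) • NQuat.toRing (ρ s) (ρ t) ⟨a, c, d, b⟩ =
        NQuat.toRing (ρ s) (ρ t) (⟨(4 : ℤ) • 1, 0, 0, 0⟩ * ⟨a, c, d, b⟩) := by
      rw [mul, h_int, zsmul_one_mul]
    rw [e2, e3, NQuat.conj_ijk]
  · rintro X ⟨g, hg, h⟩
    apply inj
    rw [mul, NQuat.toRing_neg, NQuat.toRing_add, NQuat.toRing_add, NQuat.toRing_one, h]
    linear_combination (norm := noncomm_ring) (4 : ℤ) • hρ.mul_self_of_orderOf_three hg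
  · rintro X ⟨g, hg, hX⟩ Y ⟨g', hg', hY⟩
    rcases hρ.orderOf_three_pair hg hg' hX hY with h | h | h | h | h
    · left
      apply inj
      rw [hX, hY, h]
    · right; left
      apply inj
      rw [NQuat.toRing_neg, hX, hY, h, hρ.inv_of_orderOf_three hg]
      noncomm_ring
    · right; right; left
      apply inj
      rw [NQuat.toRing_add, NQuat.toRing_add, mul, mul, NQuat.toRing_one, h]
    · right; right; right; left
      apply inj
      rw [NQuat.toRing_neg, NQuat.toRing_add, NQuat.toRing_add, mul, mul, NQuat.toRing_one, h]
    · right; right; right; right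
      apply inj
      rw [mul, NQuat.toRing_add, mul, mul, h, h_int]
  · rintro X ⟨g, hg, hX⟩ Y ⟨g', hg', hY⟩ Z hZ hZZ
    have e1 : NQuat.toRing (ρ s) (ρ t) Z = (4 : ℤ) • ρ (g * g'⁻¹ * s) := by
      rw [hZ, mul, mul, NQuat.toRing_add, NQuat.toRing_add, NQuat.toRing_neg, NQuat.toRing_neg,
        NQuat.toRing_one, hX, hY, map_mul, map_mul, hρ.inv_of_orderOf_three hg']
      simp only [NQuat.toRing, ZeroMemClass.coe_zero, OneMemClass.coe_one]
      noncomm_ring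
    have e2 : ρ (g * g'⁻¹ * s) * ρ (g * g'⁻¹ * s) = 1 := by
      apply NQuat.TetraSystem.zsmul_cancel (show (16 : ℤ) ≠ 0 by norm_num)
      rw [← h_int, ← hZZ, mul, e1]
      noncomm_ring
    rcases hρ.eq_one_or_of_mul_self e2 with h | h
    · left
      apply inj
      rw [e1, h, h_int]
    · right
      apply inj
      rw [e1, h, h_int, smul_neg, neg_smul]

end FixedPointFreeRep

/-- The ring `ℤ[φ]` of golden integers. -/
abbrev Golden := QuadraticAlgebra ℤ 1 1

namespace NQuat

instance {C : Type*} [DecidableEq C] : DecidableEq (NQuat C) := fun a b =>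
  decidable_of_iff (a.re = b.re ∧ a.i = b.i ∧ a.j = b.j ∧ a.k = b.k) (NQuat.ext_iff).symm

/-- Half the product of two doubled icosians. -/
def halfMul (a b : NQuat Golden) : NQuat Golden :=
  let h (z : Golden) : Golden := ⟨z.re / 2, z.im / 2⟩
  ⟨h (a * b).re, h (a * b).i, h (a * b).j, h (a * b).k⟩

/-- The doubled generators of the binary icosahedral group. -/
def icoS : NQuat Golden := ⟨0, ⟨2, 0⟩, 0, 0⟩
def icoT : NQuat Golden := ⟨0, 0, ⟨2, 0⟩, 0⟩
def icoX : NQuat Golden := ⟨-1, 1, 1, 1⟩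
def icoY : NQuat Golden := ⟨-1, 0, ⟨0, 1⟩, ⟨1, -1⟩⟩

/-- The doubles of the 120 units of the icosian ring. -/
def icoList : List (NQuat Golden) :=
  (List.range 4).flatMap fun b => (List.range 2).flatMap fun c => (List.range 3).flatMap fun d =>
    (List.range 5).map fun e =>
      (halfMul icoS)^[b] ((halfMul icoT)^[c] ((halfMul icoX)^[d]
        ((fun a => halfMul icoT (halfMul icoY a))^[e] ⟨⟨2, 0⟩, 0, 0, 0⟩)))

theorem icoList_closed : ∀ g ∈ [icoS, icoT, icoX, icoY], ∀ a ∈ icoList,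
    halfMul g a ∈ icoList ∧ halfMul g a + halfMul g a = g * a := by
  decide +kernel

theorem icoList_nodup : icoList.Nodup := by
  decide +kernel

end NQuat

theorem Int.eq_zero_of_golden {m n : ℤ} (h : n * n = m * n + m * m) : m = 0 ∧ n = 0 := by
  have h5 : (2 * n - m) * (2 * n - m) = 5 * (m * m) := by linear_combination 4 * h
  have hm : m = 0 := by
    by_contra hm
    have hirr : Irrational (√(5 : ℕ) : ℝ) := Nat.Prime.irrational_sqrt (by norm_num)
    rw [Nat.cast_ofNat] at hirr
    have h6 : ((2 * n - m) * (2 * n - m) : ℝ) = 5 * (m * m) := by exact_mod_cast h5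
    have hm' : (m : ℝ) ≠ 0 := by exact_mod_cast hm
    apply hirr
    refine ⟨|((2 * n - m : ℤ) : ℚ) / (m : ℤ)|, ?_⟩
    rw [Rat.cast_abs]
    refine ((Real.sqrt_eq_iff_mul_self_eq (by norm_num) (abs_nonneg _)).2 ?_).symm
    rw [abs_mul_abs_self]
    push_cast
    rw [div_mul_div_comm, h6, mul_div_cancel_right₀ _ (mul_ne_zero hm' hm')]
  subst hm
  simpa using h

namespace Golden

variable {C : Type*} [Ring C]

/-- Evaluation of a golden integer at a given element. -/
def eval (p : C) (z : Golden) : C := z.re • 1 + z.im • p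

variable {p : C}

theorem eval_add (z w : Golden) : eval p (z + w) = eval p z + eval p w := by
  simp only [eval, QuadraticAlgebra.re_add, QuadraticAlgebra.im_add, add_smul]
  abel

theorem eval_neg (z : Golden) : eval p (-z) = -eval p z := by
  simp only [eval, QuadraticAlgebra.re_neg, QuadraticAlgebra.im_neg, neg_smul]
  abel

theorem eval_sub (z w : Golden) : eval p (z - w) = eval p z - eval p w := by
  rw [sub_eq_add_neg, eval_add, eval_neg, sub_eq_add_neg]

theorem eval_mul (hp : p * p = p + 1) (z w : Golden) :
    eval p (z * w) = eval p z * eval p w := by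
  simp only [eval, QuadraticAlgebra.re_mul, QuadraticAlgebra.im_mul, mul_add, add_mul,
    smul_mul_smul_comm, mul_one, one_mul, hp, smul_add, add_smul]
  abel

theorem eval_injective [Algebra ℚ C] [Nontrivial C] (hp : p * p = p + 1) :
    Function.Injective (eval p) := by
  have key : ∀ m n : ℤ, m • (1 : C) + n • p = 0 → m = 0 ∧ n = 0 := by
    intro m n h
    have h0 : (n * n - (m * n + m * m)) • (1 : C) = 0 := by
      have h1 : (m • (1 : C) + n • p) * ((m + n) • (1 : C) - n • p) = 0 := by rw [h, zero_mul]
      have h2 : (m • (1 : C) + n • p) * ((m + n) • (1 : C) - n • p) =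
          -((n * n - (m * n + m * m)) • (1 : C)) := by
        simp only [mul_sub, add_mul, smul_mul_smul_comm, mul_one, one_mul, hp, smul_add, add_smul,
          sub_smul, mul_add, mul_comm n m]
        abel
      rw [h2, neg_eq_zero] at h1
      exact h1
    apply Int.eq_zero_of_golden
    by_contra hne
    exact NQuat.TetraSystem.zsmul_one_ne (sub_ne_zero.2 hne) h0
  intro z w h
  have h1 : eval p (z - w) = 0 := by rw [eval_sub, h, sub_self]
  obtain ⟨hr, hi⟩ := key _ _ h1
  rw [QuadraticAlgebra.re_sub, sub_eq_zero] at hr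
  rw [QuadraticAlgebra.im_sub, sub_eq_zero] at hi
  exact QuadraticAlgebra.ext hr hi

end Golden

namespace NQuat

section eval

variable {R : Type*} [Ring R] [Algebra ℚ R] {i j : R} {p : Subalgebra.centralizer ℚ {i, j}}

/-- Evaluation of a quaternion with golden coefficients. -/
def evalGolden (p : Subalgebra.centralizer ℚ {i, j}) (a : NQuat Golden) : R :=
  toRing i j ⟨Golden.eval p a.re, Golden.eval p a.i, Golden.eval p a.j, Golden.eval p a.k⟩

theorem evalGolden_add (v w : NQuat Golden) :
    evalGolden p (v + w) = evalGolden p v + evalGolden p w := by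
  obtain ⟨a, b, c, d⟩ := v
  obtain ⟨a', b', c', d'⟩ := w
  simp only [evalGolden, ← toRing_add, add_mk, Golden.eval_add]

theorem evalGolden_mul (hi : i * i = -1) (hj : j * j = -1) (hij : j * i = -(i * j))
    (hp : p * p = p + 1) (v w : NQuat Golden) :
    evalGolden p (v * w) = evalGolden p v * evalGolden p w := by
  obtain ⟨a, b, c, d⟩ := v
  obtain ⟨a', b', c', d'⟩ := w
  simp only [evalGolden, ← toRing_mul hi hj hij, mul_mk, Golden.eval_add, Golden.eval_sub,
    Golden.eval_mul hp]

theorem evalGolden_injective [Nontrivial R] (hi : i * i = -1) (hj : j * j = -1) (hij : j * i = -(i * j))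
    (hp : p * p = p + 1) : Function.Injective (evalGolden p) := by
  intro a b h
  have h1 := toRing_injective hi hj hij h
  rw [mk.injEq] at h1
  have inj := Golden.eval_injective hp
  exact NQuat.ext (inj h1.1) (inj h1.2.1) (inj h1.2.2.1) (inj h1.2.2.2)

end eval

section red

/-- Reduction of golden integers modulo a prime of norm five. -/
def goldenMod (z : Golden) : ZMod 5 := z.re + 3 * z.im

theorem goldenMod_add (z w : Golden) : goldenMod (z + w) = goldenMod z + goldenMod w := by
  simp only [goldenMod, QuadraticAlgebra.re_add, QuadraticAlgebra.im_add, Int.cast_add]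
  ring

theorem goldenMod_sub (z w : Golden) : goldenMod (z - w) = goldenMod z - goldenMod w := by
  simp only [goldenMod, QuadraticAlgebra.re_sub, QuadraticAlgebra.im_sub, Int.cast_sub]
  ring

theorem goldenMod_mul (z w : Golden) : goldenMod (z * w) = goldenMod z * goldenMod w := by
  simp only [goldenMod, QuadraticAlgebra.re_mul, QuadraticAlgebra.im_mul, Int.cast_add,
    Int.cast_mul, Int.cast_one]
  have h5 : (5 : ZMod 5) = 0 := by decide
  linear_combination (-(z.im * w.im : ZMod 5)) * h5

/-- Reduction of quaternions with golden coefficients to matrices modulo five. -/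
def red (a : NQuat Golden) : Matrix (Fin 2) (Fin 2) (ZMod 5) :=
  !![goldenMod a.re + 2 * goldenMod a.i, goldenMod a.j + 2 * goldenMod a.k;
     -goldenMod a.j + 2 * goldenMod a.k, goldenMod a.re + 3 * goldenMod a.i]

theorem red_add (v w : NQuat Golden) : red (v + w) = red v + red w := by
  obtain ⟨a, b, c, d⟩ := v
  obtain ⟨a', b', c', d'⟩ := w
  ext u v
  fin_cases u <;> fin_cases v <;> simp [red, add_mk, goldenMod_add] <;> ring

theorem red_mul (v w : NQuat Golden) : red (v * w) = red v * red w := by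
  obtain ⟨a, b, c, d⟩ := v
  obtain ⟨a', b', c', d'⟩ := w
  have h5 : (5 : ZMod 5) = 0 := by decide
  rw [red, red, red, Matrix.mul_fin_two]
  simp only [mul_mk, goldenMod_add, goldenMod_mul, goldenMod_sub]
  generalize goldenMod a = a, goldenMod b = b, goldenMod c = c, goldenMod d = d,
    goldenMod a' = a', goldenMod b' = b', goldenMod c' = c', goldenMod d' = d'
  congr 2
  · exact congrArg₂ (fun x y => ![x, y])
      (by linear_combination (-(b * b') - d * d') * h5)
      (by linear_combination (-(d * b') - b * d' - c * b') * h5)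
  · exact congrArg (fun x => ![x]) (congrArg₂ (fun x y => ![x, y])
      (by linear_combination (-(d * b') - b * d' + b * c') * h5)
      (by linear_combination (-2 * (b * b') - d * d' + c * d' - d * c') * h5))

end red

end NQuat

namespace NQuat

theorem icoList_one : (⟨⟨2, 0⟩, 0, 0, 0⟩ : NQuat Golden) ∈ icoList := by
  decide +kernel

theorem icoList_length : icoList.length = 120 := by
  decide +kernel

theorem icoList_three {w : NQuat Golden} (hw : IsTetra w ∨ IsIcosa ⟨0, 1⟩ w) :
    -1 + w ∈ icoList := by
  obtain ⟨a, b, c, d⟩ := w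
  rcases hw with ⟨h1, h2, h3, h4⟩ | ⟨h1, ⟨h2, h3, h4⟩ | ⟨h2, h3, h4⟩ | ⟨h2, h3, h4⟩⟩
  · dsimp only at h1 h2 h3 h4
    rcases h2 with rfl | rfl <;> rcases h3 with rfl | rfl <;> rcases h4 with rfl | rfl <;>
      subst h1 <;> decide +kernel
  all_goals
    dsimp only at h1 h2 h3 h4
    rcases h3 with rfl | rfl <;> rcases h4 with rfl | rfl <;> subst h1 h2 <;> decide +kernel

theorem icoList_red : ∀ a ∈ icoList, (3 • red a) 0 0 * (3 • red a) 1 1 -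
    (3 • red a) 0 1 * (3 • red a) 1 0 = 1 ∧ (3 • red a = 1 → a = ⟨⟨2, 0⟩, 0, 0, 0⟩) := by
  decide +kernel

end NQuat

section

open NQuat

namespace Golden

variable {C : Type*} [Ring C] (p : C)

@[simp] theorem eval_zero : eval p 0 = 0 := by
  change (0 : ℤ) • (1 : C) + (0 : ℤ) • p = 0
  simp

@[simp] theorem eval_one : eval p 1 = 1 := by
  change (1 : ℤ) • (1 : C) + (0 : ℤ) • p = 1
  simp

@[simp] theorem eval_two : eval p ⟨2, 0⟩ = 1 + 1 := by
  change (2 : ℤ) • (1 : C) + (0 : ℤ) • p = 1 + 1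
  rw [zero_smul, add_zero, two_smul]

@[simp] theorem eval_omega : eval p ⟨0, 1⟩ = p := by
  change (0 : ℤ) • (1 : C) + (1 : ℤ) • p = p
  simp

end Golden

/-- Elements of a group that are represented by generators of the binary icosahedral group,
together with the coordinates of all elements of order three. -/
structure IcosianFrame {H W : Type*} [Group H] [AddCommGroup W] [Module ℚ W]
    (ρ : H →* Module.End ℚ W) where
  s : H
  t : H
  x : H
  y : H
  p : Subalgebra.centralizer ℚ {ρ s, ρ t}
  hs : ρ s * ρ s = -1
  ht : ρ t * ρ t = -1
  hst : ρ t * ρ s = -(ρ s * ρ t)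
  hp : p * p = p + 1
  hx : orderOf x = 3
  hy : orderOf y = 3
  hxw : toRing (ρ s) (ρ t) ⟨0, 1, 1, 1⟩ = ρ x + ρ x + 1
  hyw : toRing (ρ s) (ρ t) ⟨0, 0, p, 1 - p⟩ = ρ y + ρ y + 1
  three : ∀ g, orderOf g = 3 →
    ∃ w, toRing (ρ s) (ρ t) w = ρ g + ρ g + 1 ∧ (IsTetra w ∨ IsIcosa p w)

namespace IcosianFrame

variable {H W : Type*} [Group H] [AddCommGroup W] [Module ℚ W] {ρ : H →* Module.End ℚ W}
  (E : IcosianFrame ρ)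

/-- The element `g` is represented by half of the quaternion `a`. -/
def Rep (g : H) (a : NQuat Golden) : Prop := ρ g + ρ g = evalGolden E.p a

/-- The subgroup generated by the frame. -/
def group : Subgroup H := Subgroup.closure {E.s, E.t, E.x, E.y}

variable {E}

theorem Rep.halfMul {g h : H} {a b : NQuat Golden} (hg : E.Rep g a) (hh : E.Rep h b)
    (hab : halfMul a b + halfMul a b = a * b) : E.Rep (g * h) (NQuat.halfMul a b) := by
  apply TetraSystem.zsmul_cancel two_ne_zero
  rw [two_smul, two_smul, ← evalGolden_add, hab, evalGolden_mul E.hs E.ht E.hst E.hp, ← hg, ← hh,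
    map_mul]
  noncomm_ring

theorem rep_one : E.Rep 1 ⟨⟨2, 0⟩, 0, 0, 0⟩ := by
  simp [Rep, evalGolden, toRing]

theorem rep_s : E.Rep E.s icoS := by
  simp [Rep, evalGolden, toRing, icoS, add_mul]

theorem rep_t : E.Rep E.t icoT := by
  simp [Rep, evalGolden, toRing, icoT, add_mul]

theorem evalGolden_neg_one_add (w : NQuat Golden) :
    evalGolden E.p (-1 + w) = -1 + evalGolden E.p w := by
  rw [evalGolden_add]
  congr 1
  simp [evalGolden, neg_mk, one_def, Golden.eval_neg, toRing]

theorem rep_of_three {g : H} {w : NQuat Golden} (h : evalGolden E.p w = ρ g + ρ g + 1) :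
    E.Rep g (-1 + w) := by
  rw [Rep, evalGolden_neg_one_add, h]
  abel

theorem rep_x : E.Rep E.x icoX := by
  have h : icoX = -1 + ⟨0, 1, 1, 1⟩ := by decide
  rw [h]
  apply rep_of_three
  rw [← E.hxw]
  simp [evalGolden]

theorem rep_y : E.Rep E.y icoY := by
  have h : icoY = -1 + ⟨0, 0, ⟨0, 1⟩, ⟨1, -1⟩⟩ := by decide
  rw [h]
  apply rep_of_three
  rw [← E.hyw]
  simp [evalGolden, Golden.eval, sub_eq_add_neg]

theorem Rep.mul_gen {g h : H} {a b : NQuat Golden} (hg : E.Rep g a)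
    (ha : a ∈ [icoS, icoT, icoX, icoY]) (hh : E.Rep h b) (hb : b ∈ icoList) :
    NQuat.halfMul a b ∈ icoList ∧ E.Rep (g * h) (NQuat.halfMul a b) :=
  ⟨(icoList_closed a ha b hb).1, hg.halfMul hh (icoList_closed a ha b hb).2⟩

theorem exists_rep [Finite H] {g : H} (hg : g ∈ E.group) : ∃ a ∈ icoList, E.Rep g a := by
  have step : ∀ u ∈ ({E.s, E.t, E.x, E.y} : Set H), ∀ h, (∃ a ∈ icoList, E.Rep h a) →
      ∃ a ∈ icoList, E.Rep (u * h) a := by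
    rintro u (rfl | rfl | rfl | rfl) h ⟨b, hb, hh⟩
    · exact ⟨_, rep_s.mul_gen (by simp) hh hb⟩
    · exact ⟨_, rep_t.mul_gen (by simp) hh hb⟩
    · exact ⟨_, rep_x.mul_gen (by simp) hh hb⟩
    · exact ⟨_, rep_y.mul_gen (by simp) hh hb⟩
  rw [group, ← Subgroup.mem_toSubmonoid, Subgroup.closure_toSubmonoid_of_finite] at hg
  induction hg using Submonoid.closure_induction_left with
  | one => exact ⟨_, icoList_one, rep_one⟩
  | mul_left u hu h _ ih => exact step u hu h ih

theorem exists_of_mem_icoList {a : NQuat Golden} (ha : a ∈ icoList) : ∃ g ∈ E.group, E.Rep g a := by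
  have mem {u : H} (hu : u ∈ ({E.s, E.t, E.x, E.y} : Set H)) : u ∈ E.group :=
    Subgroup.subset_closure hu
  let Q (a : NQuat Golden) : Prop := a ∈ icoList ∧ ∃ g ∈ E.group, E.Rep g a
  have hS : ∀ b, Q b → Q (NQuat.halfMul icoS b) := by
    rintro b ⟨hb, g, hg, h⟩
    have := rep_s.mul_gen (by simp) h hb
    exact ⟨this.1, _, mul_mem (mem (by simp)) hg, this.2⟩
  have hT : ∀ b, Q b → Q (NQuat.halfMul icoT b) := by
    rintro b ⟨hb, g, hg, h⟩
    have := rep_t.mul_gen (by simp) h hb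
    exact ⟨this.1, _, mul_mem (mem (by simp)) hg, this.2⟩
  have hX : ∀ b, Q b → Q (NQuat.halfMul icoX b) := by
    rintro b ⟨hb, g, hg, h⟩
    have := rep_x.mul_gen (by simp) h hb
    exact ⟨this.1, _, mul_mem (mem (by simp)) hg, this.2⟩
  have hY : ∀ b, Q b → Q (NQuat.halfMul icoY b) := by
    rintro b ⟨hb, g, hg, h⟩
    have := rep_y.mul_gen (by simp) h hb
    exact ⟨this.1, _, mul_mem (mem (by simp)) hg, this.2⟩
  simp only [icoList, List.mem_flatMap, List.mem_map] at ha
  obtain ⟨b, -, c, -, d, -, e, -, rfl⟩ := ha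
  have iter {f : NQuat Golden → NQuat Golden} (hf : ∀ b, Q b → Q (f b)) (n : ℕ) :
      ∀ b, Q b → Q (f^[n] b) := by
    induction n with
    | zero => exact fun b hb => hb
    | succ n ih => exact fun b hb => ih _ (hf b hb)
  have h1 : Q ⟨⟨2, 0⟩, 0, 0, 0⟩ := ⟨icoList_one, 1, one_mem _, rep_one⟩
  exact (iter hS b _ (iter hT c _ (iter hX d _ (iter (fun b hb => hT _ (hY b hb)) e _ h1)))).2

variable [Nontrivial W]

theorem Rep.left_unique {g : H} {a b : NQuat Golden} (ha : E.Rep g a) (hb : E.Rep g b) : a = b :=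
  evalGolden_injective E.hs E.ht E.hst E.hp (ha.symm.trans hb)

theorem Rep.right_unique (hρ : FixedPointFreeRep ρ) {g h : H} {a : NQuat Golden} (hg : E.Rep g a)
    (hh : E.Rep h a) : g = h := by
  apply hρ.injective
  apply TetraSystem.zsmul_cancel two_ne_zero
  rw [two_smul, two_smul, hg, hh]

theorem mem_group_of_orderOf_three (hρ : FixedPointFreeRep ρ) {g : H} (hg : orderOf g = 3) :
    g ∈ E.group := by
  obtain ⟨w, hw, hT⟩ := E.three g hg
  obtain ⟨v, hv, hvT⟩ : ∃ v : NQuat Golden, evalGolden E.p v = ρ g + ρ g + 1 ∧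
      (IsTetra v ∨ IsIcosa ⟨0, 1⟩ v) := by
    have k0 : ∃ z : Golden, z = 0 ∧ Golden.eval E.p z = 0 := ⟨0, rfl, by simp [Golden.eval_neg]⟩
    have k1 {c : Subalgebra.centralizer ℚ {ρ E.s, ρ E.t}} (h : c = 1 ∨ c = -1) :
        ∃ z : Golden, (z = 1 ∨ z = -1) ∧ Golden.eval E.p z = c := by
      rcases h with rfl | rfl
      · exact ⟨1, Or.inl rfl, by simp [Golden.eval_neg]⟩
      · exact ⟨-1, Or.inr rfl, by simp [Golden.eval_neg]⟩
    have kp {c : Subalgebra.centralizer ℚ {ρ E.s, ρ E.t}} (h : c = E.p ∨ c = -E.p) :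
        ∃ z : Golden, (z = ⟨0, 1⟩ ∨ z = -⟨0, 1⟩) ∧ Golden.eval E.p z = c := by
      rcases h with rfl | rfl
      · exact ⟨⟨0, 1⟩, Or.inl rfl, by simp [Golden.eval_neg]⟩
      · exact ⟨-⟨0, 1⟩, Or.inr rfl, by rw [Golden.eval_neg, Golden.eval_omega]⟩
    have kq {c : Subalgebra.centralizer ℚ {ρ E.s, ρ E.t}} (h : c = 1 - E.p ∨ c = -(1 - E.p)) :
        ∃ z : Golden, (z = 1 - ⟨0, 1⟩ ∨ z = -(1 - ⟨0, 1⟩)) ∧ Golden.eval E.p z = c := by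
      rcases h with rfl | rfl
      · exact ⟨1 - ⟨0, 1⟩, Or.inl rfl, by simp [Golden.eval_sub]⟩
      · exact ⟨-(1 - ⟨0, 1⟩), Or.inr rfl, by simp [Golden.eval_neg, Golden.eval_sub]⟩
    obtain ⟨a, b, c, d⟩ := w
    obtain ⟨z0, e0, e0'⟩ := k0
    rcases hT with ⟨h1, h2, h3, h4⟩ | ⟨h1, ⟨h2, h3, h4⟩ | ⟨h2, h3, h4⟩ | ⟨h2, h3, h4⟩⟩
    · obtain ⟨b', hb, rfl⟩ := k1 h2
      obtain ⟨c', hc, rfl⟩ := k1 h3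
      obtain ⟨d', hd, rfl⟩ := k1 h4
      obtain rfl : a = 0 := h1
      exact ⟨⟨z0, b', c', d'⟩, by rw [← hw, evalGolden, e0'], Or.inl ⟨e0, hb, hc, hd⟩⟩
    · obtain ⟨b', hb, rfl⟩ := kp h3
      obtain ⟨c', hc, rfl⟩ := kq h4
      obtain rfl : a = 0 := h1
      dsimp only at h2
      subst h2
      exact ⟨⟨z0, z0, b', c'⟩, by rw [← hw, evalGolden, e0'],
        Or.inr ⟨e0, Or.inl ⟨e0, hb, hc⟩⟩⟩
    · obtain ⟨b', hb, rfl⟩ := kp h3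
      obtain ⟨c', hc, rfl⟩ := kq h4
      obtain rfl : a = 0 := h1
      dsimp only at h2
      subst h2
      exact ⟨⟨z0, c', z0, b'⟩, by rw [← hw, evalGolden, e0'],
        Or.inr ⟨e0, Or.inr (Or.inl ⟨e0, hb, hc⟩)⟩⟩
    · obtain ⟨b', hb, rfl⟩ := kp h3
      obtain ⟨c', hc, rfl⟩ := kq h4
      obtain rfl : a = 0 := h1
      dsimp only at h2
      subst h2
      exact ⟨⟨z0, b', c', z0⟩, by rw [← hw, evalGolden, e0'],
        Or.inr ⟨e0, Or.inr (Or.inr ⟨e0, hb, hc⟩)⟩⟩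
  obtain ⟨h, hh, hr⟩ := E.exists_of_mem_icoList (icoList_three hvT)
  rw [(rep_of_three hv).right_unique hρ hr]
  exact hh

theorem nonempty_equiv [Finite H] (hρ : FixedPointFreeRep ρ) : Nonempty (E.group ≃* SL25) := by
  choose a haL ha using fun g : E.group => E.exists_rep g.2
  have hmul : ∀ g h, red (a g) * red (a h) = red (a (g * h)) + red (a (g * h)) := by
    intro g h
    rw [← red_mul, ← red_add]
    congr 1
    apply evalGolden_injective E.hs E.ht E.hst E.hp
    rw [evalGolden_add, evalGolden_mul E.hs E.ht E.hst E.hp, ← ha, ← ha, ← ha, Subgroup.coe_mul,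
      map_mul]
    noncomm_ring
  have hdet (g : E.group) : (3 • red (a g)).det = 1 := by
    rw [Matrix.det_fin_two]
    exact (icoList_red _ (haL g)).1
  let θ : E.group →* SL25 := MonoidHom.mk' (fun g => ⟨3 • red (a g), hdet g⟩) (by
    intro g h
    apply Subtype.ext
    change 3 • red (a (g * h)) = 3 • red (a g) * 3 • red (a h)
    rw [smul_mul_smul_comm, hmul, ← two_smul ℕ, smul_smul]
    generalize red (a (g * h)) = M
    ext u v
    simp only [Matrix.smul_apply]
    generalize M u v = z
    revert z
    decide)
  have hinj : Function.Injective θ := by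
    rw [injective_iff_map_eq_one]
    intro g hg
    have h1 := (icoList_red _ (haL g)).2 (congrArg Subtype.val hg)
    exact Subtype.ext ((h1 ▸ ha g : E.Rep _ _).right_unique hρ rep_one)
  have hcard : Nat.card SL25 ≤ Nat.card E.group := by
    choose f hf hf' using fun b : {b // b ∈ icoList} => E.exists_of_mem_icoList b.2
    have : Nat.card {b // b ∈ icoList} = 120 := by
      have h1 := List.toFinset_card_of_nodup icoList_nodup
      rw [icoList_length] at h1
      rw [← h1, Nat.card_eq_fintype_card]
      exact Fintype.card_of_subtype _ (by simp)
    rw [sl25_card, ← this]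
    refine Nat.card_le_card_of_injective (fun b => (⟨f b, hf b⟩ : E.group)) fun b c hbc => ?_
    have h : f b = f c := congrArg Subtype.val hbc
    exact Subtype.ext ((hf' b).left_unique (h ▸ hf' c))
  exact ⟨MulEquiv.ofBijective θ (hinj.bijective_of_nat_card_le hcard)⟩

end IcosianFrame

theorem Subgroup.closure_orderOf_normal (H : Type*) [Group H] (n : ℕ) :
    (Subgroup.closure {g : H | orderOf g = n}).Normal := by
  have h : Group.conjugatesOfSet {g : H | orderOf g = n} = {g : H | orderOf g = n} := by
    refine Set.Subset.antisymm ?_ Group.subset_conjugatesOfSet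
    intro g hg
    obtain ⟨a, ha, hag⟩ := Group.mem_conjugatesOfSet_iff.1 hg
    obtain ⟨c, rfl⟩ := isConj_iff.1 hag
    exact (FixedPointFreeRep.orderOf_conj c a).trans ha
  rw [← h]
  exact Subgroup.normalClosure_normal

namespace IcosianFrame

variable {H W : Type*} [Group H] [AddCommGroup W] [Module ℚ W] {ρ : H →* Module.End ℚ W}
  {E : IcosianFrame ρ} [Nontrivial W]

theorem x_mul_t (hρ : FixedPointFreeRep ρ) : E.x * E.t = E.s * E.x := by
  have h1 : NQuat.halfMul icoX icoT = NQuat.halfMul icoS icoX := by decide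
  have h2 := (rep_x (E := E)).halfMul rep_t (by decide)
  rw [h1] at h2
  exact h2.right_unique hρ (rep_s.halfMul rep_x (by decide))

theorem x_mul_s (hρ : FixedPointFreeRep ρ) : E.x * E.s = E.s * E.t * E.x := by
  have h1 : NQuat.halfMul icoX icoS = NQuat.halfMul (NQuat.halfMul icoS icoT) icoX := by decide
  have h2 := (rep_x (E := E)).halfMul rep_s (by decide)
  rw [h1] at h2
  exact h2.right_unique hρ ((rep_s.halfMul rep_t (by decide)).halfMul rep_x (by decide))

theorem group_eq_closure (hρ : FixedPointFreeRep ρ) :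
    E.group = Subgroup.closure {g : H | orderOf g = 3} := by
  refine le_antisymm ?_ ((Subgroup.closure_le _).2 fun g hg => mem_group_of_orderOf_three hρ hg)
  set L := Subgroup.closure {g : H | orderOf g = 3} with hL
  have hN : L.Normal := Subgroup.closure_orderOf_normal H 3
  have hx : E.x ∈ L := Subgroup.subset_closure E.hx
  have hy : E.y ∈ L := Subgroup.subset_closure E.hy
  have h1 : E.t * E.s⁻¹ ∈ L := by
    have h := mul_mem (hN.conj_mem _ hx E.t) (inv_mem hx)
    have e : E.t * E.x * E.t⁻¹ * E.x⁻¹ = E.t * E.s⁻¹ := by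
      have h2 : E.x * E.t⁻¹ = E.s⁻¹ * E.x := by
        rw [mul_inv_eq_iff_eq_mul, mul_assoc, x_mul_t hρ, inv_mul_cancel_left]
      rw [mul_assoc E.t, h2]; group
    rwa [e] at h
  have ht : E.t ∈ L := by
    have h := hN.conj_mem _ (hN.conj_mem _ h1 E.x) E.s⁻¹
    have e : E.s⁻¹ * (E.x * (E.t * E.s⁻¹) * E.x⁻¹) * E.s⁻¹⁻¹ = E.t⁻¹ := by
      have e1 : E.x * (E.t * E.s⁻¹) * E.x⁻¹ = (E.x * E.t) * (E.x * E.s)⁻¹ := by group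
      rw [e1, x_mul_t hρ, x_mul_s hρ]; group
    rw [e] at h
    exact inv_mem_iff.1 h
  have hs : E.s ∈ L := by
    have := mul_mem (inv_mem h1) ht
    simpa using this
  rw [group, Subgroup.closure_le]
  rintro _ (rfl | rfl | rfl | rfl) <;> assumption

theorem group_normal (hρ : FixedPointFreeRep ρ) : E.group.Normal := by
  rw [group_eq_closure hρ]
  exact Subgroup.closure_orderOf_normal H 3

end IcosianFrame

namespace FixedPointFreeRep

variable {H W : Type*} [Group H] [Finite H] [AddCommGroup W] [Module ℚ W] [FiniteDimensional ℚ W]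
  [Nontrivial W] {ρ : H →* Module.End ℚ W}

/-- A pair of noncommuting elements of order three gives quaternion coordinates for all elements
of order three, of tetrahedral or icosahedral type. -/
theorem tetra_or_icosianFrame (hρ : FixedPointFreeRep ρ) {x y : H}
    (hx : orderOf x = 3) (hy : orderOf y = 3) (hxy : x * y ≠ y * x) :
    (∃ s t : H, ρ s * ρ s = -1 ∧ ρ t * ρ t = -1 ∧ ρ t * ρ s = -(ρ s * ρ t) ∧
      ∀ w ∈ threeSet ρ s t, IsTetra w) ∨ Nonempty (IcosianFrame ρ) := by
  obtain ⟨s, t, hs, ht, hst, hxs⟩ := hρ.exists_frame hx hy hxy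
  have hT := hρ.tetraSystem hs ht hst hx hxs
  rcases hT.classification with h | ⟨p, hp, ⟨u, hu, huw⟩, h⟩
  · exact Or.inl ⟨s, t, hs, ht, hst, h⟩
  · refine Or.inr ⟨⟨s, t, x, u, p, hs, ht, hst, hp, hx, hu, ?_, huw, fun g hg => ?_⟩⟩
    · rw [hxs]; simp [toRing]
    · obtain ⟨w, hw⟩ := NQuat.toRing_surjective hs ht hst (ρ g + ρ g + 1)
      exact ⟨w, hw, h w ⟨g, hg, hw⟩⟩

end FixedPointFreeRep

end

/-- A group in which commuting elements of the same prime order generate the same subgroup and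
which has at most one involution. -/
structure RankOneGroup (X : Type*) [Group X] : Prop where
  mem_zpowers : ∀ a b : X, (orderOf a).Prime → orderOf b = orderOf a → a * b = b * a →
    b ∈ Subgroup.zpowers a
  involution_unique : ∀ a b : X, orderOf a = 2 → orderOf b = 2 → a = b

namespace FixedPointFreeRep

variable {H W : Type*} [Group H] [AddCommGroup W] [Module ℚ W] [FiniteDimensional ℚ W]
  {ρ : H →* Module.End ℚ W}

theorem sum_range_pow_eq_zero (hρ : FixedPointFreeRep ρ) {g : H} {n : ℕ} (hg : g ≠ 1)
    (hn : g ^ n = 1) : ∑ i ∈ Finset.range n, ρ (g ^ i) = 0 := by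
  have h := mul_geom_sum (ρ g) n
  rw [← map_pow, hn, map_one, sub_self] at h
  simp only [map_pow]
  exact (IsUnit.mul_right_eq_zero (hρ.isUnit_sub_one hg)).1 h

theorem rankOneGroup [Nontrivial W] (hρ : FixedPointFreeRep ρ) : RankOneGroup H := by
  refine ⟨fun a b hp hab hc => ?_, fun a b ha hb => hρ.eq_of_orderOf_two ha hb⟩
  by_contra hb
  set p := orderOf a with hpa
  have hap : a ^ p = 1 := pow_orderOf_eq_one a
  have hbp : b ^ p = 1 := hab ▸ pow_orderOf_eq_one b
  have hne (i : ℕ) : b * a ^ i ≠ 1 := fun h =>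
    hb (by rw [eq_inv_of_mul_eq_one_left h]; exact inv_mem (Subgroup.npow_mem_zpowers a i))
  have hcom : Commute b a := hc.symm
  have h1 : ∑ i ∈ Finset.range p, ∑ k ∈ Finset.range p, ρ ((b * a ^ i) ^ k) = 0 := by
    refine Finset.sum_eq_zero fun i _ => hρ.sum_range_pow_eq_zero (hne i) ?_
    rw [(hcom.pow_right i).mul_pow, hbp, ← pow_mul, mul_comm, pow_mul, hap, one_pow, one_mul]
  rw [Finset.sum_comm] at h1
  have h2 : ∀ k ∈ Finset.range p, k ≠ 0 → ∑ i ∈ Finset.range p, ρ ((b * a ^ i) ^ k) = 0 := by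
    intro k hk hk0
    have h3 : a ^ k ≠ 1 := fun h =>
      (Finset.mem_range.1 hk).not_ge (orderOf_le_of_pow_eq_one (Nat.pos_of_ne_zero hk0) h)
    have h4 : (a ^ k) ^ p = 1 := by rw [← pow_mul, mul_comm, pow_mul, hap, one_pow]
    have h5 := hρ.sum_range_pow_eq_zero h3 h4
    rw [← mul_zero (ρ (b ^ k)), ← h5, Finset.mul_sum]
    refine Finset.sum_congr rfl fun i _ => ?_
    rw [(hcom.pow_right i).mul_pow, map_mul, ← pow_mul, ← pow_mul, mul_comm i]
  rw [Finset.sum_eq_single_of_mem 0 (Finset.mem_range.2 hp.pos) h2] at h1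
  simp only [pow_zero, map_one, Finset.sum_const, Finset.card_range, nsmul_eq_mul, mul_one] at h1
  have := algebraRat.charZero (Module.End ℚ W)
  exact hp.ne_zero (Nat.cast_eq_zero.1 h1)

end FixedPointFreeRep

namespace RankOneGroup

variable {X : Type*} [Group X]

theorem of_injective {Y : Type*} [Group Y] (hX : RankOneGroup X) (f : Y →* X)
    (hf : Function.Injective f) : RankOneGroup Y := by
  refine ⟨fun a b hp hab hc => ?_, fun a b ha hb => hf (hX.involution_unique _ _ ?_ ?_)⟩
  · obtain ⟨k, hk⟩ := hX.mem_zpowers (f a) (f b) (by rwa [orderOf_injective f hf])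
      (by rw [orderOf_injective f hf, orderOf_injective f hf, hab])
      (by rw [← map_mul, hc, map_mul])
    exact ⟨k, hf (by rw [← hk]; exact map_zpow f a k)⟩
  · rw [orderOf_injective f hf, ha]
  · rw [orderOf_injective f hf, hb]

theorem subgroup (hX : RankOneGroup X) (N : Subgroup X) : RankOneGroup N :=
  hX.of_injective N.subtype N.subtype_injective

theorem zpowers_eq [Finite X] (hX : RankOneGroup X) {a b : X} (hp : (orderOf a).Prime)
    (hab : orderOf b = orderOf a) (hc : a * b = b * a) :
    Subgroup.zpowers b = Subgroup.zpowers a := by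
  apply Subgroup.eq_of_le_of_card_ge
  · rw [Subgroup.zpowers_le]
    exact hX.mem_zpowers a b hp hab hc
  · rw [Nat.card_zpowers, Nat.card_zpowers, hab]

/-- An involution is central. -/
theorem mul_comm_of_orderOf_two (hX : RankOneGroup X) {z : X} (hz : orderOf z = 2) (g : X) :
    g * z = z * g := by
  have h := hX.involution_unique (g * z * g⁻¹) z
    ((FixedPointFreeRep.orderOf_conj g z).trans hz) hz
  rwa [mul_inv_eq_iff_eq_mul] at h

theorem exists_orderOf_four [Finite X] (hX : RankOneGroup X) (h4 : 4 ∣ Nat.card X) :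
    ∃ g : X, orderOf g = 4 := by
  have := Fact.mk Nat.prime_two
  obtain ⟨V, hV⟩ := Sylow.exists_subgroup_card_pow_prime 2 (n := 2) (by simpa using h4)
  by_contra! hne
  obtain ⟨z, hz⟩ := exists_prime_orderOf_dvd_card' (G := V) 2 (by rw [hV]; norm_num)
  have hle : (V : Set X) ⊆ {1, (z : X)} := by
    intro g hg
    by_cases h1 : g = 1
    · exact Or.inl h1
    · right
      have h2 : orderOf g ∣ 2 ^ 2 := by
        rw [← hV, ← Subgroup.orderOf_mk g hg]
        exact orderOf_dvd_natCard _
      obtain ⟨k, hk, hgk⟩ := (Nat.dvd_prime_pow Nat.prime_two).1 h2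
      have hk1 : k = 1 := by
        have h5 : k ≠ 0 := by
          rintro rfl
          exact h1 (orderOf_eq_one_iff.1 hgk)
        have h6 : k ≠ 2 := by
          rintro rfl
          exact hne g hgk
        omega
      exact hX.involution_unique _ _ (by rw [hgk, hk1, pow_one]) (by rw [Subgroup.orderOf_coe, hz])
  have h1 := Set.ncard_le_ncard hle (Set.toFinite _)
  have h2 : (V : Set X).ncard = 4 := by
    rw [← Nat.card_coe_set_eq]
    exact hV
  have h3 := Set.ncard_insert_le (1 : X) {(z : X)}
  rw [Set.ncard_singleton] at h3
  omega

end RankOneGroup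

theorem Subgroup.mem_of_coprime_index {X : Type*} [Group X] [Finite X] (N : Subgroup X) [N.Normal]
    {g : X} (h : (orderOf g).Coprime N.index) : g ∈ N := by
  rw [← QuotientGroup.eq_one_iff (N := N) g, ← orderOf_eq_one_iff]
  refine Nat.eq_one_of_dvd_coprimes h ?_ ?_
  · exact orderOf_map_dvd (QuotientGroup.mk' N) g
  · rw [Subgroup.index]
    exact _root_.orderOf_dvd_natCard _

theorem orderCount_subgroup_eq {X : Type*} [Group X] (N : Subgroup X) {n : ℕ}
    (h : ∀ g : X, orderOf g = n → g ∈ N) : orderCount N n = orderCount X n := by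
  refine Nat.card_congr ⟨fun g => ⟨g.1, by rw [Subgroup.orderOf_coe, g.2]⟩,
    fun g => ⟨⟨g.1, h g.1 g.2⟩, by rw [Subgroup.orderOf_mk, g.2]⟩, fun _ => rfl, fun _ => rfl⟩

theorem orderCount_mul {X : Type*} [Group X] {m n : ℕ} (hmn : m.Coprime n)
    (hm : m ≠ 0) (hn : n ≠ 0)
    (h : ∀ a b : X, orderOf a = m → orderOf b = n → Commute a b) :
    orderCount X (m * n) = orderCount X m * orderCount X n := by
  obtain ⟨u, hu1, hu0⟩ := Nat.chineseRemainder hmn 1 0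
  obtain ⟨v, hv0, hv1⟩ := Nat.chineseRemainder hmn 0 1
  have huv : u + v ≡ 1 [MOD m * n] := by
    rw [← Nat.modEq_and_modEq_iff_modEq_mul hmn]
    exact ⟨hu1.add hv0, hu0.add hv1⟩
  have hnu : n ∣ u := Nat.modEq_zero_iff_dvd.1 hu0
  have hmv : m ∣ v := Nat.modEq_zero_iff_dvd.1 hv0
  have key (a b : X) (ha : orderOf a = m) (hb : orderOf b = n) :
      orderOf (a * b) = m * n ∧ (a * b) ^ u = a ∧ (a * b) ^ v = b := by
    have hc := h a b ha hb
    refine ⟨?_, ?_, ?_⟩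
    · rw [hc.orderOf_mul_eq_mul_orderOf_of_coprime (by rwa [ha, hb]), ha, hb]
    · rw [hc.mul_pow, orderOf_dvd_iff_pow_eq_one.1 (hb ▸ hnu : orderOf b ∣ u), mul_one]
      conv_rhs => rw [← pow_one a]
      exact pow_eq_pow_iff_modEq.2 (ha ▸ hu1)
    · rw [hc.mul_pow, orderOf_dvd_iff_pow_eq_one.1 (ha ▸ hmv : orderOf a ∣ v), one_mul]
      conv_rhs => rw [← pow_one b]
      exact pow_eq_pow_iff_modEq.2 (hb ▸ hv1)
  have key' (g : X) (hg : orderOf g = m * n) :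
      g ^ u * g ^ v = g ∧ orderOf (g ^ u) = m ∧ orderOf (g ^ v) = n := by
    have h1 : g ^ u * g ^ v = g := by
      rw [← pow_add]
      conv_rhs => rw [← pow_one g]
      exact pow_eq_pow_iff_modEq.2 (hg ▸ huv)
    have hum : orderOf (g ^ u) ∣ m := by
      rw [orderOf_dvd_iff_pow_eq_one, ← pow_mul, ← orderOf_dvd_iff_pow_eq_one, hg, mul_comm u]
      exact mul_dvd_mul_left m hnu
    have hvn : orderOf (g ^ v) ∣ n := by
      rw [orderOf_dvd_iff_pow_eq_one, ← pow_mul, ← orderOf_dvd_iff_pow_eq_one, hg]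
      exact mul_dvd_mul_right hmv n
    have h2 : orderOf (g ^ u) * orderOf (g ^ v) = m * n := by
      rw [← ((Commute.refl g).pow_pow u v).orderOf_mul_eq_mul_orderOf_of_coprime
        (hmn.coprime_dvd_left hum |>.coprime_dvd_right hvn), h1, hg]
    have h3 := Nat.le_of_dvd (Nat.pos_of_ne_zero hm) hum
    have h4 := Nat.le_of_dvd (Nat.pos_of_ne_zero hn) hvn
    refine ⟨h1, ?_, ?_⟩
    · by_contra h5
      have := Nat.mul_lt_mul_of_lt_of_le (lt_of_le_of_ne h3 h5) h4 (Nat.pos_of_ne_zero hn)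
      omega
    · by_contra h5
      have := Nat.mul_lt_mul_of_le_of_lt h3 (lt_of_le_of_ne h4 h5) (Nat.pos_of_ne_zero hm)
      omega
  rw [orderCount, orderCount, orderCount, ← Nat.card_prod]
  exact Nat.card_congr ⟨fun g => (⟨g.1 ^ u, (key' g.1 g.2).2.1⟩, ⟨g.1 ^ v, (key' g.1 g.2).2.2⟩),
    fun p => ⟨p.1.1 * p.2.1, (key _ _ p.1.2 p.2.2).1⟩,
    fun g => Subtype.ext (key' g.1 g.2).1,
    fun p => Prod.ext (Subtype.ext (key _ _ p.1.2 p.2.2).2.1)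
      (Subtype.ext (key _ _ p.1.2 p.2.2).2.2)⟩

namespace SL25

/-- The upper unitriangular matrices. -/
def upper (x : ZMod 5) : SL25 := ⟨!![1, x; 0, 1], by simp⟩

/-- The lower unitriangular matrices. -/
def lower (x : ZMod 5) : SL25 := ⟨!![1, 0; x, 1], by simp⟩

theorem upper_add (x y : ZMod 5) : upper (x + y) = upper x * upper y := by
  apply Subtype.ext
  change !![1, x + y; 0, 1] = !![1, x; 0, 1] * !![1, y; 0, 1]
  rw [Matrix.mul_fin_two]
  simp [add_comm]

theorem lower_add (x y : ZMod 5) : lower (x + y) = lower x * lower y := by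
  apply Subtype.ext
  change !![1, 0; x + y, 1] = !![1, 0; x, 1] * !![1, 0; y, 1]
  rw [Matrix.mul_fin_two]
  simp

theorem mem_closure (g : SL25) : g ∈ Subgroup.closure {upper 1, lower 1} := by
  set L := Subgroup.closure {upper 1, lower 1}
  have hU (x : ZMod 5) : upper x ∈ L := by
    obtain ⟨n, rfl⟩ := ZMod.natCast_zmod_surjective x
    induction n with
    | zero =>
      have : upper ((0 : ℕ) : ZMod 5) = 1 := by
        rw [Nat.cast_zero]; apply Subtype.ext; exact Matrix.one_fin_two.symm
      rw [this]; exact one_mem _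
    | succ n ih =>
      rw [Nat.cast_succ, upper_add]
      exact mul_mem ih (Subgroup.subset_closure (by simp))
  have hV (x : ZMod 5) : lower x ∈ L := by
    obtain ⟨n, rfl⟩ := ZMod.natCast_zmod_surjective x
    induction n with
    | zero =>
      have : lower ((0 : ℕ) : ZMod 5) = 1 := by
        rw [Nat.cast_zero]; apply Subtype.ext; exact Matrix.one_fin_two.symm
      rw [this]; exact one_mem _
    | succ n ih =>
      rw [Nat.cast_succ, lower_add]
      exact mul_mem ih (Subgroup.subset_closure (by simp))
  have key (h : SL25) (hc : h.1 1 0 ≠ 0) : h ∈ L := by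
    have e : h = upper ((h.1 0 0 - 1) * h.1 1 0 ^ 3) * lower (h.1 1 0) *
        upper ((h.1 1 1 - 1) * h.1 1 0 ^ 3) := by
      have hd := h.2
      rw [Matrix.det_fin_two] at hd
      apply Subtype.ext
      change h.1 = !![1, _; 0, 1] * !![1, 0; _, 1] * !![1, _; 0, 1]
      rw [Matrix.eta_fin_two h.1]
      revert hd hc
      generalize h.1 0 0 = a
      generalize h.1 0 1 = b
      generalize h.1 1 0 = c
      generalize h.1 1 1 = d
      rw [Matrix.mul_fin_two, Matrix.mul_fin_two]
      intro hc hd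
      have : ∀ a b c d : ZMod 5, c ≠ 0 → a * d - b * c = 1 →
          a = (1 * 1 + (a - 1) * c ^ 3 * c) * 1 + (1 * 0 + (a - 1) * c ^ 3 * 1) * 0 ∧
          b = (1 * 1 + (a - 1) * c ^ 3 * c) * ((d - 1) * c ^ 3) +
            (1 * 0 + (a - 1) * c ^ 3 * 1) * 1 ∧
          c = (0 * 1 + 1 * c) * 1 + (0 * 0 + 1 * 1) * 0 ∧
          d = (0 * 1 + 1 * c) * ((d - 1) * c ^ 3) + (0 * 0 + 1 * 1) * 1 := by decide +kernel
      obtain ⟨h1, h2, h3, h4⟩ := this a b c d hc hd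
      simp only [Matrix.of_apply, Matrix.cons_val', Matrix.cons_val_zero, Matrix.cons_val_one,
        Matrix.cons_val_fin_one]
      rw [← h1, ← h2, ← h3, ← h4]
    rw [e]
    exact mul_mem (mul_mem (hU _) (hV _)) (hU _)
  by_cases hc : g.1 1 0 = 0
  · have h1 : lower 1 * g ∈ L := by
      apply key
      have h2 : (lower 1 * g).1 1 0 = g.1 0 0 + g.1 1 0 := by
        change ((!![1, 0; 1, 1] : Matrix (Fin 2) (Fin 2) (ZMod 5)) * g.1) 1 0 = _
        simp [Matrix.mul_apply, Fin.sum_univ_two]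
      rw [h2, hc, add_zero]
      intro h3
      have h4 := g.2
      rw [Matrix.det_fin_two, hc, h3, zero_mul, mul_zero, sub_zero] at h4
      exact absurd h4 (by decide)
    have := mul_mem (inv_mem (hV 1)) h1
    rwa [inv_mul_cancel_left] at this
  · exact key g hc

/-- The product of matrices in terms of their entries. -/
def quadMul (q r : ZMod 5 × ZMod 5 × ZMod 5 × ZMod 5) : ZMod 5 × ZMod 5 × ZMod 5 × ZMod 5 :=
  (q.1 * r.1 + q.2.1 * r.2.2.1, q.1 * r.2.1 + q.2.1 * r.2.2.2,
    q.2.2.1 * r.1 + q.2.2.2 * r.2.2.1, q.2.2.1 * r.2.1 + q.2.2.2 * r.2.2.2)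

theorem slQuadEquiv_mul (g h : SL25) :
    (slQuadEquiv (g * h)).1 = quadMul (slQuadEquiv g).1 (slQuadEquiv h).1 := by
  change ((g.1 * h.1) 0 0, (g.1 * h.1) 0 1, (g.1 * h.1) 1 0, (g.1 * h.1) 1 1) = _
  simp only [Matrix.mul_apply, Fin.sum_univ_two]
  rfl

/-- Matrices of order five in terms of their entries. -/
abbrev QuadFive : Type := {q : DetOneQuad // quadOrder q.1 = 5}

theorem card_pairs :
    Fintype.card {r : QuadFive × QuadFive // quadOrder (quadMul r.1.1.1 r.2.1.1) = 10} = 120 := by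
  decide +kernel

theorem card_mulAut_le : Nat.card (MulAut SL25) ≤ 120 := by
  rw [← card_pairs, ← Nat.card_eq_fintype_card]
  have h5 : ∀ φ : MulAut SL25, ∀ g : SL25, quadOrder (slQuadEquiv (φ g)).1 =
      quadOrder (slQuadEquiv g).1 := fun φ g => by
    rw [← sl25_orderOf, ← sl25_orderOf]
    exact orderOf_injective φ.toMonoidHom φ.injective g
  have hU : quadOrder (slQuadEquiv (upper 1)).1 = 5 := by decide +kernel
  have hV : quadOrder (slQuadEquiv (lower 1)).1 = 5 := by decide +kernel
  have hUV : quadOrder (quadMul (slQuadEquiv (upper 1)).1 (slQuadEquiv (lower 1)).1) = 10 := by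
    decide +kernel
  refine Nat.card_le_card_of_injective (fun φ : MulAut SL25 =>
    (⟨(⟨slQuadEquiv (φ (upper 1)), (h5 _ _).trans hU⟩,
      ⟨slQuadEquiv (φ (lower 1)), (h5 _ _).trans hV⟩), by
        rw [← slQuadEquiv_mul, ← map_mul, h5, slQuadEquiv_mul, hUV]⟩ :
      {r : QuadFive × QuadFive // quadOrder (quadMul r.1.1.1 r.2.1.1) = 10})) ?_
  intro φ ψ h
  have h1 : φ (upper 1) = ψ (upper 1) := slQuadEquiv.injective (by
    simpa using congrArg (fun r => r.1.1.1) h)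
  have h2 : φ (lower 1) = ψ (lower 1) := slQuadEquiv.injective (by
    simpa using congrArg (fun r => r.1.2.1) h)
  have hle : Subgroup.closure {upper 1, lower 1} ≤
      MonoidHom.eqLocus φ.toMonoidHom ψ.toMonoidHom := by
    rw [Subgroup.closure_le]
    rintro _ (rfl | rfl)
    · exact h1
    · exact h2
  exact MulEquiv.ext fun g => hle (mem_closure g)

end SL25

theorem orderCount_le_of_mem_zpowers {H : Type*} [Group H] [Finite H] (N : Subgroup H) {n : ℕ}
    (c : H) (h : ∀ g : N, orderOf g = n → (g : H) ∈ Subgroup.zpowers c) :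
    orderCount N n ≤ orderOf c := by
  rw [← Nat.card_zpowers, orderCount]
  exact Nat.card_le_card_of_injective
    (fun g : {g : N // orderOf g = n} => (⟨g.1, h g.1 g.2⟩ : Subgroup.zpowers c))
    fun a b hab => Subtype.ext (Subtype.ext (congrArg (fun u => u.1) hab :))

theorem card_le_card_centralizer_mul {H : Type*} [Group H] [Finite H] (x : H) :
    Nat.card H ≤ Nat.card (Subgroup.centralizer {x}) * orderCount H (orderOf x) := by
  rw [← Subgroup.card_mul_index (Subgroup.centralizer {x})]
  refine Nat.mul_le_mul_left _ ?_
  rw [Subgroup.index]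
  refine Nat.card_le_card_of_injective
    (Quotient.lift (fun g : H => (⟨g * x * g⁻¹, FixedPointFreeRep.orderOf_conj g x⟩ :
      {g : H // orderOf g = orderOf x})) ?_) ?_
  · intro a b hab
    have h := Subgroup.mem_centralizer_singleton_iff.1 (QuotientGroup.leftRel_apply.1 hab)
    apply Subtype.ext
    change a * x * a⁻¹ = b * x * b⁻¹
    have e : b = a * (a⁻¹ * b) := by group
    rw [e, mul_assoc a (a⁻¹ * b) x, h]; group
  · rintro ⟨a⟩ ⟨b⟩ hab
    have h : a * x * a⁻¹ = b * x * b⁻¹ := congrArg Subtype.val hab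
    apply Quotient.sound
    apply QuotientGroup.leftRel_apply.2
    rw [Subgroup.mem_centralizer_singleton_iff]
    have e : a⁻¹ * b * x = a⁻¹ * (b * x * b⁻¹) * b := by group
    rw [e, ← h]; group

namespace RankOneGroup

variable {H : Type*} [Group H] [Finite H] {N : Subgroup H}

/-- A group with a single involution and with a normal subgroup `SL(2,5)` of index two does not
have perfect order classes. -/
theorem false_of_card (hH : RankOneGroup H) (hP : PerfectOrderClasses H) [N.Normal]
    (e : N ≃* SL25) (hcard : Nat.card H = 240) : False := by
  have hNc : Nat.card N = 120 := by rw [Nat.card_congr e.toEquiv, sl25_card]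
  have hidx : N.index = 2 := by
    have := N.card_mul_index
    rw [hNc, hcard] at this
    omega
  obtain ⟨v1, v2, v3, v4, v5, v6, v10⟩ := sl25_orderCount_values
  rw [← orderCount_congr e] at v1 v2 v3 v4 v5 v6 v10
  have hmem (g : H) (hg : Odd (orderOf g)) : g ∈ N :=
    N.mem_of_coprime_index (by rw [hidx]; exact hg.coprime_two_right)
  have hord (g : H) (hg : g ∈ N) : orderOf g ∈ ({1, 2, 3, 4, 5, 6, 10} : Finset ℕ) := by
    have h := sl25_orderOf_mem (e ⟨g, hg⟩)
    rwa [MulEquiv.orderOf_eq, Subgroup.orderOf_mk] at h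
  have f3 : orderCount H 3 = 20 := by
    rw [← v3, orderCount_subgroup_eq]
    exact fun g hg => hmem g (by rw [hg]; decide)
  have f2 : orderCount H 2 = 1 := by
    obtain ⟨g, hg⟩ := exists_prime_orderOf_dvd_card' (G := H) 2 (by rw [hcard]; norm_num)
    have : Unique {g : H // orderOf g = 2} :=
      ⟨⟨⟨g, hg⟩⟩, fun x => Subtype.ext (hH.involution_unique _ _ x.2 hg)⟩
    exact Nat.card_unique
  have f6 : orderCount H 6 = 20 := by
    rw [show 6 = 2 * 3 from rfl, orderCount_mul (by norm_num) (by norm_num) (by norm_num), f2, f3]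
    exact fun a b ha _ => (hH.mul_comm_of_orderOf_two ha b).symm
  obtain ⟨x, hx⟩ : ∃ x : H, orderOf x = 3 := exists_of_orderCount_ne_zero (by rw [f3]; norm_num)
  have hxN : x ∈ N := hmem x (by rw [hx]; decide)
  set Z := Subgroup.centralizer {x} with hZ
  have hZ12 : 12 ≤ Nat.card Z := by
    have := card_le_card_centralizer_mul x
    rw [hcard, hx, f3, ← hZ] at this
    omega
  have hprod (y : H) (hy : y ∈ Z) (hco : (orderOf y).Coprime 3) :
      orderOf (y * x) = orderOf y * 3 := by
    rw [← hx]
    exact Commute.orderOf_mul_eq_mul_orderOf_of_coprime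
      (Subgroup.mem_centralizer_singleton_iff.1 hy) (by rwa [hx])
  have hZ5 : ¬ 5 ∣ Nat.card Z := by
    intro h5
    have := Fact.mk Nat.prime_five
    obtain ⟨y, hy⟩ := exists_prime_orderOf_dvd_card' (G := Z) 5 h5
    rw [← Subgroup.orderOf_coe] at hy
    have h1 := hprod y y.2 (by rw [hy]; norm_num)
    have h2 := hord _ (mul_mem (hmem y (by rw [hy]; decide)) hxN)
    rw [h1, hy] at h2
    exact absurd h2 (by decide)
  have hZ4 : 4 ∣ Nat.card Z := by
    have h1 : Nat.card Z ∣ 48 * 5 := by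
      have := Z.card_subgroup_dvd_card
      rwa [hcard] at this
    have h2 : Nat.card Z ∣ 48 := Nat.Coprime.dvd_of_dvd_mul_right
      ((Nat.Prime.coprime_iff_not_dvd Nat.prime_five).2 hZ5).symm h1
    generalize Nat.card Z = n at *
    have h3 := Nat.le_of_dvd (by norm_num) h2
    interval_cases n <;> omega
  obtain ⟨y, hy⟩ := (hH.subgroup Z).exists_orderOf_four hZ4
  rw [← Subgroup.orderOf_coe] at hy
  have hyN : (y : H) ∉ N := by
    intro h
    have h1 := hprod y y.2 (by rw [hy]; norm_num)
    have h2 := hord _ (mul_mem h hxN)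
    rw [h1, hy] at h2
    exact absurd h2 (by decide)
  have f4 : 30 < orderCount H 4 := by
    by_contra hle
    have h1 : Function.Bijective (fun g : {g : N // orderOf g = 4} =>
        (⟨g.1.1, by rw [Subgroup.orderOf_coe, g.2]⟩ : {g : H // orderOf g = 4})) := by
      apply Function.Injective.bijective_of_nat_card_le
      · exact fun _ _ hab => Subtype.ext (Subtype.ext (congrArg (fun u => u.1) hab))
      · change orderCount H 4 ≤ orderCount N 4
        omega
    obtain ⟨g, hg⟩ := h1.2 ⟨y, hy⟩
    have : (g.1 : H) = y := congrArg Subtype.val hg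
    exact hyN (this ▸ g.1.2)
  have f4d : orderCount H 4 ∣ 240 := by
    have := hP.dvd (y : H)
    rwa [hy, hcard] at this
  have hsum := card_pow_eq_one_eq_sum H (d := 240) (by norm_num)
  have hall : Nat.card {g : H // g ^ 240 = 1} = 240 := by
    rw [← hcard]
    exact Nat.card_congr (Equiv.subtypeUnivEquiv fun g => pow_card_eq_one')
  have hdiv : Nat.divisors 240 = {1, 2, 3, 4, 5, 6, 8, 10, 12, 15, 16, 20, 24, 30, 40, 48, 60, 80,
      120, 240} := by decide +kernel
  have hsplit : ∑ m ∈ Nat.divisors 240, orderCount H m = orderCount H 1 + orderCount H 2 +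
      orderCount H 3 + orderCount H 4 + orderCount H 6 +
      ∑ m ∈ ({5, 8, 10, 12, 15, 16, 20, 24, 30, 40, 48, 60, 80, 120, 240} : Finset ℕ),
        orderCount H m := by
    have : Nat.divisors 240 = ({1, 2, 3, 4, 6} : Finset ℕ) ∪
      {5, 8, 10, 12, 15, 16, 20, 24, 30, 40, 48, 60, 80, 120, 240} := by rw [hdiv]; decide
    rw [this, Finset.sum_union (by decide)]
    congr 1
    simp [add_assoc]
  have hrest : 4 ∣ ∑ m ∈ ({5, 8, 10, 12, 15, 16, 20, 24, 30, 40, 48, 60, 80, 120, 240} :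
      Finset ℕ), orderCount H m := by
    refine Finset.dvd_sum fun m hm => ?_
    have h1 : 0 < m ∧ 4 ∣ m.totient := by
      revert m
      decide +kernel
    exact h1.2.trans (totient_dvd_orderCount H m h1.1)
  rw [hall, hsplit, orderCount_one, f2, f3, f6] at hsum
  have h4 : orderCount H 4 % 4 = 2 := by omega
  have hlt := Nat.le_of_dvd (by norm_num) f4d
  have key : ∀ n ∈ Nat.divisors 240, 30 < n → n % 4 ≠ 2 := by rw [hdiv]; decide
  exact key _ (Nat.mem_divisors.2 ⟨f4d, by norm_num⟩) f4 h4

theorem nonempty_equiv_of_normal (hH : RankOneGroup H) (hP : PerfectOrderClasses H) [N.Normal]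
    (e : N ≃* SL25) : Nonempty (H ≃* SL25) := by
  have hNc : Nat.card N = 120 := by rw [Nat.card_congr e.toEquiv, sl25_card]
  obtain ⟨v1, v2, v3, v4, v5, v6, v10⟩ := sl25_orderCount_values
  rw [← orderCount_congr e] at v1 v2 v3 v4 v5 v6 v10
  set C := (MulAut.conjNormal (H := N)).ker with hC
  have hCN : ∀ c ∈ C, ∀ n ∈ N, c * n = n * c := by
    intro c hc n hn
    have h : MulAut.conjNormal c (⟨n, hn⟩ : N) = ⟨n, hn⟩ := by
      rw [MonoidHom.mem_ker.1 hc]; rfl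
    have h' : c * n * c⁻¹ = n := congrArg Subtype.val h
    rwa [mul_inv_eq_iff_eq_mul] at h'
  have hprime {p : ℕ} (hp : p.Prime) (hpN : p < orderCount N p) : ¬ p ∣ Nat.card C := by
    intro h
    have := Fact.mk hp
    obtain ⟨c, hc⟩ := exists_prime_orderOf_dvd_card' (G := C) p h
    rw [← Subgroup.orderOf_coe] at hc
    have := orderCount_le_of_mem_zpowers N (n := p) (c : H) fun g hg =>
      hH.mem_zpowers _ _ (by rwa [hc]) (by rw [hc, Subgroup.orderOf_coe, hg])
        (hCN c c.2 g g.2)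
    omega
  have h3 : ¬ 3 ∣ Nat.card C := hprime Nat.prime_three (by omega)
  have h5 : ¬ 5 ∣ Nat.card C := hprime Nat.prime_five (by omega)
  have h4 : ¬ 4 ∣ Nat.card C := by
    intro h
    obtain ⟨c, hc⟩ := (hH.subgroup C).exists_orderOf_four h
    rw [← Subgroup.orderOf_coe] at hc
    have hsq {g : H} (hg : orderOf g = 4) : orderOf (g ^ 2) = 2 := by
      rw [orderOf_pow' _ two_ne_zero, hg]; rfl
    have := orderCount_le_of_mem_zpowers N (n := 4) (c : H) fun g hg => by
      have hg' : orderOf (g : H) = 4 := by rw [Subgroup.orderOf_coe, hg]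
      have h1 : ((c : H) * g) ^ 2 = 1 := by
        have hcg : Commute (c : H) g := hCN c c.2 g g.2
        rw [hcg.mul_pow, hH.involution_unique _ _ (hsq hg') (hsq hc), ← pow_add, show 2 + 2 = 4 from rfl, ← hc]
        exact pow_orderOf_eq_one _
      have h2 : (c : H) * g ∈ Subgroup.zpowers (c : H) := by
        by_cases h3 : (c : H) * g = 1
        · rw [h3]; exact one_mem _
        · rw [hH.involution_unique _ _ (orderOf_eq_prime h1 h3) (hsq hc)]
          exact Subgroup.npow_mem_zpowers _ _
      have h3 := mul_mem (inv_mem (Subgroup.mem_zpowers (c : H))) h2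
      rwa [inv_mul_cancel_left] at h3
    omega
  obtain ⟨z, hz⟩ : ∃ z : N, orderOf z = 2 := exists_of_orderCount_ne_zero (by omega)
  rw [← Subgroup.orderOf_coe] at hz
  have hzC : (z : H) ∈ C := by
    rw [hC, MonoidHom.mem_ker]
    refine MulEquiv.ext fun n => Subtype.ext ?_
    change (z : H) * n * (z : H)⁻¹ = n
    rw [mul_inv_eq_iff_eq_mul, hH.mul_comm_of_orderOf_two hz]
  have h2 : 2 ∣ Nat.card C := by
    rw [← hz, ← Subgroup.orderOf_mk _ hzC]
    exact orderOf_dvd_natCard _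
  obtain ⟨m, hm⟩ := h2
  have hm30 : m.Coprime 30 := by
    have a2 : ¬ 2 ∣ m := fun h => h4 (by rw [hm]; exact mul_dvd_mul_left 2 h)
    have a3 : ¬ 3 ∣ m := fun h => h3 (by rw [hm]; exact h.mul_left 2)
    have a5 : ¬ 5 ∣ m := fun h => h5 (by rw [hm]; exact h.mul_left 2)
    rw [show 30 = 2 * 3 * 5 from rfl]
    refine Nat.Coprime.mul_right (Nat.Coprime.mul_right ?_ ?_) ?_
    · exact ((Nat.Prime.coprime_iff_not_dvd Nat.prime_two).2 a2).symm
    · exact ((Nat.Prime.coprime_iff_not_dvd Nat.prime_three).2 a3).symm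
    · exact ((Nat.Prime.coprime_iff_not_dvd Nat.prime_five).2 a5).symm
  have hle : C.index ≤ 120 := by
    have h1 : Nat.card (MulAut N) ≤ 120 := by
      rw [Nat.card_congr (MulAut.congr e).toEquiv]
      exact SL25.card_mulAut_le
    rw [hC, Subgroup.index_ker]
    exact (Nat.card_le_card_of_injective _ (Subgroup.subtype_injective _)).trans h1
  have h60 : 60 ∣ C.index := by
    refine dvd_trans ?_ (Subgroup.relIndex_dvd_index_of_normal C N)
    have h1 : Nat.card (C.subgroupOf N) ∣ 2 := by
      have a1 : Nat.card (C.subgroupOf N) ∣ 2 * 60 := by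
        have := (C.subgroupOf N).card_subgroup_dvd_card
        rwa [hNc] at this
      have a2 : Nat.card (C.subgroupOf N) ∣ 2 * m := by
        rw [← hm]
        refine Subgroup.card_dvd_of_injective
          (MonoidHom.mk' (fun g : C.subgroupOf N => (⟨g.1.1, g.2⟩ : C)) fun _ _ => rfl) ?_
        exact fun a b hab => Subtype.ext (Subtype.ext (congrArg (fun u => u.1) hab :))
      have a3 := Nat.dvd_gcd a1 a2
      rwa [Nat.gcd_mul_left, show 60 = 30 * 2 from rfl,
        Nat.Coprime.gcd_mul_left_cancel _ hm30.symm, Nat.Coprime.gcd_eq_one, mul_one] at a3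
      exact ((hm30.coprime_dvd_right (by norm_num : 2 ∣ 30)).symm)
    have h2 := (C.subgroupOf N).card_mul_index
    rw [hNc] at h2
    rw [Subgroup.relIndex]
    rcases (Nat.dvd_prime Nat.prime_two).1 h1 with h | h <;> rw [h] at h2 <;> omega
  have hidx : C.index = 60 ∨ C.index = 120 := by
    have := C.index_ne_zero_of_finite
    omega
  have hcard := C.card_mul_index
  obtain ⟨f, hf, hfe⟩ : ∃ f, C.index = 60 * f ∧ f ∣ 2 := by
    rcases hidx with h | h
    · exact ⟨1, h, by norm_num⟩
    · exact ⟨2, h, by norm_num⟩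
  rw [hm, hf] at hcard
  have hm1 : m = 1 := by
    by_contra hm1
    set q := m.minFac with hq
    have hqp : q.Prime := Nat.minFac_prime hm1
    have := Fact.mk hqp
    have hqm : q ∣ m := Nat.minFac_dvd m
    have hq30 : q.Coprime 30 := hm30.coprime_dvd_left hqm
    have hqC : ∀ g : H, orderOf g = q → g ∈ C := fun g hg => by
      refine C.mem_of_coprime_index ?_
      rw [hg]
      refine Nat.Coprime.coprime_dvd_right (?_ : C.index ∣ 30 * (2 * 2)) ?_
      · rw [hf, show 30 * (2 * 2) = 60 * 2 from rfl]
        exact mul_dvd_mul_left _ hfe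
      · have : q.Coprime 2 := hq30.coprime_dvd_right (by norm_num)
        exact hq30.mul_right (this.mul_right this)
    have hidxN : N.index * 2 = 2 * f * m := by
      have := N.card_mul_index
      rw [hNc, ← hcard] at this
      linarith
    have hcop (p : ℕ) (hp : p.Prime) (hp2 : p ≠ 2) (hp30 : p ∣ 30) : p.Coprime N.index := by
      refine Nat.Coprime.coprime_dvd_right (Dvd.intro _ hidxN) ?_
      have a2 : p.Coprime 2 := (Nat.coprime_primes hp Nat.prime_two).2 hp2
      exact (a2.mul_right (a2.coprime_dvd_right hfe)).mul_right
        ((hm30.coprime_dvd_right hp30).symm)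
    have hN (p : ℕ) (hp : p.Prime) (hp2 : p ≠ 2) (hp30 : p ∣ 30) :
        orderCount N p * orderCount H q ∣ Nat.card H := by
      have hmem : ∀ g : H, orderOf g = p → g ∈ N := fun g hg =>
        N.mem_of_coprime_index (by rw [hg]; exact hcop p hp hp2 hp30)
      rw [orderCount_subgroup_eq N hmem, ← orderCount_mul
        (hq30.coprime_dvd_right hp30).symm hp.ne_zero hqp.ne_zero
        fun a b ha hb => (hCN b (hqC b hb) a (hmem a ha)).symm]
      have hne : orderCount H (p * q) ≠ 0 := by
        rw [orderCount_mul (hq30.coprime_dvd_right hp30).symm hp.ne_zero hqp.ne_zero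
          fun a b ha hb => (hCN b (hqC b hb) a (hmem a ha)).symm]
        have := Fact.mk hp
        obtain ⟨a, ha⟩ := exists_prime_orderOf_dvd_card' (G := H) p (by
          rw [← hcard, show 2 * m * (60 * f) = 30 * (4 * m * f) by ring]
          exact hp30.mul_right _)
        obtain ⟨b, hb⟩ := exists_prime_orderOf_dvd_card' (G := H) q (by
          rw [← hcard, show 2 * m * (60 * f) = m * (120 * f) by ring]
          exact hqm.mul_right _)
        exact mul_ne_zero (orderCount_pos a ha).ne' (orderCount_pos b hb).ne'
      exact (hP _ (Nat.mul_pos hp.pos hqp.pos)).resolve_left hne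
    have d3 := hN 3 Nat.prime_three (by norm_num) (by norm_num)
    have d5 := hN 5 Nat.prime_five (by norm_num) (by norm_num)
    rw [v3, ← hcard, show 2 * m * (60 * f) = 20 * (6 * (f * m)) by ring] at d3
    rw [v5, ← hcard, show 2 * m * (60 * f) = 24 * (5 * (f * m)) by ring] at d5
    have e3 := Nat.dvd_of_mul_dvd_mul_left (by norm_num) d3
    have e5 := Nat.dvd_of_mul_dvd_mul_left (by norm_num) d5
    have e1 : orderCount H q ∣ f * m := by
      have := Nat.dvd_gcd e3 e5
      rwa [Nat.gcd_mul_right, show Nat.gcd 6 5 = 1 from rfl, one_mul] at this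
    have t := totient_dvd_orderCount H q hqp.pos
    rw [Nat.totient_prime hqp] at t
    have hqm1 : (q - 1).Coprime m := by
      by_contra hnc
      obtain ⟨r, hr, hr1, hr2⟩ := Nat.Prime.not_coprime_iff_dvd.1 hnc
      have a1 := Nat.minFac_le_of_dvd hr.two_le hr2
      have a2 := Nat.le_of_dvd (by have := hqp.two_le; omega) hr1
      have := hqp.two_le
      omega
    have hq2 : q - 1 ∣ 2 := (hqm1.dvd_of_dvd_mul_right (t.trans e1)).trans hfe
    have hq3 := Nat.le_of_dvd (by norm_num) hq2
    have hq2' := hqp.two_le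
    have : q = 2 ∨ q = 3 := by omega
    rcases this with h | h <;> rw [h] at hq30 <;> exact absurd hq30 (by norm_num)
  rw [hm1] at hcard
  rcases (Nat.dvd_prime Nat.prime_two).1 hfe with rfl | rfl
  · have htop : N = ⊤ := Subgroup.eq_top_of_card_eq N (by rw [hNc, ← hcard])
    subst htop
    exact ⟨Subgroup.topEquiv.symm.trans e⟩
  · exact (hH.false_of_card hP e hcard.symm).elim

end RankOneGroup

theorem zpow_mul_pow_of_conj {X : Type*} [Group X] {c s : X} {k : ℕ} (h : s * c * s⁻¹ = c ^ k)
    (r : ℤ) (m : ℕ) :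
    (c ^ r * s) ^ m = c ^ (r * ∑ i ∈ Finset.range m, (k : ℤ) ^ i) * s ^ m := by
  have hz (j : ℤ) : s * c ^ j = c ^ ((k : ℤ) * j) * s := by
    rw [← mul_inv_eq_iff_eq_mul, ← conj_zpow, h, ← zpow_natCast, ← zpow_mul]
  induction m with
  | zero => simp
  | succ m ih =>
    have hs : r * ∑ i ∈ Finset.range (m + 1), (k : ℤ) ^ i =
        r + k * (r * ∑ i ∈ Finset.range m, (k : ℤ) ^ i) := by
      rw [Finset.sum_range_succ', Finset.mul_sum, Finset.mul_sum, mul_add,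
        Finset.mul_sum, pow_zero, mul_one, add_comm]
      congr 1
      exact Finset.sum_congr rfl fun i _ => by ring
    rw [pow_succ', ih, hs, zpow_add, mul_assoc, ← mul_assoc s, hz, pow_succ' s]
    group

namespace RankOneGroup

variable {X : Type*} [Group X] [Finite X]

theorem isCyclic_of_conj (hX : RankOneGroup X) {p n k : ℕ} (hp : p.Prime) {c s : X}
    (hc : orderOf c = p ^ (n + 1)) (hM : (Subgroup.zpowers c).index = p)
    (hs : s ∉ Subgroup.zpowers c) (hsp : s ^ p ∈ Subgroup.zpowers c)
    (hk : s * c * s⁻¹ = c ^ k) (hk1 : k ≡ 1 [MOD p]) {u : ℤ}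
    (hu : IsCoprime u p) (hsum : ∑ i ∈ Finset.range p, (k : ℤ) ^ i = p * u) : IsCyclic X := by
  obtain ⟨j, hj⟩ := hsp
  change c ^ j = s ^ p at hj
  have hcard : Nat.card X = p ^ (n + 1) * p := by
    rw [← (Subgroup.zpowers c).card_mul_index, hM, Nat.card_zpowers, hc]
  by_cases hpj : (p : ℤ) ∣ j
  · exfalso
    obtain ⟨l, rfl⟩ := hpj
    obtain ⟨a, b, hab⟩ := hu.pow_right (n := n + 1)
    have hcz : c ^ ((p : ℤ) ^ (n + 1)) = 1 := by
      rw [← Nat.cast_pow, zpow_natCast, ← hc, pow_orderOf_eq_one]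
    set y := c ^ (-l * a) * s with hy
    have hyp : y ^ p = 1 := by
      rw [hy, zpow_mul_pow_of_conj hk, hsum, ← hj, ← zpow_add]
      have : -l * a * (p * u) + p * l = (p : ℤ) ^ (n + 1) * (p * l * b) := by
        linear_combination (-l * p) * hab
      rw [this, zpow_mul, hcz, one_zpow]
    have hyM : y ∉ Subgroup.zpowers c := fun h =>
      hs ((Subgroup.mul_mem_cancel_left _ (Subgroup.zpow_mem_zpowers c _)).1 h)
    have hyo : orderOf y = p := by
      have := Fact.mk hp
      exact orderOf_eq_prime hyp fun h => hyM (h ▸ one_mem _)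
    have hco : orderOf (c ^ p ^ n) = p := by
      rw [orderOf_pow' _ (pow_ne_zero _ hp.ne_zero), hc, pow_succ,
        Nat.gcd_eq_right (Dvd.intro _ rfl), Nat.mul_div_cancel_left _ (pow_pos hp.pos n)]
    have hcs : s * c ^ p ^ n * s⁻¹ = c ^ p ^ n := by
      rw [← conj_pow, hk, ← pow_mul, mul_comm, pow_mul]
      conv_rhs => rw [← pow_one (c ^ p ^ n)]
      rw [pow_eq_pow_iff_modEq, hco]
      exact hk1
    have hcom : c ^ p ^ n * y = y * c ^ p ^ n := by
      have h1 : Commute (c ^ p ^ n) (c ^ (-l * a)) :=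
        ((Commute.refl c).pow_left _).zpow_right _
      have h2 : Commute (c ^ p ^ n) s := (mul_inv_eq_iff_eq_mul.1 hcs).symm
      exact h1.mul_right h2
    obtain ⟨i, hi⟩ := hX.mem_zpowers (c ^ p ^ n) y (hco.symm ▸ hp) (hyo.trans hco.symm) hcom
    exact hyM (hi ▸ zpow_mem (Subgroup.npow_mem_zpowers c _) i)
  · have hle : Subgroup.zpowers c ≤ Subgroup.zpowers s := by
      rw [Subgroup.zpowers_le]
      obtain ⟨a, b, hab⟩ := ((Nat.prime_iff_prime_int.1 hp).coprime_iff_not_dvd.2 hpj).symm.pow_right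
        (n := n + 1)
      have : c = (s ^ p) ^ a := by
        rw [← hj, ← zpow_mul]
        have hcz : c ^ ((p : ℤ) ^ (n + 1)) = 1 := by
          rw [← Nat.cast_pow, zpow_natCast, ← hc, pow_orderOf_eq_one]
        have h2 : c ^ (a * j + b * (p : ℤ) ^ (n + 1)) = c := by rw [hab, zpow_one]
        rw [zpow_add, mul_comm b, zpow_mul c _ b, hcz, one_zpow, mul_one, mul_comm a] at h2
        exact h2.symm
      rw [this]
      exact zpow_mem (Subgroup.npow_mem_zpowers s p) a
    apply isCyclic_of_orderOf_eq_card s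
    have h1 := Subgroup.card_dvd_of_le hle
    rw [Nat.card_zpowers, Nat.card_zpowers, hc] at h1
    obtain ⟨t, ht⟩ := h1
    have h2 := orderOf_dvd_natCard s
    rw [hcard, ht] at h2
    rcases (Nat.dvd_prime hp).1 (Nat.dvd_of_mul_dvd_mul_left (pow_pos hp.pos _) h2) with h | h
    · exfalso
      rw [h, mul_one] at ht
      have := Subgroup.eq_of_le_of_card_ge hle (by
        rw [Nat.card_zpowers, Nat.card_zpowers, hc, ht])
      exact hs (this ▸ Subgroup.mem_zpowers s)
    · rw [ht, h, hcard]

theorem isCyclic_of_isCyclic_subgroup (hX : RankOneGroup X) {p n : ℕ} (hp : p.Prime)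
    {M : Subgroup X} [M.Normal] [IsCyclic M] (hM : Nat.card M = p ^ (n + 1)) (hMi : M.index = p)
    (hk : ∀ (c s : X) (k : ℕ), M = Subgroup.zpowers c → s * c * s⁻¹ = c ^ k → s ∉ M →
      s ^ p ∈ M → k ≡ 1 [MOD p] ∧ ∃ u : ℤ, IsCoprime u p ∧
        ∑ i ∈ Finset.range p, (k : ℤ) ^ i = p * u) : IsCyclic X := by
  obtain ⟨c, rfl⟩ := (Subgroup.isCyclic_iff_exists_zpowers_eq_top M).1 inferInstance
  obtain ⟨s, hs⟩ : ∃ s, s ∉ Subgroup.zpowers c := by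
    by_contra! h
    rw [(Subgroup.eq_top_iff' _).2 h, Subgroup.index_top] at hMi
    exact hp.one_lt.ne hMi
  have hsp : s ^ p ∈ Subgroup.zpowers c := by
    have := Subgroup.pow_index_mem (Subgroup.zpowers c) s
    rwa [hMi] at this
  obtain ⟨k, hkk⟩ := Submonoid.mem_powers_iff _ _ |>.1 <| mem_powers_iff_mem_zpowers.2 <|
    Subgroup.Normal.conj_mem ‹_› c (Subgroup.mem_zpowers c) s
  obtain ⟨h1, u, hu, hsum⟩ := hk c s k rfl hkk.symm hs hsp
  exact hX.isCyclic_of_conj hp (by rwa [Nat.card_zpowers] at hM) hMi hs hsp hkk.symm h1 hu hsum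

theorem isCyclic_of_odd_prime {p : ℕ} (hp : p.Prime) (hodd : Odd p) (N : ℕ) :
    ∀ {X : Type*} [Group X] [Finite X] (_ : RankOneGroup X) (_ : Nat.card X = p ^ N),
      IsCyclic X := by
  have := Fact.mk hp
  induction N with
  | zero =>
    intro X _ _ _ h
    have := (Nat.card_eq_one_iff_unique.1 (h.trans (pow_zero p))).1
    infer_instance
  | succ N ih =>
    intro X _ _ hX h
    obtain _ | n := N
    · exact isCyclic_of_prime_card (p := p) (h.trans (by simp))
    obtain ⟨M, hM⟩ := Sylow.exists_subgroup_card_pow_prime (G := X) p (n := n + 1)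
      (h ▸ pow_dvd_pow p (by omega))
    have hMi : M.index = p := by
      have := M.card_mul_index
      rw [hM, h, pow_succ p (n + 1)] at this
      exact Nat.eq_of_mul_eq_mul_left (pow_pos hp.pos _) this
    have := ih (hX.subgroup M) hM
    have hN : M.Normal := Subgroup.normal_of_index_eq_minFac_card (by
      rw [hMi, h, hp.pow_minFac (by omega)])
    refine hX.isCyclic_of_isCyclic_subgroup hp hM hMi fun c s k hMc hk hs hsp => ?_
    have hco : orderOf c = p ^ (n + 1) := by rw [← Nat.card_zpowers, ← hMc, hM]
    have hpow (m : ℕ) : s ^ m * c * (s ^ m)⁻¹ = c ^ k ^ m := by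
      induction m with
      | zero => simp
      | succ m ihm =>
        rw [pow_succ', pow_succ, pow_mul, ← ihm, conj_pow, ← hk, mul_inv_rev]
        group
    have h1 : c ^ k ^ p = c ^ 1 := by
      rw [← hpow, pow_one, mul_inv_eq_iff_eq_mul]
      obtain ⟨j, hj⟩ := hMc ▸ hsp
      rw [← hj]
      exact ((Commute.refl c).zpow_left j)
    rw [pow_eq_pow_iff_modEq, hco] at h1
    have h2 : k ≡ 1 [MOD p] := by
      have := (h1.of_dvd (dvd_pow_self p n.succ_ne_zero))
      rw [← ZMod.natCast_eq_natCast_iff] at this ⊢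
      rwa [Nat.cast_pow, ZMod.pow_card] at this
    refine ⟨h2, ?_⟩
    obtain ⟨q, hq⟩ := (Nat.modEq_iff_dvd.1 h2.symm)
    have h3 := odd_sq_dvd_geom_sum₂_sub (R := ℤ) (a := 1) q hodd
    simp only [one_pow, mul_one, ← hq] at h3
    obtain ⟨t, ht⟩ := h3
    refine ⟨1 + p * t, ⟨1, -t, by ring⟩, ?_⟩
    rw [Nat.cast_one, add_sub_cancel] at ht
    linear_combination ht

theorem isCyclic_of_central_four (N : ℕ) :
    ∀ {X : Type*} [Group X] [Finite X] (_ : RankOneGroup X) (_ : Nat.card X = 2 ^ N) {e : X}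
      (_ : orderOf e = 4) (_ : ∀ g, g * e = e * g), IsCyclic X := by
  have := Fact.mk Nat.prime_two
  induction N with
  | zero =>
    intro X _ _ _ h e he
    have := orderOf_dvd_natCard e
    rw [he, h] at this
    norm_num at this
  | succ N ih =>
    intro X _ _ hX h e he hcent
    have hd := orderOf_dvd_natCard e
    rw [he, h] at hd
    obtain _ | _ | n := N
    · norm_num at hd
    · exact isCyclic_of_orderOf_eq_card e (by rw [he, h]; norm_num)
    obtain ⟨M, hM, heM⟩ := Sylow.exists_subgroup_card_pow_prime_le (G := X) 2 (m := n + 2)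
      (n := 2) (h ▸ pow_dvd_pow 2 (by omega)) (Subgroup.zpowers e)
      (by rw [Nat.card_zpowers, he]; norm_num) (by omega)
    rw [Subgroup.zpowers_le] at heM
    have hMi : M.index = 2 := by
      have := M.card_mul_index
      rw [hM, h, pow_succ 2 (n + 2)] at this
      exact Nat.eq_of_mul_eq_mul_left (pow_pos two_pos _) this
    have := ih (hX.subgroup M) hM (e := ⟨e, heM⟩) (by rw [Subgroup.orderOf_mk, he])
      fun g => Subtype.ext (hcent g)
    have hN : M.Normal := Subgroup.normal_of_index_eq_two hMi
    refine hX.isCyclic_of_isCyclic_subgroup Nat.prime_two hM hMi fun c s k hMc hk hs hsp => ?_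
    obtain ⟨j, hj⟩ := hMc ▸ heM
    change c ^ j = e at hj
    have h1 : e ^ k = e ^ 1 := by
      rw [pow_one]
      conv_rhs => rw [← mul_inv_eq_iff_eq_mul.2 (hcent s)]
      rw [← hj, ← conj_zpow, hk, ← zpow_natCast, ← zpow_natCast, ← zpow_mul, ← zpow_mul, mul_comm]
    rw [pow_eq_pow_iff_modEq, he] at h1
    refine ⟨h1.of_dvd (by norm_num), ?_⟩
    obtain ⟨q, hq⟩ := (Nat.modEq_iff_dvd.1 h1.symm)
    push_cast at hq
    refine ⟨1 + 2 * q, ⟨1, -q, by push_cast; ring⟩, ?_⟩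
    simp only [Finset.sum_range_succ, Finset.sum_range_zero]
    push_cast
    linear_combination hq

end RankOneGroup

namespace RankOneGroup

variable {X : Type*} [Group X]

theorem sq_eq_of_orderOf_four (hX : RankOneGroup X) {z x : X} (hz : orderOf z = 2)
    (hx : orderOf x = 4) : x ^ 2 = z := by
  refine hX.involution_unique _ _ ?_ hz
  rw [orderOf_pow' _ two_ne_zero, hx]; rfl

theorem orderOf_four_of_sq {z x : X} (hz : orderOf z = 2) (hx : x ^ 2 = z) : orderOf x = 4 := by
  have := Fact.mk Nat.prime_two
  refine orderOf_eq_prime_pow (p := 2) (n := 1) ?_ ?_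
  · rw [pow_one, hx]
    intro h
    rw [h, orderOf_one] at hz
    exact absurd hz (by norm_num)
  · rw [show 2 ^ (1 + 1) = 2 * 2 by norm_num, pow_mul, hx, ← hz, pow_orderOf_eq_one]

theorem eq_one_or_eq_of_sq (hX : RankOneGroup X) {z x : X} (hz : orderOf z = 2)
    (hx : x ^ 2 = 1) : x = 1 ∨ x = z := by
  by_cases h : x = 1
  · exact Or.inl h
  · have := Fact.mk Nat.prime_two
    exact Or.inr (hX.involution_unique _ _ (orderOf_eq_prime hx h) hz)

theorem inv_eq_mul_of_sq {z x : X} (hz : orderOf z = 2) (hx : x ^ 2 = z) : x⁻¹ = z * x := by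
  have hzz : z * z = 1 := by rw [← pow_two, ← hz, pow_orderOf_eq_one]
  rw [inv_eq_iff_mul_eq_one]
  have : x * z = z * x := by rw [← hx]; exact (Commute.refl x).pow_right 2
  rw [← mul_assoc, this, mul_assoc, ← pow_two, hx, hzz]

theorem eq_or_eq_inv_of_commute (hX : RankOneGroup X) {z x y : X} (hz : orderOf z = 2)
    (hx : orderOf x = 4) (hy : orderOf y = 4) (h : x * y = y * x) : y = x ∨ y = x⁻¹ := by
  have hx2 := hX.sq_eq_of_orderOf_four hz hx
  have hy2 := hX.sq_eq_of_orderOf_four hz hy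
  have h1 : (y * x⁻¹) ^ 2 = 1 := by
    rw [(show Commute y x from h.symm).inv_right.mul_pow, inv_pow, hx2, hy2, mul_inv_cancel]
  rcases hX.eq_one_or_eq_of_sq hz h1 with h2 | h2
  · exact Or.inl (mul_inv_eq_one.1 h2)
  · exact Or.inr (by rw [inv_eq_mul_of_sq hz hx2, ← h2, inv_mul_cancel_right])

variable [Finite X]

theorem exists_four_conj (hX : RankOneGroup X) {N : ℕ} (hcard : Nat.card X = 2 ^ (N + 2)) :
    ∃ e : X, orderOf e = 4 ∧ ∀ g, g * e * g⁻¹ = e ∨ g * e * g⁻¹ = e⁻¹ := by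
  have := Fact.mk Nat.prime_two
  obtain ⟨z, hz⟩ := exists_prime_orderOf_dvd_card' (G := X) 2
    (hcard ▸ dvd_pow_self 2 (by omega))
  have hzc := hX.mul_comm_of_orderOf_two hz
  have hmem {x : X} (hx : x ∈ Subgroup.zpowers z) : x = 1 ∨ x = z := by
    apply hX.eq_one_or_eq_of_sq hz
    have := Subgroup.orderOf_dvd_natCard _ hx
    rw [Nat.card_zpowers, hz] at this
    exact orderOf_dvd_iff_pow_eq_one.1 this
  have hN : (Subgroup.zpowers z).Normal := by
    refine ⟨fun x hx g => ?_⟩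
    rcases hmem hx with rfl | rfl
    · simp
    · rwa [hzc, mul_inv_cancel_right]
  let Q := X ⧸ Subgroup.zpowers z
  have hQ : Nat.card Q = 2 ^ (N + 1) := by
    have h := (Subgroup.zpowers z).card_mul_index
    rw [Nat.card_zpowers, hz, hcard, pow_succ' 2 (N + 1)] at h
    exact Nat.eq_of_mul_eq_mul_left two_pos h
  have hnt : Nontrivial Q := Finite.one_lt_card_iff_nontrivial.1
    (by rw [hQ]; exact Nat.one_lt_two_pow (by omega))
  have hQp : IsPGroup 2 Q := IsPGroup.of_card hQ
  have := hQp.center_nontrivial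
  obtain ⟨m, hm0, hm⟩ := (hQp.to_subgroup (Subgroup.center Q)).nontrivial_iff_card.1 this
  obtain ⟨q, hq⟩ := exists_prime_orderOf_dvd_card' (G := Subgroup.center Q) 2
    (hm ▸ dvd_pow_self 2 hm0.ne')
  obtain ⟨e, he⟩ := QuotientGroup.mk_surjective q.1
  have hqo : orderOf (e : Q) = 2 := by rw [he, Subgroup.orderOf_coe, hq]
  have he2 : e ^ 2 ∈ Subgroup.zpowers z := by
    rw [← QuotientGroup.eq_one_iff, QuotientGroup.mk_pow, ← hqo, pow_orderOf_eq_one]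
  have hez : e ∉ Subgroup.zpowers z := by
    rw [← QuotientGroup.eq_one_iff]
    intro h
    rw [h, orderOf_one] at hqo
    exact absurd hqo (by norm_num)
  have he2z : e ^ 2 = z := by
    rcases hmem he2 with h | h
    · exfalso
      rcases hX.eq_one_or_eq_of_sq hz h with rfl | rfl
      · exact hez (one_mem _)
      · exact hez (Subgroup.mem_zpowers _)
    · exact h
  refine ⟨e, orderOf_four_of_sq hz he2z, fun g => ?_⟩
  have hc := Subgroup.mem_center_iff.1 q.2 g
  rw [← he, ← QuotientGroup.mk_mul, ← QuotientGroup.mk_mul, eq_comm, QuotientGroup.eq] at hc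
  rcases hmem hc with h | h
  · left
    rw [inv_mul_eq_one] at h
    rw [← h, mul_inv_cancel_right]
  · right
    rw [inv_mul_eq_iff_eq_mul] at h
    rw [h, inv_eq_mul_of_sq hz he2z, mul_assoc, ← hzc, ← mul_assoc, hzc, mul_inv_cancel_right]

/-- The shape of a noncyclic Sylow 2-subgroup `S` of a rank one group: a cyclic subgroup `⟨c⟩` of
index two is inverted by all elements of order four outside it. -/
structure TwoFrame (S : Subgroup X) (c e s : X) : Prop where
  orderOf_e : orderOf e = 4
  e_mem : e ∈ Subgroup.zpowers c
  c_mem : c ∈ S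
  s_mem : s ∈ S
  s_notMem : s ∉ Subgroup.zpowers c
  card_eq : Nat.card S = 2 * Nat.card (Subgroup.zpowers c)
  orderOf_eq : ∀ g ∈ S, g ∉ Subgroup.zpowers c → orderOf g = 4
  conj_eq : ∀ g ∈ S, g ∉ Subgroup.zpowers c → g * c * g⁻¹ = c⁻¹
  mul_mem : ∀ g ∈ S, g ∉ Subgroup.zpowers c → g * s⁻¹ ∈ Subgroup.zpowers c

theorem exists_twoFrame (hX : RankOneGroup X) (S : Subgroup X) {N : ℕ}
    (hcard : Nat.card S = 2 ^ N) (hcyc : ¬ IsCyclic S) : ∃ c e s, TwoFrame S c e s := by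
  have hp2 := Fact.mk Nat.prime_two
  obtain _ | _ | N := N
  · have := (Nat.card_eq_one_iff_unique.1 (hcard.trans (pow_zero 2))).1
    exact absurd isCyclic_of_subsingleton hcyc
  · exact absurd (isCyclic_of_prime_card (p := 2) (hcard.trans (by simp))) hcyc
  obtain ⟨z, hz⟩ := exists_prime_orderOf_dvd_card' (G := S) 2
    (hcard ▸ dvd_pow_self 2 (by omega))
  replace hz : orderOf (z : X) = 2 := (Subgroup.orderOf_coe z).trans hz
  have hzc := hX.mul_comm_of_orderOf_two hz
  obtain ⟨⟨e, heS⟩, he, hconj⟩ := (hX.subgroup S).exists_four_conj hcard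
  rw [Subgroup.orderOf_mk] at he
  replace hconj (g : X) (hg : g ∈ S) : g * e * g⁻¹ = e ∨ g * e * g⁻¹ = e⁻¹ :=
    (hconj ⟨g, hg⟩).imp (congrArg Subtype.val) (congrArg Subtype.val)
  have he2 := hX.sq_eq_of_orderOf_four hz he
  set A : Subgroup X := S ⊓ Subgroup.centralizer {e} with hA
  have hmemA {g : X} (hg : g ∈ S) : g ∈ A ↔ g * e = e * g := by
    rw [hA, Subgroup.mem_inf, Subgroup.mem_centralizer_singleton_iff, and_iff_right hg]
  have hAS : A ≤ S := inf_le_left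
  have heA : e ∈ A := (hmemA heS).2 rfl
  obtain ⟨M, -, hM⟩ := (Nat.dvd_prime_pow Nat.prime_two).1 (hcard ▸ Subgroup.card_dvd_of_le hAS)
  have hAc : IsCyclic A := isCyclic_of_central_four M (hX.subgroup A) hM (e := ⟨e, heA⟩)
    (by rw [Subgroup.orderOf_mk, he]) fun g => Subtype.ext ((hmemA (hAS g.2)).1 g.2)
  obtain ⟨s, hsS, hsA⟩ : ∃ s ∈ S, s ∉ A := by
    by_contra! h
    rw [le_antisymm hAS h] at hAc
    exact hcyc hAc
  have hinv {g : X} (hg : g ∈ S) (hgA : g ∉ A) : g * e * g⁻¹ = e⁻¹ :=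
    (hconj g hg).resolve_left fun h => hgA ((hmemA hg).2 (mul_inv_eq_iff_eq_mul.1 h))
  have hmul {g h : X} (hg : g ∈ S) (hgA : g ∉ A) (hh : h ∈ S) (hhA : h ∉ A) : g * h ∈ A := by
    rw [hmemA (mul_mem hg hh), ← mul_inv_eq_iff_eq_mul]
    calc g * h * e * (g * h)⁻¹ = g * (h * e * h⁻¹) * g⁻¹ := by group
      _ = (g * e * g⁻¹)⁻¹ := by rw [hinv hh hhA]; group
      _ = e := by rw [hinv hg hgA, inv_inv]
  have hsq {g : X} (hg : g ∈ S) (hgA : g ∉ A) : g ^ 2 = z := by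
    obtain ⟨m, -, hm⟩ := (Nat.dvd_prime_pow Nat.prime_two).1
      (hcard ▸ Subgroup.orderOf_dvd_natCard S hg)
    have hcomm : g * e ≠ e * g := fun h => hgA ((hmemA hg).2 h)
    obtain _ | _ | _ | m := m
    · rw [pow_zero, orderOf_eq_one_iff] at hm
      exact absurd (by simp [hm]) hcomm
    · rw [hX.involution_unique g z (by simpa using hm) hz] at hcomm
      exact absurd (hzc e).symm hcomm
    · exact hX.sq_eq_of_orderOf_four hz (by simpa using hm)
    · exfalso
      set f := g ^ 2 ^ (m + 1) with hf
      have hfo : orderOf f = 4 := by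
        rw [hf, orderOf_pow' _ (by positivity), hm, show m + 1 + 1 + 1 = m + 1 + 2 by ring,
          pow_add 2 (m + 1) 2, Nat.gcd_eq_right (Dvd.intro _ rfl),
          Nat.mul_div_cancel_left _ (by positivity)]
        norm_num
      have hfA : f ∈ A := by
        rw [hf, pow_succ' 2 m, pow_mul, pow_two]
        exact pow_mem (hmul hg hgA hg hgA) _
      have hfe := (hmemA (hAS hfA)).1 hfA
      have hgf : Commute g f := (Commute.refl g).pow_right _
      rcases hX.eq_or_eq_inv_of_commute hz hfo he hfe with h | h
      · exact hcomm (h ▸ hgf)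
      · exact hcomm (h ▸ hgf.inv_right)
  obtain ⟨c, hc⟩ := (Subgroup.isCyclic_iff_exists_zpowers_eq_top A).1 hAc
  have hcA : c ∈ A := hc ▸ Subgroup.mem_zpowers c
  have hsinv : s⁻¹ ∈ S := inv_mem hsS
  have hsinvA : s⁻¹ ∉ A := fun h => hsA (by simpa using inv_mem h)
  refine ⟨c, e, s, he, hc ▸ heA, hAS hcA, hsS, hc ▸ hsA, ?_, fun g hg hgA => ?_,
    fun g hg hgA => ?_, fun g hg hgA => ?_⟩
  · rw [hc, ← Subgroup.relIndex_bot_left S, ← Subgroup.relIndex_mul_relIndex ⊥ A S bot_le hAS,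
      Subgroup.relIndex_bot_left, mul_comm]
    congr 1
    rw [Subgroup.relIndex, Subgroup.index_eq_two_iff]
    refine ⟨⟨s, hsS⟩, fun b => ?_⟩
    rw [Subgroup.mem_subgroupOf, Subgroup.mem_subgroupOf]
    by_cases hb : (b : X) ∈ A
    · exact Or.inr ⟨hb, fun h => hsA ((Subgroup.mul_mem_cancel_left _ hb).1 h)⟩
    · exact Or.inl ⟨hmul b.2 hb hsS hsA, hb⟩
  · exact orderOf_four_of_sq hz (hsq hg (hc ▸ hgA))
  · rw [hc] at hgA
    have h1 := hsq (mul_mem (hAS hcA) hg) fun h => hgA ((Subgroup.mul_mem_cancel_left _ hcA).1 h)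
    rw [← hsq hg hgA, pow_two, pow_two, ← mul_assoc, mul_left_inj] at h1
    rw [mul_inv_eq_iff_eq_mul, eq_inv_mul_iff_mul_eq, ← mul_assoc, h1]
  · rw [hc] at hgA ⊢
    exact hmul hg hgA hsinv hsinvA

end RankOneGroup

theorem Sylow.exists_conj_mem_of_le {X : Type*} [Group X] [Finite X] {p : ℕ} [Fact p.Prime]
    (S : Sylow p X) {N : Subgroup X} (hS : (S : Subgroup X) ≤ N) {b : X} (hb : b ∈ N) {m : ℕ}
    (hbo : orderOf b = p ^ m) : ∃ n ∈ N, n * b * n⁻¹ ∈ (S : Subgroup X) := by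
  have hP : IsPGroup p (Subgroup.zpowers (⟨b, hb⟩ : N)) := by
    apply IsPGroup.of_card (n := m)
    rw [Nat.card_zpowers, Subgroup.orderOf_mk, hbo]
  obtain ⟨Q, hQ⟩ := hP.exists_le_sylow
  obtain ⟨n, hn⟩ := MulAction.exists_smul_eq N Q (S.subtype hS)
  refine ⟨n, n.2, ?_⟩
  have h1 : n * ⟨b, hb⟩ * n⁻¹ ∈ S.subtype hS := by
    rw [← hn]
    exact Subgroup.smul_mem_pointwise_smul (⟨b, hb⟩ : N) (MulAut.conj n) Q
      (hQ (Subgroup.mem_zpowers _))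
  exact h1

namespace RankOneGroup

variable {X : Type*} [Group X]

namespace TwoFrame

variable {S : Subgroup X} {c e s : X}

theorem conj_e (hT : TwoFrame S c e s) {g : X} (hg : g ∈ S) (hgc : g ∉ Subgroup.zpowers c) :
    g * e * g⁻¹ = e⁻¹ := by
  obtain ⟨j, hj⟩ := hT.e_mem
  change c ^ j = e at hj
  rw [← hj, ← conj_zpow, hT.conj_eq g hg hgc, inv_zpow]

theorem commute_of_mem (hT : TwoFrame S c e s) {g : X} (hgc : g ∈ Subgroup.zpowers c) :
    g * e = e * g := by
  obtain ⟨j, rfl⟩ := hT.e_mem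
  obtain ⟨i, rfl⟩ := hgc
  exact ((Commute.refl c).zpow_left i).zpow_right j

end TwoFrame

variable [Finite X]

theorem exists_hom_eq_neg_one (hX : RankOneGroup X) (S : Sylow 2 X) {c e s g : X}
    (hT : TwoFrame (S : Subgroup X) c e s) (hg : g ∈ S)
    (hno : ∀ h : X, h⁻¹ * g * h ∉ Subgroup.zpowers c) : ∃ φ : X →* ℤˣ, φ g = -1 := by
  classical
  have hp2 := Fact.mk Nat.prime_two
  have := Fintype.ofFinite (X ⧸ Subgroup.zpowers c)
  have hgc : g ∉ Subgroup.zpowers c := by simpa using hno 1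
  have hz : orderOf (e ^ 2) = 2 := by rw [orderOf_pow' _ two_ne_zero, hT.orderOf_e]; rfl
  have hg2 := hX.sq_eq_of_orderOf_four hz (hT.orderOf_eq g hg hgc)
  have hzc := hX.mul_comm_of_orderOf_two hz
  refine ⟨Equiv.Perm.sign.comp (MulAction.toPermHom X (X ⧸ Subgroup.zpowers c)), ?_⟩
  rw [MonoidHom.comp_apply, Equiv.Perm.sign_of_pow_two_eq_one]
  · have h0 : Fintype.card (Function.fixedPoints
        (MulAction.toPermHom X (X ⧸ Subgroup.zpowers c) g)) = 0 := by
      rw [Fintype.card_eq_zero_iff]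
      refine ⟨fun ⟨q, hq⟩ => ?_⟩
      obtain ⟨h, rfl⟩ := QuotientGroup.mk_surjective q
      have hq' : ((g * h : X) : X ⧸ Subgroup.zpowers c) = h := hq
      rw [eq_comm, QuotientGroup.eq, ← mul_assoc] at hq'
      exact hno h hq'
    have h1 : Fintype.card (X ⧸ Subgroup.zpowers c) = 2 * (S : Subgroup X).index := by
      rw [← Nat.card_eq_fintype_card]
      have h2 := (Subgroup.zpowers c).card_mul_index
      rw [← (S : Subgroup X).card_mul_index, hT.card_eq, mul_comm 2, mul_assoc] at h2
      exact Nat.eq_of_mul_eq_mul_left Nat.card_pos h2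
    rw [h0, h1, Nat.sub_zero, Nat.mul_div_cancel_left _ two_pos]
    exact Odd.neg_one_pow (Nat.not_even_iff_odd.1 fun h => S.not_dvd_index h.two_dvd)
  · rw [← map_pow, hg2]
    ext q
    obtain ⟨h, rfl⟩ := QuotientGroup.mk_surjective q
    change ((e ^ 2 * h : X) : X ⧸ Subgroup.zpowers c) = h
    rw [← hzc, eq_comm, QuotientGroup.eq, inv_mul_cancel_left]
    exact pow_mem hT.e_mem 2

namespace TwoFrame

theorem conj_of_forall_conj (hX : RankOneGroup X) (S : Sylow 2 X) {c e s : X}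
    (hT : TwoFrame (S : Subgroup X) c e s)
    (hcon : ∀ g ∈ S, g ∉ Subgroup.zpowers c → ∃ h : X, h⁻¹ * g * h ∈ Subgroup.zpowers c)
    {a : X} (ha : orderOf a = 4) : ∃ g : X, g * a * g⁻¹ = e := by
  have hp2 := Fact.mk Nat.prime_two
  have hz : orderOf (e ^ 2) = 2 := by rw [orderOf_pow' _ two_ne_zero, hT.orderOf_e]; rfl
  have key {g : X} (h : g * a * g⁻¹ ∈ Subgroup.zpowers c) : ∃ g : X, g * a * g⁻¹ = e := by
    rcases hX.eq_or_eq_inv_of_commute hz hT.orderOf_e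
      ((FixedPointFreeRep.orderOf_conj g a).trans ha) (hT.commute_of_mem h).symm with h1 | h1
    · exact ⟨g, h1⟩
    · refine ⟨s * g, ?_⟩
      have h2 := hT.conj_e hT.s_mem hT.s_notMem
      calc s * g * a * (s * g)⁻¹ = s * (g * a * g⁻¹) * s⁻¹ := by group
        _ = (s * e * s⁻¹)⁻¹ := by rw [h1]; group
        _ = e := by rw [h2, inv_inv]
  obtain ⟨n, -, hn⟩ := S.exists_conj_mem_of_le le_top (Subgroup.mem_top a) (m := 2) ha
  by_cases h : n * a * n⁻¹ ∈ Subgroup.zpowers c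
  · exact key h
  · obtain ⟨h, hh⟩ := hcon _ hn h
    exact key (g := h⁻¹ * n) (by convert hh using 1; group)

theorem pair_conj (hX : RankOneGroup X) (S : Sylow 2 X) {c e s : X}
    (hT : TwoFrame (S : Subgroup X) c e s)
    (hcon : ∀ g ∈ S, g ∉ Subgroup.zpowers c → ∃ h : X, h⁻¹ * g * h ∈ Subgroup.zpowers c)
    {a b : X} (ha : orderOf a = 4) (hb : orderOf b = 4) (hab : b * a * b⁻¹ = a⁻¹) :
    ∃ g : X, g * a * g⁻¹ = e ∧ (g * b * g⁻¹ = s ∨ g * b * g⁻¹ = c * s) := by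
  have hp2 := Fact.mk Nat.prime_two
  have hse := hT.conj_e hT.s_mem hT.s_notMem
  obtain ⟨g, hg⟩ := conj_of_forall_conj hX S hT hcon ha
  have hbe : (g * b * g⁻¹) * e * (g * b * g⁻¹)⁻¹ = e⁻¹ := by
    calc (g * b * g⁻¹) * e * (g * b * g⁻¹)⁻¹ = g * (b * a * b⁻¹) * g⁻¹ := by rw [← hg]; group
      _ = (g * a * g⁻¹)⁻¹ := by rw [hab]; group
      _ = e⁻¹ := by rw [hg]
  let N : Subgroup X :=
    { carrier := {g | g * e * g⁻¹ = e ∨ g * e * g⁻¹ = e⁻¹}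
      one_mem' := by simp
      mul_mem' := by
        rintro x y hx hy
        have h : x * y * e * (x * y)⁻¹ = x * (y * e * y⁻¹) * x⁻¹ := by group
        rw [Set.mem_ofPred_eq, h]
        rcases hx with hx | hx <;> rcases hy with hy | hy <;> rw [hy] <;>
          simp only [← conj_inv, hx, inv_inv, true_or, or_true]
      inv_mem' := by
        rintro x (hx | hx)
        · exact Or.inl (by nth_rw 1 [← hx]; group)
        · refine Or.inr ?_
          have h : e = x⁻¹ * e⁻¹ * x := by rw [← hx]; group
          nth_rw 2 [h]
          group }
  have hSN : (S : Subgroup X) ≤ N := by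
    intro g hg
    by_cases h : g ∈ Subgroup.zpowers c
    · exact Or.inl (mul_inv_eq_iff_eq_mul.2 (hT.commute_of_mem h))
    · exact Or.inr (hT.conj_e hg h)
  obtain ⟨n, hnN, hn⟩ := S.exists_conj_mem_of_le hSN (b := g * b * g⁻¹) (Or.inr hbe) (m := 2)
    ((FixedPointFreeRep.orderOf_conj g b).trans hb)
  obtain ⟨k, hke, hkS⟩ : ∃ k, k * e * k⁻¹ = e ∧ k * (g * b * g⁻¹) * k⁻¹ ∈ (S : Subgroup X) := by
    rcases hnN with h | h
    · exact ⟨n, h, hn⟩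
    · refine ⟨s * n, ?_, ?_⟩
      · calc s * n * e * (s * n)⁻¹ = s * (n * e * n⁻¹) * s⁻¹ := by group
          _ = (s * e * s⁻¹)⁻¹ := by rw [h]; group
          _ = e := by rw [hse, inv_inv]
      · have := Subgroup.mul_mem _ (Subgroup.mul_mem _ hT.s_mem hn) (inv_mem hT.s_mem)
        convert this using 1
        group
  set b' := k * (g * b * g⁻¹) * k⁻¹ with hb'
  have hb'e : b' * e * b'⁻¹ = e⁻¹ := by
    calc b' * e * b'⁻¹ = k * ((g * b * g⁻¹) * (k⁻¹ * e * k) * (g * b * g⁻¹)⁻¹) * k⁻¹ := by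
          rw [hb']; group
      _ = k * ((g * b * g⁻¹) * e * (g * b * g⁻¹)⁻¹) * k⁻¹ := by
          congr 4
          nth_rw 1 [← hke]
          group
      _ = (k * e * k⁻¹)⁻¹ := by rw [hbe]; group
      _ = e⁻¹ := by rw [hke]
  have hb'c : b' ∉ Subgroup.zpowers c := fun h => by
    rw [mul_inv_eq_iff_eq_mul.2 (hT.commute_of_mem h)] at hb'e
    have h2 : e ^ 2 = 1 := by rw [pow_two]; nth_rw 1 [hb'e]; group
    have := orderOf_dvd_of_pow_eq_one h2
    rw [hT.orderOf_e] at this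
    exact absurd this (by norm_num)
  obtain ⟨j, hj⟩ := hT.mul_mem b' hkS hb'c
  change c ^ j = b' * s⁻¹ at hj
  have hj' : b' = c ^ j * s := by rw [hj, inv_mul_cancel_right]
  have hsc (i : ℤ) : s * c ^ i = c ^ (-i) * s := by
    rw [← mul_inv_eq_iff_eq_mul, ← conj_zpow, hT.conj_eq s hT.s_mem hT.s_notMem, inv_zpow,
      zpow_neg]
  have hci (i : ℤ) : c ^ i * b' * (c ^ i)⁻¹ = c ^ (j + 2 * i) * s := by
    rw [hj', ← zpow_neg, mul_assoc, mul_assoc, hsc, ← mul_assoc, ← mul_assoc, ← zpow_add,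
      ← zpow_add]
    congr 2; ring
  have hce (i : ℤ) : c ^ i * e * (c ^ i)⁻¹ = e :=
    mul_inv_eq_iff_eq_mul.2 (hT.commute_of_mem ⟨i, rfl⟩)
  have hfin (i : ℤ) : (c ^ i * k * g) * a * (c ^ i * k * g)⁻¹ = e ∧
      (c ^ i * k * g) * b * (c ^ i * k * g)⁻¹ = c ^ (j + 2 * i) * s := by
    constructor
    · calc (c ^ i * k * g) * a * (c ^ i * k * g)⁻¹
          = c ^ i * (k * (g * a * g⁻¹) * k⁻¹) * (c ^ i)⁻¹ := by group
        _ = e := by rw [hg, hke, hce]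
    · rw [← hci, hb']; group
  rcases Int.even_or_odd' j with ⟨i, hi | hi⟩
  · refine ⟨_, (hfin (-i)).1, Or.inl ?_⟩
    rw [(hfin (-i)).2, hi, show 2 * i + 2 * -i = 0 by ring, zpow_zero, one_mul]
  · refine ⟨_, (hfin (-i)).1, Or.inr ?_⟩
    rw [(hfin (-i)).2, hi, show 2 * i + 1 + 2 * -i = 1 by ring, zpow_one]

end TwoFrame

theorem exists_hom_of_not_isCyclic (hX : RankOneGroup X) (h3 : ¬ 3 ∣ Nat.card X) (S : Sylow 2 X)
    (hS : ¬ IsCyclic S) : ∃ (φ : X →* ℤˣ) (g : X), φ g = -1 := by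
  have hp2 := Fact.mk Nat.prime_two
  obtain ⟨N, hN⟩ := S.2.exists_card_eq
  obtain ⟨c, e, s, hT⟩ := hX.exists_twoFrame S hN hS
  by_contra hcontra
  have hcon : ∀ g ∈ S, g ∉ Subgroup.zpowers c → ∃ h : X, h⁻¹ * g * h ∈ Subgroup.zpowers c := by
    intro g hg _
    by_contra! hno
    obtain ⟨φ, hφ⟩ := hX.exists_hom_eq_neg_one S hT hg hno
    exact hcontra ⟨φ, g, hφ⟩
  have hz : orderOf (e ^ 2) = 2 := by rw [orderOf_pow' _ two_ne_zero, hT.orderOf_e]; rfl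
  have hso := hT.orderOf_eq s hT.s_mem hT.s_notMem
  have hse := hT.conj_e hT.s_mem hT.s_notMem
  have hs2 := hX.sq_eq_of_orderOf_four hz hso
  have hesmem : e * s ∉ Subgroup.zpowers c := fun h =>
    hT.s_notMem ((Subgroup.mul_mem_cancel_left _ hT.e_mem).1 h)
  have hesS : e * s ∈ (S : Subgroup X) := Subgroup.mul_mem _
    ((Subgroup.zpowers_le.2 hT.c_mem) hT.e_mem) hT.s_mem
  have heso := hT.orderOf_eq _ hesS hesmem
  have hse' : s * e = e⁻¹ * s := mul_inv_eq_iff_eq_mul.1 hse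
  have hses : s * (e * s) = e := by
    rw [← mul_assoc, hse', mul_assoc, ← pow_two, hs2, pow_two, inv_mul_cancel_left]
  have hes : e * s * e⁻¹ = s⁻¹ := by
    have heses : e * s * e = s := by rw [mul_assoc, hse', mul_inv_cancel_left]
    have h : e * s * e⁻¹ = (e * s * e) * (e ^ 2)⁻¹ := by group
    rw [h, heses, ← hs2]
    group
  obtain ⟨g, hge, hgs⟩ : ∃ g : X, g * e * g⁻¹ = s ∧ g * s * g⁻¹ = e * s := by
    have tr {g h a a' x : X} (hg : g * a * g⁻¹ = x) (hh : h * a' * h⁻¹ = x) :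
        (h⁻¹ * g) * a * (h⁻¹ * g)⁻¹ = a' := by
      rw [← hh] at hg
      calc (h⁻¹ * g) * a * (h⁻¹ * g)⁻¹ = h⁻¹ * (g * a * g⁻¹) * h := by group
        _ = a' := by rw [hg]; group
    obtain ⟨g₀, h₀, h₀'⟩ := TwoFrame.pair_conj hX S hT hcon hT.orderOf_e hso hse
    obtain ⟨g₁, h₁, h₁'⟩ := TwoFrame.pair_conj hX S hT hcon hso heso (by rw [← hes]; group)
    obtain ⟨g₂, h₂, h₂'⟩ := TwoFrame.pair_conj hX S hT hcon heso hT.orderOf_e (by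
      rw [mul_assoc, hes, mul_inv_rev, eq_inv_mul_iff_mul_eq, ← mul_assoc, hse])
    have c01 {x : X} (h : g₀ * s * g₀⁻¹ = x) (h' : g₁ * (e * s) * g₁⁻¹ = x) :
        ∃ g : X, g * e * g⁻¹ = s ∧ g * s * g⁻¹ = e * s := ⟨_, tr h₀ h₁, tr h h'⟩
    have c12 {x : X} (h : g₁ * (e * s) * g₁⁻¹ = x) (h' : g₂ * e * g₂⁻¹ = x) :
        ∃ g : X, g * e * g⁻¹ = s ∧ g * s * g⁻¹ = e * s := by
      refine ⟨_, ?_, tr h₁ h₂⟩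
      set k := g₂⁻¹ * g₁
      calc k * e * k⁻¹ = (k * (e * s) * k⁻¹) * (k * s * k⁻¹)⁻¹ := by group
        _ = (e * s * e⁻¹)⁻¹ := by rw [tr h h', tr h₁ h₂]; group
        _ = s := by rw [hes, inv_inv]
    have c20 {x : X} (h : g₂ * e * g₂⁻¹ = x) (h' : g₀ * s * g₀⁻¹ = x) :
        ∃ g : X, g * e * g⁻¹ = s ∧ g * s * g⁻¹ = e * s := by
      refine ⟨_, tr h h', ?_⟩
      set k := g₀⁻¹ * g₂
      calc k * s * k⁻¹ = (k * e * k⁻¹)⁻¹ * (k * (e * s) * k⁻¹) := by group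
        _ = e * s := by rw [tr h h', tr h₂ h₀, inv_mul_eq_iff_eq_mul, hses]
    rcases h₀' with h₀' | h₀' <;> rcases h₁' with h₁' | h₁' <;> rcases h₂' with h₂' | h₂'
    · exact c01 h₀' h₁'
    · exact c01 h₀' h₁'
    · exact c20 h₂' h₀'
    · exact c12 h₁' h₂'
    · exact c12 h₁' h₂'
    · exact c20 h₂' h₀'
    · exact c01 h₀' h₁'
    · exact c01 h₀' h₁'
  have hg3 : g ^ 3 * e * (g ^ 3)⁻¹ = e := by
    calc g ^ 3 * e * (g ^ 3)⁻¹ = g * (g * (g * e * g⁻¹) * g⁻¹) * g⁻¹ := by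
          simp only [pow_succ, pow_zero, one_mul, mul_inv_rev, mul_assoc]
      _ = g * (e * s) * g⁻¹ := by rw [hge, hgs]
      _ = (g * e * g⁻¹) * (g * s * g⁻¹) := by group
      _ = e := by rw [hge, hgs, hses]
  have hco : Nat.Coprime 3 (orderOf g) := (Nat.Prime.coprime_iff_not_dvd Nat.prime_three).2
    fun h => h3 (h.trans (orderOf_dvd_natCard g))
  obtain ⟨m, hm⟩ := exists_pow_eq_self_of_coprime hco
  have hcomm : Commute g e := by
    rw [← hm]
    exact Commute.pow_left (mul_inv_eq_iff_eq_mul.1 hg3) m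
  rw [hcomm.eq, mul_inv_cancel_right] at hge
  exact hT.s_notMem (hge ▸ hT.e_mem)

theorem isSolvable_of_not_three_dvd (n : ℕ) :
    ∀ {X : Type*} [Group X] [Finite X] (_ : RankOneGroup X) (_ : ¬ 3 ∣ Nat.card X)
      (_ : Nat.card X ≤ n), Group.IsSolvable X := by
  induction n with
  | zero => exact fun _ _ h => absurd h (Nat.not_le.2 Nat.card_pos)
  | succ n ih =>
    intro X _ _ hX h3 hn
    have hp2 := Fact.mk Nat.prime_two
    by_cases hS : ∃ S : Sylow 2 X, ¬ IsCyclic S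
    · obtain ⟨S, hS⟩ := hS
      obtain ⟨φ, g, hg⟩ := hX.exists_hom_of_not_isCyclic h3 S hS
      have hlt : Nat.card φ.ker < Nat.card X := by
        refine lt_of_le_of_ne (Subgroup.card_le_card_group _) fun h => ?_
        have := Subgroup.eq_top_of_card_eq _ h
        have hg' : g ∈ φ.ker := this ▸ Subgroup.mem_top g
        rw [MonoidHom.mem_ker, hg] at hg'
        exact absurd hg' (by decide)
      have := ih (hX.subgroup φ.ker) (fun h => h3 (h.trans (Subgroup.card_subgroup_dvd_card _)))
        (by omega)
      exact Group.isSolvable_of_ker_le_range φ.ker.subtype φ (by simp)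
    · push Not at hS
      have : IsZGroup X := by
        refine ⟨fun p hp P => ?_⟩
        have := Fact.mk hp
        rcases hp.eq_two_or_odd' with rfl | hodd
        · exact hS P
        · obtain ⟨N, hN⟩ := P.2.exists_card_eq
          exact isCyclic_of_odd_prime hp hodd N (hX.subgroup P) hN
      infer_instance

end RankOneGroup

theorem Equiv.Perm.isSolvable_of_card_eq_four {α : Type*} [Fintype α] [DecidableEq α]
    (h : Nat.card α = 4) : Group.IsSolvable (Equiv.Perm α) := by
  have hk := alternatingGroup.kleinFour_isKleinFour h
  have h1 : Group.IsSolvable (alternatingGroup.kleinFour α) :=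
    Group.isSolvable_of_comm fun a b => mul_comm_of_exponent_two hk.exponent_two a b
  have h2 : Group.IsSolvable (alternatingGroup α) := by
    refine Group.isSolvable_of_ker_le_range (alternatingGroup.kleinFour α).subtype
      (Abelianization.of (G := alternatingGroup α)) ?_
    rw [Abelianization.ker_of, Subgroup.range_subtype,
      alternatingGroup.kleinFour_eq_commutator h]
  refine Group.isSolvable_of_ker_le_range (alternatingGroup α).subtype Equiv.Perm.sign ?_
  rw [Subgroup.range_subtype]
  exact le_rfl

namespace Subgroup

variable {X : Type*} [Group X]

theorem isSolvable_of_inf_centralizer {L : Subgroup X} {x : X}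
    (hL : ∀ g ∈ L, g * x * g⁻¹ ∈ zpowers x)
    (hs : Group.IsSolvable (L ⊓ centralizer {x} : Subgroup X)) : Group.IsSolvable L := by
  have hle : L ≤ normalizer (zpowers x : Set X) := by
    have h1 (g : X) (hg : g ∈ L) : ∀ h ∈ zpowers x, g * h * g⁻¹ ∈ zpowers x := by
      rintro _ ⟨j, rfl⟩
      change g * x ^ j * g⁻¹ ∈ _
      rw [← conj_zpow]
      exact zpow_mem (hL g hg) j
    intro g hg
    rw [mem_normalizer_iff]
    refine fun h => ⟨h1 g hg h, fun hh => ?_⟩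
    have := h1 _ (inv_mem hg) _ hh
    convert this using 1
    group
  have : Group.IsSolvable (MulAut (zpowers x)) :=
    Group.isSolvable_of_isSolvable_injective
      (f := (IsCyclic.mulAutMulEquiv (zpowers x)).toMonoidHom)
      (IsCyclic.mulAutMulEquiv (zpowers x)).injective
  refine Group.isSolvable_of_ker_le_range
    (inclusion (inf_le_left : L ⊓ centralizer {x} ≤ L))
    ((zpowers x).normalizerMonoidHom.comp (inclusion hle)) fun g hg => ?_
  rw [MonoidHom.mem_ker, MonoidHom.comp_apply, ← MonoidHom.mem_ker, normalizerMonoidHom_ker,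
    mem_subgroupOf, mem_centralizer_iff] at hg
  exact ⟨⟨g, g.2, mem_centralizer_singleton_iff.2 (hg x (mem_zpowers x)).symm⟩, rfl⟩

end Subgroup

open scoped IsMulCommutative in
theorem Subgroup.exists_hom_ne_one_of_central {X : Type*} [Group X] (P : Subgroup X)
    [P.FiniteIndex] [IsMulCommutative P] {x : X} (hx : ∀ g, g * x = x * g)
    (hne : x ^ P.index ≠ 1) : ∃ φ : X →* P, φ x ≠ 1 := by
  refine ⟨MonoidHom.transfer (MonoidHom.id P), ?_⟩
  rw [MonoidHom.transfer_eq_pow]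
  · exact fun h => hne (congrArg Subtype.val h)
  · intro k g _
    have : Commute g (x ^ k) := Commute.pow_right (hx g) k
    rw [mul_assoc, ← this.eq, inv_mul_cancel_left]

namespace RankOneGroup

variable {X : Type*} [Group X] [Finite X]

theorem isSolvable_of_no_orderOf_three (hX : RankOneGroup X) (h : ∀ x : X, orderOf x ≠ 3) :
    Group.IsSolvable X := by
  refine isSolvable_of_not_three_dvd _ hX (fun h3 => ?_) le_rfl
  have := Fact.mk Nat.prime_three
  obtain ⟨x, hx⟩ := exists_prime_orderOf_dvd_card' (G := X) 3 h3
  exact h x hx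

theorem isSolvable_of_central_three (hX : RankOneGroup X) {x : X} (hx : orderOf x = 3)
    (hxc : ∀ g, g * x = x * g) : Group.IsSolvable X := by
  have hp3 := Fact.mk Nat.prime_three
  obtain ⟨P⟩ := Sylow.nonempty (p := 3) (G := X)
  obtain ⟨N, hN⟩ := P.2.exists_card_eq
  have hP : IsCyclic P := isCyclic_of_odd_prime Nat.prime_three (by decide) N (hX.subgroup P) hN
  obtain ⟨φ, hφ⟩ := (P : Subgroup X).exists_hom_ne_one_of_central hxc fun h =>
    P.not_dvd_index (hx.symm.dvd.trans (orderOf_dvd_of_pow_eq_one h))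
  have hker : Group.IsSolvable φ.ker := by
    refine (hX.subgroup φ.ker).isSolvable_of_no_orderOf_three fun g hg => hφ ?_
    rw [← Subgroup.orderOf_coe] at hg
    have := hX.zpowers_eq (a := x) (b := g) (hx ▸ Nat.prime_three) (hg.trans hx.symm) (hxc g).symm
    have hxg : x ∈ Subgroup.zpowers (g : X) := this ▸ Subgroup.mem_zpowers x
    exact (Subgroup.zpowers_le.2 g.2) hxg
  have : Group.IsSolvable P := Group.isSolvable_of_comm mul_comm'
  exact Group.isSolvable_of_ker_le_range φ.ker.subtype φ (by simp)

theorem isSolvable_of_three_commute (hX : RankOneGroup X)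
    (h : ∀ x y : X, orderOf x = 3 → orderOf y = 3 → x * y = y * x) : Group.IsSolvable X := by
  by_cases h3 : ∀ x : X, orderOf x ≠ 3
  · exact hX.isSolvable_of_no_orderOf_three h3
  · push Not at h3
    obtain ⟨x, hx⟩ := h3
    have h1 : Group.IsSolvable (⊤ : Subgroup X) := by
      refine Subgroup.isSolvable_of_inf_centralizer (x := x) (fun g _ => ?_) ?_
      · have hg := (FixedPointFreeRep.orderOf_conj g x).trans hx
        exact hX.mem_zpowers x _ (hx ▸ Nat.prime_three) (hg.trans hx.symm) (h _ _ hx hg)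
      · rw [top_inf_eq]
        have hxm : x ∈ Subgroup.centralizer {x} := Subgroup.mem_centralizer_singleton_iff.2 rfl
        refine (hX.subgroup (Subgroup.centralizer {x})).isSolvable_of_central_three (x := ⟨x, hxm⟩)
          (by rw [Subgroup.orderOf_mk, hx]) fun g => Subtype.ext ?_
        exact Subgroup.mem_centralizer_singleton_iff.1 g.2
    exact Group.isSolvable_of_isSolvable_injective
      (f := (Subgroup.topEquiv (G := X)).symm.toMonoidHom) Subgroup.topEquiv.symm.injective

open scoped Pointwise in
theorem isSolvable_of_four_classes (hX : RankOneGroup X) {x y : X} (hx : orderOf x = 3)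
    (hy : orderOf y = 3) (hxy : x * y ≠ y * x) (f : X → Bool × Bool)
    (hf : ∀ g h, orderOf g = 3 → orderOf h = 3 → f g = f h →
      Subgroup.zpowers g = Subgroup.zpowers h) : Group.IsSolvable X := by
  let Ω := {T : Subgroup X // ∃ g, orderOf g = 3 ∧ T = Subgroup.zpowers g}
  let act : MulAction X Ω :=
    { smul := fun g T => ⟨MulAut.conj g • T.1, by
        obtain ⟨_, h, hh, rfl⟩ := T
        refine ⟨g * h * g⁻¹, (FixedPointFreeRep.orderOf_conj g h).trans hh, ?_⟩
        exact MonoidHom.map_zpowers (MulAut.conj g).toMonoidHom h⟩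
      one_smul := fun T => Subtype.ext (by
        change MulAut.conj 1 • T.1 = T.1
        rw [map_one, one_smul])
      mul_smul := fun a b T => Subtype.ext (by
        change MulAut.conj (a * b) • T.1 = MulAut.conj a • MulAut.conj b • T.1
        rw [map_mul, mul_smul]) }
  let F : Ω ↪ Bool × Bool := ⟨fun T => f T.2.choose, fun T T' h => Subtype.ext (by
    rw [T.2.choose_spec.2, T'.2.choose_spec.2]
    exact hf _ _ T.2.choose_spec.1 T'.2.choose_spec.1 h)⟩
  have h4 : Group.IsSolvable (Equiv.Perm (Bool × Bool)) :=
    Equiv.Perm.isSolvable_of_card_eq_four (by simp)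
  have hΩ : Group.IsSolvable (Equiv.Perm Ω) :=
    Group.isSolvable_of_isSolvable_injective (Equiv.Perm.viaEmbeddingHom_injective F)
  let φ := MulAction.toPermHom X Ω
  have hφ {w : X} (hw : orderOf w = 3) {g : X} (hg : g ∈ φ.ker) :
      g * w * g⁻¹ ∈ Subgroup.zpowers w := by
    have h1 : φ g ⟨Subgroup.zpowers w, w, hw, rfl⟩ = ⟨Subgroup.zpowers w, w, hw, rfl⟩ := by
      rw [MonoidHom.mem_ker.1 hg]; rfl
    have h2 : MulAut.conj g • Subgroup.zpowers w = Subgroup.zpowers w := congrArg Subtype.val h1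
    have h3 := Subgroup.smul_mem_pointwise_smul w (MulAut.conj g) _ (Subgroup.mem_zpowers w)
    rw [h2] at h3
    exact h3
  have hker : Group.IsSolvable φ.ker := by
    refine Subgroup.isSolvable_of_inf_centralizer (x := x) (fun g hg => hφ hx hg) ?_
    refine Subgroup.isSolvable_of_inf_centralizer (x := y) (fun g hg => hφ hy hg.1) ?_
    refine (hX.subgroup _).isSolvable_of_no_orderOf_three fun g hg => ?_
    rw [← Subgroup.orderOf_coe] at hg
    have hgx := Subgroup.mem_centralizer_singleton_iff.1 g.2.1.2
    have hgy := Subgroup.mem_centralizer_singleton_iff.1 g.2.2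
    obtain ⟨i, hi⟩ := hX.mem_zpowers g x (hg ▸ Nat.prime_three) (hx.trans hg.symm) hgx
    obtain ⟨j, hj⟩ := hX.mem_zpowers g y (hg ▸ Nat.prime_three) (hy.trans hg.symm) hgy
    have hc : Commute ((g : X) ^ i) ((g : X) ^ j) := Commute.zpow_zpow_self _ i j
    exact hxy (by rwa [show (g : X) ^ i = x from hi, show (g : X) ^ j = y from hj] at hc)
  exact Group.isSolvable_of_ker_le_range φ.ker.subtype φ (by simp)

end RankOneGroup

theorem eq_or_eq_neg_of_signs {C : Type*} [Ring C] (h : (1 : C) ≠ -1) {a b c a' b' c' : C}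
    (ha : a = 1 ∨ a = -1) (hb : b = 1 ∨ b = -1) (hc : c = 1 ∨ c = -1)
    (ha' : a' = 1 ∨ a' = -1) (hb' : b' = 1 ∨ b' = -1) (hc' : c' = 1 ∨ c' = -1)
    (h1 : a = b ↔ a' = b') (h2 : b = c ↔ b' = c') :
    (a' = a ∧ b' = b ∧ c' = c) ∨ (a' = -a ∧ b' = -b ∧ c' = -c) := by
  have h' := h.symm
  rcases ha with rfl | rfl <;> rcases hb with rfl | rfl <;> rcases hc with rfl | rfl <;>
    rcases ha' with rfl | rfl <;> rcases hb' with rfl | rfl <;> rcases hc' with rfl | rfl <;>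
    first
    | exact Or.inl ⟨rfl, rfl, rfl⟩
    | (refine Or.inr ⟨?_, ?_, ?_⟩ <;> first | rfl | exact (neg_neg _).symm)
    | exact absurd (h1.1 rfl) h
    | exact absurd (h1.1 rfl) h'
    | exact absurd (h1.2 rfl) h
    | exact absurd (h1.2 rfl) h'
    | exact absurd (h2.1 rfl) h
    | exact absurd (h2.1 rfl) h'
    | exact absurd (h2.2 rfl) h
    | exact absurd (h2.2 rfl) h'

namespace FixedPointFreeRep

variable {H W : Type*} [Group H] [Finite H] [AddCommGroup W] [Module ℚ W] [FiniteDimensional ℚ W]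
  [Nontrivial W] {ρ : H →* Module.End ℚ W}

theorem isSolvable_of_isTetra (hρ : FixedPointFreeRep ρ) {x y s t : H} (hx : orderOf x = 3)
    (hy : orderOf y = 3) (hxy : x * y ≠ y * x) (hs : ρ s * ρ s = -1) (ht : ρ t * ρ t = -1)
    (hst : ρ t * ρ s = -(ρ s * ρ t)) (h : ∀ w ∈ threeSet ρ s t, NQuat.IsTetra w) :
    Group.IsSolvable H := by
  classical
  choose v hv using fun g => NQuat.toRing_surjective hs ht hst (ρ g + ρ g + 1)
  refine hρ.rankOneGroup.isSolvable_of_four_classes hx hy hxy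
    (fun g => (decide ((v g).i = (v g).j), decide ((v g).j = (v g).k))) fun g g' hg hg' he => ?_
  obtain ⟨hr, hi, hj, hk⟩ := h (v g) ⟨g, hg, hv g⟩
  obtain ⟨hr', hi', hj', hk'⟩ := h (v g') ⟨g', hg', hv g'⟩
  have h2 : (1 : Subalgebra.centralizer ℚ {ρ s, ρ t}) ≠ -1 := by
    intro h1
    have h3 : (1 : Module.End ℚ W) = -1 := congrArg Subtype.val h1
    have := algebraRat.charZero (Module.End ℚ W)
    have h4 : (2 : Module.End ℚ W) = 0 := by
      rw [← one_add_one_eq_two]; nth_rw 1 [h3]; exact neg_add_cancel 1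
    exact two_ne_zero h4
  have halve {a b : Module.End ℚ W} (hab : a + a = b + b) : a = b := by
    rw [← two_smul ℚ a, ← two_smul ℚ b] at hab
    exact smul_right_injective _ (two_ne_zero : (2 : ℚ) ≠ 0) hab
  rw [Prod.mk.injEq, decide_eq_decide, decide_eq_decide] at he
  rcases eq_or_eq_neg_of_signs h2 hi hj hk hi' hj' hk' he.1 he.2 with ⟨e1, e2, e3⟩ | ⟨e1, e2, e3⟩
  · have hvv : v g' = v g := NQuat.ext (hr'.trans hr.symm) e1 e2 e3
    have h3 := hv g'
    rw [hvv, hv g] at h3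
    have h4 : ρ g = ρ g' := halve (add_right_cancel h3)
    rw [hρ.injective h4]
  · have hvv : v g' = -v g := NQuat.ext (by rw [hr']; exact (neg_eq_zero.2 hr).symm) e1 e2 e3
    have h3 := hv g'
    rw [hvv, NQuat.toRing_neg, hv g] at h3
    have h4 : ρ g⁻¹ = ρ g' := by
      rw [hρ.inv_of_orderOf_three hg]
      refine halve (add_right_cancel (b := 1) ?_)
      rw [← h3]
      abel
    rw [← hρ.injective h4, Subgroup.zpowers_inv]

end FixedPointFreeRep

/-- Theorem B: an insoluble finite Frobenius group has perfect order classes iff its kernel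
is homocyclic of rank 2 over `11^k` and its complement is `SL(2,5)`. -/
theorem insoluble_frobenius_perfectOrderClasses_iff
    {G : Type*} [Group G] [Fintype G] (K H : Subgroup G)
    (hFrob : IsFrobeniusWith K H) (hinsol : ¬ IsSolvable G) :
    PerfectOrderClasses G ↔
      ∃ k : ℕ, 0 < k ∧
        Nonempty (K ≃* (Fin 2 → Multiplicative (ZMod (11 ^ k)))) ∧
        Nonempty (H ≃* Matrix.SpecialLinearGroup (Fin 2) (ZMod 5)) := by
  refine ⟨fun hP => ?_, fun ⟨k, _, ⟨eK⟩, ⟨eH⟩⟩ => perfectOrderClasses_of_homocyclic hFrob eK eH⟩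
  have hPH := hFrob.perfectOrderClasses_compl hP
  have hc : ∀ a b : K, a * b = b * a :=
    have := hFrob.nontrivial_compl
    hFrob.commute_kernel hPH.even_card
  obtain ⟨e⟩ : Nonempty (H ≃* SL25) := by
    obtain ⟨n, ρ, hρ⟩ := hFrob.exists_fixedPointFreeRep hc
    have hHs := hFrob.not_isSolvable_compl hc hinsol
    obtain ⟨x, y, hx, hy, hxy⟩ : ∃ x y : H, orderOf x = 3 ∧ orderOf y = 3 ∧ x * y ≠ y * x := by
      by_contra! h
      exact hHs (hρ.rankOneGroup.isSolvable_of_three_commute h)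
    obtain ⟨s, t, hs, ht, hst, h⟩ | ⟨⟨E⟩⟩ := hρ.tetra_or_icosianFrame hx hy hxy
    · exact absurd (hρ.isSolvable_of_isTetra hx hy hxy hs ht hst h) hHs
    · have := E.group_normal hρ
      obtain ⟨e⟩ := E.nonempty_equiv hρ
      exact hρ.rankOneGroup.nonempty_equiv_of_normal hPH e
  have hH : Nat.card H = 120 := by rw [Nat.card_congr e.toEquiv, sl25_card]
  have := hFrob.nontrivial_kernel
  let _ : CommGroup K := { (inferInstance : Group K) with mul_comm := hc }
  obtain ⟨k, hk, eK⟩ := exists_equiv_homocyclic K (hH ▸ hFrob.coprime)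
    (fun n hn => hH ▸ hFrob.card_dvd_orderCount hn) fun n hn => by
      by_cases h0 : orderCount K n = 0
      · exact Or.inl h0
      · have hHn : orderCount H n = 0 := by_contra fun h => h0 (hFrob.orderCount_compl hn h)
        have hGn := hFrob.orderCount_eq hn
        rw [hHn, mul_zero, add_zero] at hGn
        have hn0 : 0 < n := by
          obtain ⟨g, rfl⟩ := exists_of_orderCount_ne_zero h0
          exact orderOf_pos g
        rw [← hH, hFrob.card_mul, ← hGn]
        exact hP n hn0
  exact ⟨k, hk, eK, ⟨e⟩⟩
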